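/- The category O_c(W) is a highest weight category with respect to the partial order ≤_c on Irr(W), and for each τ ∈ Irr(W) the standard object corresponding to L_c(τ) is the Verma module Δ_c(τ). -/

import Mathlib

/-! Core definitions: complex reflection groups, rational Cherednik algebras,
and their categories 𝒪. -/

noncomputable section

open Module Function

/-- A (complex) reflection: a linear automorphism `g` with `rank (g - 1) = 1`. -/
def IsComplexReflection {V : Type} [AddCommGroup V] [Module ℂ V]
    (g : V ≃ₗ[ℂ] V) : Prop :=
  Module.finrank ℂ (LinearMap.range (g.toLinearMap - LinearMap.id)) = 1

variable (V : Type) [AddCommGroup V] [Module ℂ V] [FiniteDimensional ℂ V]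

/-- A finite complex reflection group on a finite dimensional complex vector
space `V`: a finite subgroup of `GL(V)` generated by its reflections. -/
structure CRG where
  W : Subgroup (V ≃ₗ[ℂ] V)
  finite : Finite W
  gen : Subgroup.closure {g : V ≃ₗ[ℂ] V | g ∈ W ∧ IsComplexReflection g} = W

variable {V}

/-- The set `S` of reflections in `W`. -/
def CRG.Refl (G : CRG V) : Type :=
  {s : G.W // IsComplexReflection (s : V ≃ₗ[ℂ] V)}

instance (G : CRG V) : CoeOut G.Refl G.W := ⟨fun s => s.1⟩

/-- Conjugation invariance of a parameter `c : S → ℂ`. -/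
def IsConjInvariant {G : CRG V} (c : G.Refl → ℂ) : Prop :=
  ∀ s t : G.Refl, (∃ g : G.W, t.1 = g * s.1 * g⁻¹) → c t = c s

/-- For each reflection `s`: eigenvectors `α_s ∈ h*`, `α_s^∨ ∈ h` for `s` with
eigenvalue different from `1`, normalized by `⟨α_s, α_s^∨⟩ = 2`; `lam s` is the
eigenvalue of `s` on `h*` different from `1`. -/
structure ReflData (G : CRG V) where
  α : G.Refl → Module.Dual ℂ V
  αv : G.Refl → V
  lam : G.Refl → ℂ
  lam_ne_one : ∀ s, lam s ≠ 1
  α_ne : ∀ s, α s ≠ 0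
  αv_ne : ∀ s, αv s ≠ 0
  eig_α : ∀ (s : G.Refl) (v : V),
    α s (((s.1 : V ≃ₗ[ℂ] V)).symm v) = lam s * α s v
  eig_αv : ∀ s : G.Refl, ∃ μ : ℂ, μ ≠ 1 ∧ ((s.1 : V ≃ₗ[ℂ] V)) (αv s) = μ • αv s
  pairing : ∀ s, α s (αv s) = 2

/-- The rational Cherednik algebra `H_c(W)`: the quotient of `T(h ⊕ h*)#W` by
the commutation relations, presented via its universal property. -/
structure RCA (G : CRG V) (D : ReflData G) (c : G.Refl → ℂ) where
  H : Type
  [ring : Ring H]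
  [alg : Algebra ℂ H]
  x : Module.Dual ℂ V →ₗ[ℂ] H
  y : V →ₗ[ℂ] H
  w : G.W →* H
  comm_x : ∀ a b, x a * x b = x b * x a
  comm_y : ∀ u v, y u * y v = y v * y u
  w_x : ∀ (g : G.W) (a : Module.Dual ℂ V),
    w g * x a = x (a ∘ₗ (((g⁻¹ : G.W) : V ≃ₗ[ℂ] V) : V →ₗ[ℂ] V)) * w g
  w_y : ∀ (g : G.W) (v : V), w g * y v = y (((g : V ≃ₗ[ℂ] V)) v) * w g
  rel : ∀ (v : V) (a : Module.Dual ℂ V),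
    y v * x a - x a * y v =
      algebraMap ℂ H (a v) -
        ∑ᶠ s : G.Refl, (c s * D.α s v * a (D.αv s)) • w s.1
  universal : ∀ (A : Type) [Ring A] [Algebra ℂ A]
      (xA : Module.Dual ℂ V →ₗ[ℂ] A) (yA : V →ₗ[ℂ] A) (wA : G.W →* A),
      (∀ a b, xA a * xA b = xA b * xA a) →
      (∀ u v, yA u * yA v = yA v * yA u) →
      (∀ (g : G.W) (a : Module.Dual ℂ V),
        wA g * xA a = xA (a ∘ₗ (((g⁻¹ : G.W) : V ≃ₗ[ℂ] V) : V →ₗ[ℂ] V)) * wA g) →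
      (∀ (g : G.W) (v : V), wA g * yA v = yA (((g : V ≃ₗ[ℂ] V)) v) * wA g) →
      (∀ (v : V) (a : Module.Dual ℂ V),
        yA v * xA a - xA a * yA v =
          algebraMap ℂ A (a v) -
            ∑ᶠ s : G.Refl, (c s * D.α s v * a (D.αv s)) • wA s.1) →
      ∃! φ : H →ₐ[ℂ] A,
        (∀ a, φ (x a) = xA a) ∧ (∀ v, φ (y v) = yA v) ∧ (∀ g, φ (w g) = wA g)

attribute [instance] RCA.ring RCA.alg

variable {G : CRG V} {D : ReflData G} {c : G.Refl → ℂ}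

/-- The category `𝒪_c(W)`: modules over `H_c` which are finitely generated and
on which `h` acts locally nilpotently. -/
structure CatO (R : RCA G D c) where
  M : Type
  [ab : AddCommGroup M]
  [mod : Module R.H M]
  locNilp : ∀ m : M, ∃ N : ℕ, ∀ L : List V, L.length = N →
    (L.map fun v => R.y v).prod • m = 0
  fg : Module.Finite R.H M

attribute [instance] CatO.ab CatO.mod

instance catO (R : RCA G D c) : CategoryTheory.Category (CatO R) where
  Hom A B := A.M →ₗ[R.H] B.M
  id A := LinearMap.id
  comp f g := g.comp f
  id_comp f := LinearMap.comp_id f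
  comp_id f := LinearMap.id_comp f
  assoc f g h := (LinearMap.comp_assoc _ _ _).symm

/-- A finite dimensional representation of `W`. -/
structure WRep (G : CRG V) where
  T : Type
  [ab : AddCommGroup T]
  [mod : Module ℂ T]
  [fd : FiniteDimensional ℂ T]
  ρ : G.W →* (T ≃ₗ[ℂ] T)

attribute [instance] WRep.ab WRep.mod WRep.fd

/-- Irreducibility of a representation of `W`. -/
def WRep.IsIrr {G : CRG V} (τ : WRep G) : Prop :=
  Nontrivial τ.T ∧ ∀ U : Submodule ℂ τ.T,
    (∀ (g : G.W) (t : τ.T), t ∈ U → τ.ρ g t ∈ U) → U = ⊥ ∨ U = ⊤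

/-- Isomorphism of representations of `W`. -/
def WRep.Iso {G : CRG V} (τ τ' : WRep G) : Prop :=
  ∃ e : τ.T ≃ₗ[ℂ] τ'.T, ∀ (g : G.W) (t : τ.T), e (τ.ρ g t) = τ'.ρ g (e t)

/-- `M`, together with the lowest weight inclusion `ι : τ → M`, is the Verma
module `Δ_c(τ) = H_c ⊗_{S(h)#W} τ`, presented via its universal property. -/
structure VermaStr (R : RCA G D c) (τ : WRep G) (M : Type) [AddCommGroup M]
    [Module R.H M] where
  ι : τ.T →+ M
  ι_smul : ∀ (a : ℂ) (t : τ.T), ι (a • t) = algebraMap ℂ R.H a • ι t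
  ι_y : ∀ (v : V) (t : τ.T), R.y v • ι t = 0
  ι_w : ∀ (g : G.W) (t : τ.T), R.w g • ι t = ι (τ.ρ g t)
  universal : ∀ (N : Type) [AddCommGroup N] [Module R.H N] (κ : τ.T →+ N),
      (∀ (a : ℂ) (t : τ.T), κ (a • t) = algebraMap ℂ R.H a • κ t) →
      (∀ (v : V) (t : τ.T), R.y v • κ t = 0) →
      (∀ (g : G.W) (t : τ.T), R.w g • κ t = κ (τ.ρ g t)) →
      ∃! φ : M →ₗ[R.H] N, ∀ t, φ (ι t) = κ t

/-- A greatest proper submodule (so the quotient is the unique simple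
quotient). -/
def IsGreatestProper {A : Type} [Ring A] {M : Type} [AddCommGroup M]
    [Module A M] (N : Submodule A M) : Prop :=
  N ≠ ⊤ ∧ ∀ N' : Submodule A M, N' ≠ ⊤ → N' ≤ N

end

section Stmt5
noncomputable section

variable {V : Type} [AddCommGroup V] [Module ℂ V] [FiniteDimensional ℂ V]
variable {G : CRG V} {D : ReflData G} {c : G.Refl → ℂ}

open Module

/-- The Euler element `h = Σ x_i y_i + n/2 − Σ_s (2c(s)/(1−λ_s)) s` of `H_c`. -/
def eulerElt (R : RCA G D c) {n : ℕ} (b : Basis (Fin n) ℂ V) : R.H :=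
  (∑ i, R.x (b.coord i) * R.y (b i)) + ((n : ℂ) / 2) • (1 : R.H)
    - ∑ᶠ s : G.Refl, (2 * c s / (1 - D.lam s)) • R.w s.1

/-- The order `≤_c` on `Irr(W)`: `τ ≤_c ξ` iff `τ ≅ ξ` or `c_τ − c_ξ ∈ ℤ_{>0}`. -/
def cLE {G : CRG V} (cF : WRep G → ℂ) (τ ξ : WRep G) : Prop :=
  τ.Iso ξ ∨ ∃ m : ℕ, 0 < m ∧ cF τ - cF ξ = (m : ℂ)

/-- The strict order: `τ <_c ξ` iff `c_τ − c_ξ ∈ ℤ_{>0}`. -/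
def cLT {G : CRG V} (cF : WRep G → ℂ) (τ ξ : WRep G) : Prop :=
  ∃ m : ℕ, 0 < m ∧ cF τ - cF ξ = (m : ℂ)

/-- `M` lies in the Serre subcategory `𝒪_{≤ τ}` generated by the simples
`L_c(τ')` with `τ' ≤_c τ`: every simple subquotient of `M` is isomorphic to
the simple quotient of a Verma module `Δ_c(τ')` with `τ' ≤_c τ`. -/
def InSerreLE (R : RCA G D c) (cF : WRep G → ℂ) (Vobj : WRep G → CatO R)
    (τ : WRep G) (M : Type) [AddCommGroup M] [Module R.H M] : Prop :=
  ∀ (N : Submodule R.H M) (K : Submodule R.H ↥N),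
    IsSimpleModule R.H (↥N ⧸ K) →
    ∃ τ' : WRep G, τ'.IsIrr ∧ cLE cF τ' τ ∧
      ∃ N' : Submodule R.H (Vobj τ').M, IsGreatestProper N' ∧
        Nonempty ((↥N ⧸ K) ≃ₗ[R.H] ((Vobj τ').M ⧸ N'))

set_option linter.unusedSectionVars false
set_option autoImplicit false

namespace Cherednik

section Polynomials

variable {X : Type} [AddCommGroup X] [Module ℂ X]

variable (X) in
/-- The symmetric algebra of a complex vector space, as a type of its own. -/
def Pol : Type := SymmetricAlgebra ℂ X

instance : CommRing (Pol X) := inferInstanceAs (CommRing (SymmetricAlgebra ℂ X))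

instance : Algebra ℂ (Pol X) := inferInstanceAs (Algebra ℂ (SymmetricAlgebra ℂ X))

/-- The inclusion of the generators into the symmetric algebra. -/
def polι : X →ₗ[ℂ] Pol X := SymmetricAlgebra.ι ℂ X

theorem pol_induction {motive : Pol X → Prop}
    (algebraMap : ∀ r, motive (algebraMap ℂ (Pol X) r)) (ι : ∀ x, motive (polι x))
    (mul : ∀ a b, motive a → motive b → motive (a * b))
    (add : ∀ a b, motive a → motive b → motive (a + b)) (a : Pol X) : motive a :=
  SymmetricAlgebra.induction ℂ X (motive := motive) algebraMap ι mul add a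

instance [FiniteDimensional ℂ X] : IsNoetherianRing (Pol X) :=
  isNoetherianRing_of_ringEquiv _
    (SymmetricAlgebra.equivMvPolynomial (Module.finBasis ℂ X)).symm.toRingEquiv

theorem exists_polLift {A : Type} [Ring A] [Algebra ℂ A] (f : X →ₗ[ℂ] A)
    (hf : ∀ a b, f a * f b = f b * f a) : ∃ F : Pol X →ₐ[ℂ] A, ∀ a, F (polι a) = f a := by
  refine ⟨RingCon.liftₐ (TensorAlgebra.symRingCon ℂ X) (TensorAlgebra.lift ℂ f) ?_, fun a => ?_⟩
  · refine RingCon.ringConGen_le.2 fun x y h => ?_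
    induction h with
    | mul_comm x y =>
      rw [RingCon.ker_apply]
      simpa using hf x y
  · refine (RingCon.liftₐ_mk _ _ _ _).trans ?_
    simp

/-- The algebra map out of a symmetric algebra given by a commuting family of elements of a not
necessarily commutative algebra. -/
def polLift {A : Type} [Ring A] [Algebra ℂ A] (f : X →ₗ[ℂ] A)
    (hf : ∀ a b, f a * f b = f b * f a) : Pol X →ₐ[ℂ] A := (exists_polLift f hf).choose

@[simp] theorem polLift_ι {A : Type} [Ring A] [Algebra ℂ A] (f : X →ₗ[ℂ] A)
    (hf : ∀ a b, f a * f b = f b * f a) (a : X) : polLift f hf (polι a) = f a :=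
  (exists_polLift f hf).choose_spec a

/-- The functorial action of linear maps on symmetric algebras. -/
def polMap (g : X →ₗ[ℂ] X) : Pol X →ₐ[ℂ] Pol X :=
  polLift (polι ∘ₗ g) fun _ _ => mul_comm _ _

@[simp] theorem polMap_ι (g : X →ₗ[ℂ] X) (a : X) : polMap g (polι a) = polι (g a) := by
  simp [polMap]

theorem polAlgHom_ext {A : Type} [Ring A] [Algebra ℂ A] {F F' : Pol X →ₐ[ℂ] A}
    (h : ∀ a, F (polι a) = F' (polι a)) : F = F' := by
  ext a
  induction a using pol_induction with
  | algebraMap r => simp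
  | ι x => exact h x
  | mul a b ha hb => simp [ha, hb]
  | add a b ha hb => simp [ha, hb]

theorem polMap_id : polMap (LinearMap.id : X →ₗ[ℂ] X) = AlgHom.id ℂ _ :=
  polAlgHom_ext fun a => by simp

theorem polMap_comp (f g : X →ₗ[ℂ] X) : polMap (f ∘ₗ g) = (polMap f).comp (polMap g) :=
  polAlgHom_ext fun a => by simp

variable {M N : Type} [AddCommGroup M] [Module ℂ M] [Module (Pol X) M] [IsScalarTower ℂ (Pol X) M]
  [AddCommGroup N] [Module ℂ N] [Module (Pol X) N] [IsScalarTower ℂ (Pol X) N]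

theorem pol_smul_mem (U : Submodule ℂ M) (hU : ∀ (a : X), ∀ m ∈ U, polι a • m ∈ U) (f : Pol X) :
    ∀ m ∈ U, f • m ∈ U := by
  induction f using pol_induction with
  | algebraMap r => intro m hm; simpa using U.smul_mem r hm
  | ι x => exact hU x
  | mul a b ha hb => intro m hm; rw [mul_smul]; exact ha _ (hb _ hm)
  | add a b ha hb => intro m hm; rw [add_smul]; exact U.add_mem (ha _ hm) (hb _ hm)

theorem pol_map_smul (φ : M →ₗ[ℂ] N) (hφ : ∀ (a : X) (m : M), φ (polι a • m) = polι a • φ m)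
    (f : Pol X) : ∀ m, φ (f • m) = f • φ m := by
  induction f using pol_induction with
  | algebraMap r => intro m; simp
  | ι x => exact hφ x
  | mul a b ha hb => intro m; rw [mul_smul, ha, hb, mul_smul]
  | add a b ha hb => intro m; rw [add_smul, map_add, ha, hb, add_smul]

/-- A linear map commuting with the generators is linear over the symmetric algebra. -/
def polLinear (φ : M →ₗ[ℂ] N) (hφ : ∀ (a : X) (m : M), φ (polι a • m) = polι a • φ m) :
    M →ₗ[Pol X] N where
  toFun := φ
  map_add' := φ.map_add
  map_smul' f m := pol_map_smul φ hφ f m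

/-- A subspace stable under the generators is a submodule over the symmetric algebra. -/
def polSubmodule (U : Submodule ℂ M) (hU : ∀ (a : X), ∀ m ∈ U, polι a • m ∈ U) :
    Submodule (Pol X) M where
  carrier := U
  add_mem' := U.add_mem
  zero_mem' := U.zero_mem
  smul_mem' f m hm := pol_smul_mem U hU f m hm

theorem pol_tensor_top {E : Type} [AddCommGroup E] [Module ℂ E]
    (U : Submodule ℂ (TensorProduct ℂ (Pol X) E))
    (h1 : ∀ e, (1 : Pol X) ⊗ₜ[ℂ] e ∈ U) (hU : ∀ (a : X), ∀ m ∈ U, polι a • m ∈ U) : U = ⊤ := by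
  rw [eq_top_iff]
  rintro m -
  induction m using TensorProduct.induction_on with
  | zero => exact U.zero_mem
  | tmul f e =>
    have := pol_smul_mem U hU f _ (h1 e)
    rwa [TensorProduct.smul_tmul', smul_eq_mul, mul_one] at this
  | add a b ha hb => exact U.add_mem ha hb

theorem exists_derivation_lift {N : Type} [AddCommGroup N] [Module ℂ N] [Module (Pol X) N]
    [IsScalarTower ℂ (Pol X) N] (D : X →ₗ[ℂ] Module.End ℂ N)
    (hD : ∀ a b m, D a (polι b • m) - polι b • D a m = D b (polι a • m) - polι a • D b m) :
    ∃ F : Pol X →ₐ[ℂ] Module.End ℂ (N × N),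
      ∀ a u v, F (polι a) (u, v) = (polι a • u + D a v, polι a • v) := by
  let f : X →ₗ[ℂ] Module.End ℂ (N × N) :=
    { toFun := fun a =>
        ((Algebra.lsmul ℂ ℂ N (polι a) ∘ₗ LinearMap.fst ℂ N N) + (D a ∘ₗ LinearMap.snd ℂ N N)).prod
          (Algebra.lsmul ℂ ℂ N (polι a) ∘ₗ LinearMap.snd ℂ N N)
      map_add' := fun a b => by
        apply LinearMap.ext; rintro ⟨u, v⟩
        change (polι (a + b) • u + D (a + b) v, polι (a + b) • v) =
          (polι a • u + D a v + (polι b • u + D b v), polι a • v + polι b • v)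
        rw [map_add, map_add, add_smul, add_smul, LinearMap.add_apply, add_add_add_comm]
      map_smul' := fun r a => by
        apply LinearMap.ext; rintro ⟨u, v⟩
        change (polι (r • a) • u + D (r • a) v, polι (r • a) • v) =
          (r • (polι a • u + D a v), r • (polι a • v))
        rw [map_smul, map_smul, smul_assoc, smul_assoc, LinearMap.smul_apply, smul_add] }
  have f_apply : ∀ a u v, f a (u, v) = (polι a • u + D a v, polι a • v) := fun a u v => rfl
  have hf : ∀ a b, f a * f b = f b * f a := by
    intro a b
    apply LinearMap.ext; rintro ⟨u, v⟩
    rw [Module.End.mul_apply, Module.End.mul_apply, f_apply, f_apply, f_apply, f_apply]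
    have h := hD a b v
    rw [sub_eq_sub_iff_add_eq_add] at h
    refine Prod.ext ?_ ?_
    · simp only [smul_add, smul_smul, mul_comm (polι b) (polι a)]
      rw [add_assoc, add_assoc]
      congr 1
      rw [add_comm, h, add_comm]
    · simp only [smul_smul, mul_comm (polι b) (polι a)]
  exact ⟨polLift f hf, fun a u v => by rw [polLift_ι, f_apply]⟩

/-- An operator on `Pol X ⊗ E` with prescribed commutators with the generators and prescribed
values on `1 ⊗ E`. -/
theorem exists_commutator_lift {E : Type} [AddCommGroup E] [Module ℂ E]
    (D : X →ₗ[ℂ] Module.End ℂ (TensorProduct ℂ (Pol X) E))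
    (hD : ∀ a b m, D a (polι b • m) - polι b • D a m = D b (polι a • m) - polι a • D b m)
    (t : E →ₗ[ℂ] TensorProduct ℂ (Pol X) E) :
    ∃ T : Module.End ℂ (TensorProduct ℂ (Pol X) E),
      (∀ a m, T (polι a • m) = polι a • T m + D a m) ∧ ∀ e, T (1 ⊗ₜ e) = t e := by
  let N := TensorProduct ℂ (Pol X) E
  obtain ⟨F, hF⟩ := exists_derivation_lift D hD
  have F_snd : ∀ (p : Pol X) (w : N × N), (F p w).2 = p • w.2 := by
    intro p
    induction p using pol_induction with
    | algebraMap r => intro w; simp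
    | ι x => rintro ⟨u, v⟩; rw [hF]
    | mul a b ha hb => intro w; rw [map_mul, Module.End.mul_apply, ha, hb, mul_smul]
    | add a b ha hb => intro w; rw [map_add, LinearMap.add_apply, Prod.snd_add, ha, hb, add_smul]
  let i : E →ₗ[ℂ] N × N := t.prod (TensorProduct.mk ℂ (Pol X) E 1)
  let B : Pol X →ₗ[ℂ] E →ₗ[ℂ] N :=
    LinearMap.mk₂ ℂ (fun p e => (F p (i e)).1)
      (by intros; simp) (by intros; simp) (by intros; simp) (by intros; simp)
  refine ⟨TensorProduct.lift B, fun a m => ?_, fun e => ?_⟩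
  · induction m using TensorProduct.induction_on with
    | zero => simp
    | tmul p e =>
      rw [TensorProduct.smul_tmul', smul_eq_mul, TensorProduct.lift.tmul, TensorProduct.lift.tmul]
      change (F (polι a * p) (i e)).1 = polι a • (F p (i e)).1 + _
      rw [map_mul, Module.End.mul_apply]
      change (F (polι a) ((F p (i e)).1, (F p (i e)).2)).1 = _
      rw [hF, F_snd]
      change _ + D a (p • ((1 : Pol X) ⊗ₜ[ℂ] e)) = _
      rw [TensorProduct.smul_tmul', smul_eq_mul, mul_one]
    | add u v hu hv =>
      rw [smul_add, map_add, hu, hv, map_add, map_add, smul_add]; abel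
  · rw [TensorProduct.lift.tmul]
    change (F 1 (i e)).1 = t e
    rw [map_one]; rfl

end Polynomials

end Cherednik

namespace Cherednik

section Reflections

instance : Finite G.W := G.finite

instance : Finite G.Refl := inferInstanceAs (Finite {_s : G.W // _})

instance : Fintype G.Refl := Fintype.ofFinite _

theorem refl_symm_αv (D : ReflData G) (s : G.Refl) :
    (s.1 : V ≃ₗ[ℂ] V).symm (D.αv s) = D.lam s • D.αv s := by
  obtain ⟨μ, -, hμ⟩ := D.eig_αv s
  have hμ0 : μ ≠ 0 := by
    rintro rfl
    rw [zero_smul] at hμ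
    exact D.αv_ne s ((map_eq_zero_iff _ (LinearEquiv.injective _)).1 hμ)
  have h : (s.1 : V ≃ₗ[ℂ] V).symm (D.αv s) = μ⁻¹ • D.αv s := by
    rw [LinearEquiv.symm_apply_eq, map_smul, hμ, smul_smul, inv_mul_cancel₀ hμ0, one_smul]
  have h2 := D.eig_α s (D.αv s)
  rw [h, map_smul, D.pairing, smul_eq_mul] at h2
  rw [h, mul_right_cancel₀ two_ne_zero h2]

theorem refl_fixed (D : ReflData G) (s : G.Refl) (v : V) (hv : D.α s v = 0) :
    (s.1 : V ≃ₗ[ℂ] V).symm v = v := by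
  set f : V →ₗ[ℂ] V := (s.1 : V ≃ₗ[ℂ] V).toLinearMap - LinearMap.id with hf
  have hle : LinearMap.ker f ≤ LinearMap.ker (D.α s) := by
    intro u hu
    have hu' : (s.1 : V ≃ₗ[ℂ] V) u = u := by
      simpa [hf, sub_eq_zero] using hu
    have h := D.eig_α s u
    have : (s.1 : V ≃ₗ[ℂ] V).symm u = u := by rw [LinearEquiv.symm_apply_eq, hu']
    rw [this] at h
    rw [LinearMap.mem_ker]
    by_contra h0
    exact D.lam_ne_one s (mul_right_cancel₀ h0 (by rw [← h, one_mul]))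
  have h1 := LinearMap.finrank_range_add_finrank_ker f
  have h2 := Module.Dual.finrank_ker_add_one_of_ne_zero (D.α_ne s)
  have h3 : finrank ℂ (LinearMap.range f) = 1 := s.2
  have heq := Submodule.eq_of_le_of_finrank_eq hle (by omega)
  have : v ∈ LinearMap.ker f := by rw [heq]; exact hv
  rw [LinearEquiv.symm_apply_eq]
  have h4 : (s.1 : V ≃ₗ[ℂ] V) v - v = 0 := this
  exact (sub_eq_zero.1 h4).symm

theorem refl_symm_apply (D : ReflData G) (s : G.Refl) (v : V) :
    (s.1 : V ≃ₗ[ℂ] V).symm v = v + ((D.lam s - 1) / 2 * D.α s v) • D.αv s := by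
  have h := refl_fixed D s (v - (D.α s v / 2) • D.αv s) (by
    rw [map_sub, map_smul, D.pairing, smul_eq_mul]; ring)
  rw [map_sub, map_smul, refl_symm_αv, sub_eq_iff_eq_add] at h
  rw [h]
  module

theorem refl_dual_apply (D : ReflData G) (s : G.Refl) (a : Dual ℂ V) (v : V) :
    a ((s.1 : V ≃ₗ[ℂ] V).symm v) = a v + (D.lam s - 1) / 2 * (D.α s v * a (D.αv s)) := by
  rw [refl_symm_apply D, map_add, map_smul, smul_eq_mul]; ring

/-- Conjugation acts on the reflections. -/
def conjRefl (g : G.W) (s : G.Refl) : G.Refl :=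
  ⟨g * s.1 * g⁻¹, by
    have hs : finrank ℂ (LinearMap.range ((s.1 : V ≃ₗ[ℂ] V).toLinearMap - LinearMap.id)) = 1 := s.2
    have h : ((g * s.1 * g⁻¹ : G.W) : V ≃ₗ[ℂ] V).toLinearMap - LinearMap.id =
        ((g : V ≃ₗ[ℂ] V) : V →ₗ[ℂ] V) ∘ₗ ((s.1 : V ≃ₗ[ℂ] V).toLinearMap - LinearMap.id) ∘ₗ
          ((g : V ≃ₗ[ℂ] V).symm : V →ₗ[ℂ] V) := by
      ext v
      change (g : V ≃ₗ[ℂ] V) ((s.1 : V ≃ₗ[ℂ] V) ((g : V ≃ₗ[ℂ] V).symm v)) - v =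
        (g : V ≃ₗ[ℂ] V) ((s.1 : V ≃ₗ[ℂ] V) ((g : V ≃ₗ[ℂ] V).symm v) - (g : V ≃ₗ[ℂ] V).symm v)
      rw [map_sub, LinearEquiv.apply_symm_apply]
    rw [IsComplexReflection, h, LinearMap.range_comp, LinearMap.range_comp_of_range_eq_top _
      (LinearEquiv.range _)]
    rw [← hs]
    exact LinearEquiv.finrank_map_eq (g : V ≃ₗ[ℂ] V) _⟩

theorem conjRefl_val (g : G.W) (s : G.Refl) : (conjRefl g s).1 = g * s.1 * g⁻¹ := rfl

/-- Conjugation as a permutation of the reflections. -/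
def conjPerm (g : G.W) : G.Refl ≃ G.Refl where
  toFun := conjRefl g
  invFun := conjRefl g⁻¹
  left_inv s := Subtype.ext (by simp only [conjRefl_val]; group)
  right_inv s := Subtype.ext (by simp only [conjRefl_val]; group)

theorem W_coe_inv (g : G.W) : ((g⁻¹ : G.W) : V ≃ₗ[ℂ] V) = (g : V ≃ₗ[ℂ] V).symm := rfl

theorem lam_conj (D : ReflData G) (g : G.W) (s : G.Refl) : D.lam (conjRefl g s) = D.lam s := by
  set t := conjRefl g s with ht
  set v := (g : V ≃ₗ[ℂ] V) (D.αv s) with hv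
  have h1 : (t.1 : V ≃ₗ[ℂ] V).symm v = D.lam s • v := by
    rw [LinearEquiv.symm_apply_eq, map_smul, hv]
    change _ = D.lam s • (g : V ≃ₗ[ℂ] V) ((s.1 : V ≃ₗ[ℂ] V) ((g : V ≃ₗ[ℂ] V).symm _))
    rw [LinearEquiv.symm_apply_apply, ← map_smul, ← map_smul, ← refl_symm_αv,
      LinearEquiv.apply_symm_apply]
  have hv0 : v ≠ 0 := by
    rw [hv]; exact fun h => D.αv_ne s ((map_eq_zero_iff _ (LinearEquiv.injective _)).1 h)
  have h2 := refl_symm_apply D t v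
  rw [h1] at h2
  have h3 : (D.lam s - 1) • v = ((D.lam t - 1) / 2 * D.α t v) • D.αv t := by
    rw [sub_smul, h2, one_smul]; abel
  have hs : D.lam s - 1 ≠ 0 := sub_ne_zero.2 (D.lam_ne_one s)
  have h4 : v = ((D.lam s - 1)⁻¹ * ((D.lam t - 1) / 2 * D.α t v)) • D.αv t := by
    rw [mul_smul, ← h3, smul_smul, inv_mul_cancel₀ hs, one_smul]
  have h5 : (t.1 : V ≃ₗ[ℂ] V).symm v = D.lam t • v := by
    rw [h4, map_smul, refl_symm_αv, smul_comm]
  rw [h1] at h5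
  exact (smul_left_injective ℂ hv0 h5).symm

theorem pair_conj (D : ReflData G) (g : G.W) (s : G.Refl) (v : V) (a : Dual ℂ V) :
    D.α (conjRefl g s) ((g : V ≃ₗ[ℂ] V) v) *
      a ((g : V ≃ₗ[ℂ] V).symm (D.αv (conjRefl g s))) = D.α s v * a (D.αv s) := by
  have h1 := refl_dual_apply D s a v
  have h2 := refl_dual_apply D (conjRefl g s) (a ∘ₗ ((g : V ≃ₗ[ℂ] V).symm : V →ₗ[ℂ] V))
    ((g : V ≃ₗ[ℂ] V) v)
  have h3 : ((conjRefl g s).1 : V ≃ₗ[ℂ] V).symm ((g : V ≃ₗ[ℂ] V) v) =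
      (g : V ≃ₗ[ℂ] V) ((s.1 : V ≃ₗ[ℂ] V).symm v) := by
    rw [LinearEquiv.symm_apply_eq]
    change _ = (g : V ≃ₗ[ℂ] V) ((s.1 : V ≃ₗ[ℂ] V) ((g : V ≃ₗ[ℂ] V).symm _))
    rw [LinearEquiv.symm_apply_apply, LinearEquiv.apply_symm_apply]
  rw [h3, lam_conj] at h2
  simp only [LinearMap.comp_apply, LinearEquiv.coe_coe, LinearEquiv.symm_apply_apply] at h2
  rw [h1, add_right_inj] at h2
  refine (mul_left_cancel₀ ?_ h2).symm
  exact div_ne_zero (sub_ne_zero.2 (D.lam_ne_one s)) two_ne_zero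

end Reflections

section Algebra

variable (R : RCA G D c)

theorem _root_.RCA.rel' (v : V) (a : Dual ℂ V) :
    R.y v * R.x a = R.x a * R.y v + algebraMap ℂ R.H (a v) -
        ∑ s : G.Refl, (c s * D.α s v * a (D.αv s)) • R.w s.1 := by
  have := R.rel v a
  rw [finsum_eq_sum_of_fintype, sub_eq_iff_eq_add] at this
  rw [this]; abel

theorem _root_.RCA.w_refl_x (s : G.Refl) (a : Dual ℂ V) :
    R.w s.1 * R.x a = R.x a * R.w s.1 +
      ((D.lam s - 1) / 2 * a (D.αv s)) • (R.x (D.α s) * R.w s.1) := by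
  have h : a ∘ₗ (((s.1⁻¹ : G.W) : V ≃ₗ[ℂ] V) : V →ₗ[ℂ] V) =
      a + ((D.lam s - 1) / 2 * a (D.αv s)) • D.α s := by
    ext v
    rw [LinearMap.comp_apply, LinearEquiv.coe_coe, W_coe_inv, refl_dual_apply D]
    simp only [LinearMap.add_apply, LinearMap.smul_apply, smul_eq_mul]
    ring
  rw [R.w_x, h, map_add, map_smul, add_mul, smul_mul_assoc]

theorem _root_.RCA.w_refl_y (s : G.Refl) (v : V) :
    R.y v * R.w s.1 = R.w s.1 * R.y v +
      ((D.lam s - 1) / 2 * D.α s v) • (R.w s.1 * R.y (D.αv s)) := by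
  have h := R.w_y s.1 ((s.1 : V ≃ₗ[ℂ] V).symm v)
  rw [LinearEquiv.apply_symm_apply, refl_symm_apply D, map_add, map_smul] at h
  rw [← h, mul_add, mul_smul_comm]

variable {n : ℕ} (b : Basis (Fin n) ℂ V)

theorem eulerElt_eq : eulerElt R b =
    (∑ i, R.x (b.coord i) * R.y (b i)) + ((n : ℂ) / 2) • (1 : R.H)
    - ∑ s : G.Refl, (2 * c s / (1 - D.lam s)) • R.w s.1 := by
  rw [eulerElt, finsum_eq_sum_of_fintype]

theorem sum_coord_x (a : Dual ℂ V) : ∑ i, a (b i) • R.x (b.coord i) = R.x a := by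
  simp_rw [← map_smul, ← map_sum]
  congr 1
  exact b.sum_dual_apply_smul_coord a

theorem sum_coord_y (v : V) : ∑ i, b.coord i v • R.y (b i) = R.y v := by
  simp_rw [← map_smul, ← map_sum]
  congr 1
  exact b.sum_repr v

theorem refl_scalar (D : ReflData G) (s : G.Refl) (k r : ℂ) :
    2 * k / (1 - D.lam s) * ((D.lam s - 1) / 2 * r) = -(k * r) := by
  have := sub_ne_zero.2 (D.lam_ne_one s).symm
  field_simp
  ring

theorem sum_refl_x (a : Dual ℂ V) : (∑ i, R.x (b.coord i) * R.y (b i)) * R.x a =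
    R.x a * (∑ i, R.x (b.coord i) * R.y (b i)) + R.x a -
      ∑ s : G.Refl, (c s * a (D.αv s)) • (R.x (D.α s) * R.w s.1) := by
  have h : ∀ i, R.x (b.coord i) * R.y (b i) * R.x a = R.x a * (R.x (b.coord i) * R.y (b i)) +
      a (b i) • R.x (b.coord i) - ∑ s : G.Refl,
        (c s * a (D.αv s)) • ((D.α s (b i) • R.x (b.coord i)) * R.w s.1) := by
    intro i
    rw [mul_assoc, R.rel', mul_sub, mul_add, ← mul_assoc, R.comm_x, mul_assoc, Finset.mul_sum,
      ← Algebra.commutes, ← Algebra.smul_def]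
    congr 1
    refine Finset.sum_congr rfl fun s _ => ?_
    rw [mul_smul_comm, smul_mul_assoc, smul_smul]
    congr 1; ring
  rw [Finset.sum_mul, Finset.sum_congr rfl fun i _ => h i, Finset.sum_sub_distrib,
    Finset.sum_add_distrib, ← Finset.mul_sum, sum_coord_x, Finset.sum_comm]
  congr 1
  refine Finset.sum_congr rfl fun s _ => ?_
  rw [← Finset.smul_sum, ← Finset.sum_mul, sum_coord_x]

theorem euler_x (a : Dual ℂ V) :
    eulerElt R b * R.x a = R.x a * eulerElt R b + R.x a := by
  rw [eulerElt_eq, sub_mul, add_mul, sum_refl_x, Finset.sum_mul]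
  have h : ∀ s : G.Refl, (2 * c s / (1 - D.lam s)) • R.w s.1 * R.x a =
      R.x a * ((2 * c s / (1 - D.lam s)) • R.w s.1) -
        (c s * a (D.αv s)) • (R.x (D.α s) * R.w s.1) := by
    intro s
    rw [smul_mul_assoc, R.w_refl_x, smul_add, mul_smul_comm, smul_smul, refl_scalar, neg_smul,
      sub_eq_add_neg (_ • _)]
  rw [Finset.sum_congr rfl fun s _ => h s, Finset.sum_sub_distrib, ← Finset.mul_sum, mul_sub,
    mul_add, smul_mul_assoc, mul_smul_comm, one_mul, mul_one]
  abel

theorem sum_refl_y (v : V) : R.y v * (∑ i, R.x (b.coord i) * R.y (b i)) =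
    (∑ i, R.x (b.coord i) * R.y (b i)) * R.y v + R.y v -
      ∑ s : G.Refl, (c s * D.α s v) • (R.w s.1 * R.y (D.αv s)) := by
  have h : ∀ i, R.y v * (R.x (b.coord i) * R.y (b i)) = (R.x (b.coord i) * R.y (b i)) * R.y v +
      b.coord i v • R.y (b i) - ∑ s : G.Refl,
        (c s * D.α s v) • (R.w s.1 * (b.coord i (D.αv s) • R.y (b i))) := by
    intro i
    rw [← mul_assoc, R.rel', sub_mul, add_mul, mul_assoc, R.comm_y, mul_assoc, Finset.sum_mul,
      ← Algebra.smul_def]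
    congr 1
    refine Finset.sum_congr rfl fun s _ => ?_
    rw [mul_smul_comm, smul_mul_assoc, smul_smul]
  rw [Finset.mul_sum, Finset.sum_congr rfl fun i _ => h i, Finset.sum_sub_distrib,
    Finset.sum_add_distrib, ← Finset.sum_mul, sum_coord_y, Finset.sum_comm]
  congr 1
  refine Finset.sum_congr rfl fun s _ => ?_
  rw [← Finset.smul_sum, ← Finset.mul_sum, sum_coord_y]

theorem euler_y (v : V) :
    R.y v * eulerElt R b = eulerElt R b * R.y v + R.y v := by
  rw [eulerElt_eq, mul_sub, mul_add, sum_refl_y, Finset.mul_sum]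
  have h : ∀ s : G.Refl, R.y v * ((2 * c s / (1 - D.lam s)) • R.w s.1) =
      ((2 * c s / (1 - D.lam s)) • R.w s.1) * R.y v -
        (c s * D.α s v) • (R.w s.1 * R.y (D.αv s)) := by
    intro s
    rw [mul_smul_comm, R.w_refl_y, smul_add, smul_mul_assoc, smul_smul, refl_scalar, neg_smul,
      sub_eq_add_neg (_ • _)]
  rw [Finset.sum_congr rfl fun s _ => h s, Finset.sum_sub_distrib, ← Finset.sum_mul, sub_mul,
    add_mul, smul_mul_assoc, mul_smul_comm, one_mul, mul_one]
  abel

theorem conj_sum (f : G.Refl → ℂ) (hf : ∀ g s, f (conjRefl g s) = f s) (g : G.W) :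
    R.w g * (∑ s : G.Refl, f s • R.w s.1) = (∑ s : G.Refl, f s • R.w s.1) * R.w g := by
  conv_rhs => rw [← Equiv.sum_comp (conjPerm g) (fun s => f s • R.w s.1)]
  rw [Finset.mul_sum, Finset.sum_mul]
  refine Finset.sum_congr rfl fun s _ => ?_
  change _ = f (conjRefl g s) • R.w (conjRefl g s).1 * _
  rw [hf, mul_smul_comm, smul_mul_assoc, ← R.w.map_mul (conjRefl g s).1 g, conjRefl_val,
    inv_mul_cancel_right, R.w.map_mul]

theorem conj_sum_xy (g : G.W) : R.w g * (∑ i, R.x (b.coord i) * R.y (b i)) =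
    (∑ i, R.x (b.coord i) * R.y (b i)) * R.w g := by
  have h : ∀ i, R.w g * (R.x (b.coord i) * R.y (b i)) =
      ∑ j, R.x (b.coord j) *
        R.y ((g : V ≃ₗ[ℂ] V) (b.coord i ((g : V ≃ₗ[ℂ] V).symm (b j)) • b i)) * R.w g := by
    intro i
    rw [← mul_assoc, R.w_x, mul_assoc, R.w_y, ← sum_coord_x R b, Finset.sum_mul]
    refine Finset.sum_congr rfl fun j _ => ?_
    rw [map_smul, map_smul, smul_mul_assoc, mul_smul_comm, smul_mul_assoc, mul_assoc]; rfl
  rw [Finset.mul_sum, Finset.sum_congr rfl fun i _ => h i, Finset.sum_comm, Finset.sum_mul]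
  refine Finset.sum_congr rfl fun j _ => ?_
  rw [← Finset.sum_mul, ← Finset.mul_sum, ← map_sum, ← map_sum]
  have : ∑ i, b.coord i ((g : V ≃ₗ[ℂ] V).symm (b j)) • b i = (g : V ≃ₗ[ℂ] V).symm (b j) :=
    b.sum_repr _
  rw [this, LinearEquiv.apply_symm_apply]

theorem euler_w (hc : IsConjInvariant c) (g : G.W) :
    R.w g * eulerElt R b = eulerElt R b * R.w g := by
  rw [eulerElt_eq, mul_sub, mul_add, sub_mul, add_mul, conj_sum_xy, conj_sum, mul_smul_comm,
    smul_mul_assoc, one_mul, mul_one]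
  intro g s
  rw [lam_conj, hc s (conjRefl g s) ⟨g, rfl⟩]

theorem _root_.RCA.adjoin_eq_top :
    Algebra.adjoin ℂ (Set.range R.x ∪ Set.range R.y ∪ Set.range R.w) = ⊤ := by
  set B := Algebra.adjoin ℂ (Set.range R.x ∪ Set.range R.y ∪ Set.range R.w) with hB
  have hx : ∀ a, R.x a ∈ B := fun a => Algebra.subset_adjoin (Or.inl (Or.inl ⟨a, rfl⟩))
  have hy : ∀ a, R.y a ∈ B := fun a => Algebra.subset_adjoin (Or.inl (Or.inr ⟨a, rfl⟩))
  have hw : ∀ a, R.w a ∈ B := fun a => Algebra.subset_adjoin (Or.inr ⟨a, rfl⟩)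
  let xB : Dual ℂ V →ₗ[ℂ] B := R.x.codRestrict (Subalgebra.toSubmodule B) hx
  let yB : V →ₗ[ℂ] B := R.y.codRestrict (Subalgebra.toSubmodule B) hy
  let wB : G.W →* B := R.w.codRestrict B hw
  obtain ⟨φ, hφ, -⟩ := R.universal B xB yB wB (fun a b => Subtype.ext (R.comm_x a b))
    (fun a b => Subtype.ext (R.comm_y a b)) (fun g a => Subtype.ext (R.w_x g a))
    (fun g a => Subtype.ext (R.w_y g a)) (fun v a => Subtype.ext (by
      have := R.rel v a
      rw [finsum_eq_sum_of_fintype] at this ⊢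
      rw [AddSubgroupClass.coe_sub, AddSubgroupClass.coe_sub, AddSubmonoidClass.coe_finsetSum]
      exact this))
  have h1 : B.val.comp φ = AlgHom.id ℂ R.H :=
    (R.universal R.H R.x R.y R.w R.comm_x R.comm_y R.w_x R.w_y R.rel).unique
      ⟨fun a => congrArg B.val (hφ.1 a), fun a => congrArg B.val (hφ.2.1 a),
        fun a => congrArg B.val (hφ.2.2 a)⟩ ⟨fun a => rfl, fun a => rfl, fun a => rfl⟩
  rw [eq_top_iff]
  rintro h -
  have : B.val (φ h) = h := DFunLike.congr_fun h1 h
  rw [← this]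
  exact (φ h).2

theorem _root_.RCA.induction {p : R.H → Prop} (hx : ∀ a, p (R.x a)) (hy : ∀ v, p (R.y v))
    (hw : ∀ g, p (R.w g)) (hr : ∀ r, p (algebraMap ℂ R.H r))
    (hadd : ∀ a b, p a → p b → p (a + b)) (hmul : ∀ a b, p a → p b → p (a * b)) (h : R.H) :
    p h := by
  have hh : h ∈ Algebra.adjoin ℂ (Set.range R.x ∪ Set.range R.y ∪ Set.range R.w) := by
    rw [R.adjoin_eq_top]; trivial
  induction hh using Algebra.adjoin_induction with
  | mem x hx' =>
    rcases hx' with (⟨a, rfl⟩ | ⟨a, rfl⟩) | ⟨a, rfl⟩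
    exacts [hx a, hy a, hw a]
  | algebraMap r => exact hr r
  | add a b _ _ ha hb => exact hadd a b ha hb
  | mul a b _ _ ha hb => exact hmul a b ha hb

end Algebra

end Cherednik

namespace Cherednik

open TensorProduct

section Operators

variable {E : Type} [AddCommGroup E] [Module ℂ E]

/-- The contragredient action of the reflection group. -/
def contra (g : G.W) : Dual ℂ V →ₗ[ℂ] Dual ℂ V :=
  LinearMap.dualMap (((g⁻¹ : G.W) : V ≃ₗ[ℂ] V) : V →ₗ[ℂ] V)

theorem contra_apply (g : G.W) (a : Dual ℂ V) (v : V) :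
    contra g a v = a ((g : V ≃ₗ[ℂ] V).symm v) := rfl

/-- The diagonal action of `W` on `ℂ[V] ⊗ E`. -/
def tensorW (ρ : G.W →* (E ≃ₗ[ℂ] E)) : G.W →* Module.End ℂ (Pol (Dual ℂ V) ⊗[ℂ] E) where
  toFun g := TensorProduct.map (polMap (contra g)).toLinearMap (ρ g : E →ₗ[ℂ] E)
  map_one' := by
    have h : contra (1 : G.W) = LinearMap.id := by ext; rfl
    refine TensorProduct.ext' fun f e => ?_
    rw [TensorProduct.map_tmul, h, polMap_id, map_one]
    rfl
  map_mul' g g' := by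
    have h : contra (g * g') = contra g ∘ₗ contra g' := by
      ext a v
      rw [LinearMap.comp_apply, contra_apply, contra_apply, contra_apply]
      rfl
    refine TensorProduct.ext' fun f e => ?_
    rw [Module.End.mul_apply, TensorProduct.map_tmul, TensorProduct.map_tmul,
      TensorProduct.map_tmul, h, polMap_comp, map_mul]
    rfl

variable (ρ : G.W →* (E ≃ₗ[ℂ] E))

theorem tensorW_tmul (g : G.W) (f : Pol (Dual ℂ V)) (e : E) :
    tensorW ρ g (f ⊗ₜ e) = polMap (contra g) f ⊗ₜ ρ g e := rfl

theorem tensorW_x (g : G.W) (a : Dual ℂ V) (m : Pol (Dual ℂ V) ⊗[ℂ] E) :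
    tensorW ρ g (polι a • m) = polι (contra g a) • tensorW ρ g m := by
  induction m using TensorProduct.induction_on with
  | zero => simp
  | tmul f e =>
    rw [smul_tmul', tensorW_tmul, tensorW_tmul, smul_tmul', smul_eq_mul, smul_eq_mul, map_mul,
      polMap_ι]
  | add u v hu hv => rw [smul_add, map_add, hu, hv, map_add, smul_add]

theorem contra_refl (D : ReflData G) (s : G.Refl) (a : Dual ℂ V) :
    contra s.1 a = a + ((D.lam s - 1) / 2 * a (D.αv s)) • D.α s := by
  ext v
  rw [contra_apply, refl_dual_apply D]
  simp only [LinearMap.add_apply, LinearMap.smul_apply, smul_eq_mul]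
  ring

variable (D c)

/-- The prescribed commutators of the Dunkl operators with the coordinate functions. -/
def dunklComm (v : V) : Dual ℂ V →ₗ[ℂ] Module.End ℂ (Pol (Dual ℂ V) ⊗[ℂ] E) where
  toFun a := a v • 1 - ∑ s : G.Refl, (c s * D.α s v * a (D.αv s)) • tensorW ρ s.1
  map_add' a b := by
    simp only [LinearMap.add_apply, mul_add, add_smul, Finset.sum_add_distrib]
    abel
  map_smul' r a := by
    refine LinearMap.ext fun m => ?_
    simp only [LinearMap.smul_apply, smul_eq_mul, RingHom.id_apply, LinearMap.sub_apply,
      LinearMap.sum_apply, smul_sub, Finset.smul_sum, smul_smul]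
    congr 1
    refine Finset.sum_congr rfl fun s _ => ?_
    congr 1; ring

theorem dunklComm_apply (v : V) (a : Dual ℂ V) :
    dunklComm D c ρ v a =
      a v • 1 - ∑ s : G.Refl, (c s * D.α s v * a (D.αv s)) • tensorW ρ s.1 := rfl

theorem dunklComm_apply_apply (v : V) (a : Dual ℂ V) (m : Pol (Dual ℂ V) ⊗[ℂ] E) :
    dunklComm D c ρ v a m =
      a v • m - ∑ s : G.Refl, (c s * D.α s v * a (D.αv s)) • tensorW ρ s.1 m := by
  rw [dunklComm_apply, LinearMap.sub_apply, LinearMap.sum_apply]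
  rfl

theorem dunklComm_symm (v : V) (a b : Dual ℂ V) (m : Pol (Dual ℂ V) ⊗[ℂ] E) :
    dunklComm D c ρ v a (polι b • m) - polι b • dunklComm D c ρ v a m =
      dunklComm D c ρ v b (polι a • m) - polι a • dunklComm D c ρ v b m := by
  have key : ∀ a b : Dual ℂ V, dunklComm D c ρ v a (polι b • m) - polι b • dunklComm D c ρ v a m =
      - ∑ s : G.Refl, (c s * D.α s v * a (D.αv s) * ((D.lam s - 1) / 2 * b (D.αv s))) •
        (polι (D.α s) • tensorW ρ s.1 m) := by
    intro a b
    have h : ∀ s : G.Refl, (c s * D.α s v * a (D.αv s)) • tensorW ρ s.1 (polι b • m) =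
        polι b • ((c s * D.α s v * a (D.αv s)) • tensorW ρ s.1 m) +
        (c s * D.α s v * a (D.αv s) * ((D.lam s - 1) / 2 * b (D.αv s))) •
        (polι (D.α s) • tensorW ρ s.1 m) := by
      intro s
      rw [tensorW_x, contra_refl D, map_add, map_smul, add_smul, smul_add, smul_assoc, smul_smul,
        smul_comm (polι b)]
    simp only [dunklComm_apply_apply, h, Finset.sum_add_distrib, smul_sub, Finset.smul_sum]
    rw [smul_comm (a v)]
    abel
  rw [key, key]
  congr 1
  refine Finset.sum_congr rfl fun s _ => ?_
  congr 1; ring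

variable {c}

theorem dunklComm_conj (hc : IsConjInvariant c) (g : G.W) (v : V) (a : Dual ℂ V) :
    tensorW ρ g * dunklComm D c ρ v a =
      dunklComm D c ρ ((g : V ≃ₗ[ℂ] V) v) (contra g a) * tensorW ρ g := by
  have h : tensorW ρ g * ∑ s : G.Refl, (c s * D.α s v * a (D.αv s)) • tensorW ρ s.1 =
      (∑ s : G.Refl, (c s * D.α s ((g : V ≃ₗ[ℂ] V) v) * contra g a (D.αv s)) • tensorW ρ s.1) *
        tensorW ρ g := ?_
  · refine LinearMap.ext fun m => ?_
    have h' := LinearMap.congr_fun h m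
    rw [Module.End.mul_apply, Module.End.mul_apply] at h' ⊢
    rw [dunklComm_apply, dunklComm_apply, LinearMap.sub_apply, map_sub, h', LinearMap.sub_apply,
      LinearMap.smul_apply, LinearMap.smul_apply, map_smul, contra_apply,
      LinearEquiv.symm_apply_apply]
    rfl
  conv_rhs => rw [← Equiv.sum_comp (conjPerm g)
    (fun s => (c s * D.α s ((g : V ≃ₗ[ℂ] V) v) * contra g a (D.αv s)) • tensorW ρ s.1)]
  rw [Finset.mul_sum, Finset.sum_mul]
  refine Finset.sum_congr rfl fun s _ => ?_
  change _ = (c (conjRefl g s) * D.α (conjRefl g s) ((g : V ≃ₗ[ℂ] V) v) *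
    contra g a (D.αv (conjRefl g s))) • tensorW ρ (conjRefl g s).1 * _
  rw [mul_assoc (c (conjRefl g s)), contra_apply, pair_conj, hc s (conjRefl g s) ⟨g, rfl⟩, mul_smul_comm,
    smul_mul_assoc, ← (tensorW ρ).map_mul (conjRefl g s).1 g, conjRefl_val,
    inv_mul_cancel_right, (tensorW ρ).map_mul, mul_assoc]

variable (c)

theorem tensor_op_eq {T T' : Module.End ℂ (Pol (Dual ℂ V) ⊗[ℂ] E)}
    (h1 : ∀ e : E, T (1 ⊗ₜ e) = T' (1 ⊗ₜ e))
    (h : ∀ (a : Dual ℂ V) (m), T m = T' m → T (polι a • m) = T' (polι a • m)) : T = T' := by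
  have := pol_tensor_top (LinearMap.eqLocus T T') h1 h
  exact LinearMap.ext fun m => by
    have : m ∈ LinearMap.eqLocus T T' := by rw [this]; trivial
    exact this

/-- The Dunkl operators on `ℂ[V] ⊗ E`. -/
theorem exists_dunkl (Y : V →ₗ[ℂ] Module.End ℂ E) :
    ∃ T : V →ₗ[ℂ] Module.End ℂ (Pol (Dual ℂ V) ⊗[ℂ] E),
      (∀ (v : V) (a : Dual ℂ V) (m), T v (polι a • m) = polι a • T v m + dunklComm D c ρ v a m) ∧
      ∀ v e, T v (1 ⊗ₜ e) = 1 ⊗ₜ Y v e := by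
  choose T hT hT1 using fun v => exists_commutator_lift (dunklComm D c ρ v)
    (dunklComm_symm D c ρ v) (TensorProduct.mk ℂ (Pol (Dual ℂ V)) E 1 ∘ₗ Y v)
  refine ⟨{ toFun := T, map_add' := fun u v => ?_, map_smul' := fun r v => ?_ }, hT, hT1⟩
  · refine tensor_op_eq (fun e => ?_) (fun a m hm => ?_)
    · rw [LinearMap.add_apply, hT1, hT1, hT1]
      simp [TensorProduct.tmul_add]
    · rw [LinearMap.add_apply] at hm ⊢
      rw [hT, hT, hT, hm, smul_add]
      simp only [dunklComm_apply_apply, map_add, add_smul, mul_add, add_mul, Finset.sum_add_distrib]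
      abel
  · refine tensor_op_eq (fun e => ?_) (fun a m hm => ?_)
    · rw [LinearMap.smul_apply, hT1, hT1]
      simp
    · rw [RingHom.id_apply, LinearMap.smul_apply] at hm ⊢
      rw [hT, hT, hm, smul_add, smul_comm r]
      congr 1
      simp only [dunklComm_apply_apply, map_smul, smul_eq_mul, smul_sub, Finset.smul_sum, smul_smul]
      congr 1
      refine Finset.sum_congr rfl fun s _ => ?_
      congr 1; ring

variable {Y : V →ₗ[ℂ] Module.End ℂ E} {T : V →ₗ[ℂ] Module.End ℂ (Pol (Dual ℂ V) ⊗[ℂ] E)}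
  {c}

theorem dunkl_w (hc : IsConjInvariant c)
    (hY : ∀ g v e, ρ g (Y v e) = Y ((g : V ≃ₗ[ℂ] V) v) (ρ g e))
    (hT : ∀ (v : V) (a : Dual ℂ V) (m), T v (polι a • m) = polι a • T v m + dunklComm D c ρ v a m)
    (hT1 : ∀ v e, T v (1 ⊗ₜ e) = 1 ⊗ₜ Y v e) (g : G.W) (v : V) :
    tensorW ρ g * T v = T ((g : V ≃ₗ[ℂ] V) v) * tensorW ρ g := by
  refine tensor_op_eq (fun e => ?_) (fun a m hm => ?_)
  · rw [Module.End.mul_apply, Module.End.mul_apply, hT1, tensorW_tmul, tensorW_tmul, map_one, hT1,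
      hY]
  · have h := LinearMap.congr_fun (dunklComm_conj D ρ hc g v a) m
    rw [Module.End.mul_apply, Module.End.mul_apply] at h hm ⊢
    rw [hT, map_add, tensorW_x, hm, tensorW_x, hT, h]

theorem dunkl_comm (hc : IsConjInvariant c)
    (hY : ∀ g v e, ρ g (Y v e) = Y ((g : V ≃ₗ[ℂ] V) v) (ρ g e))
    (hYc : ∀ u v e, Y u (Y v e) = Y v (Y u e))
    (hT : ∀ (v : V) (a : Dual ℂ V) (m), T v (polι a • m) = polι a • T v m + dunklComm D c ρ v a m)
    (hT1 : ∀ v e, T v (1 ⊗ₜ e) = 1 ⊗ₜ Y v e) (u v : V) : T u * T v = T v * T u := by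
  have hTs : ∀ (u : V) (s : G.Refl) m, T u (tensorW ρ s.1 m) = tensorW ρ s.1 (T u m) +
      ((D.lam s - 1) / 2 * D.α s u) • tensorW ρ s.1 (T (D.αv s) m) := by
    intro u s m
    have h := LinearMap.congr_fun
      (dunkl_w D ρ hc hY hT hT1 s.1 ((s.1 : V ≃ₗ[ℂ] V).symm u)) m
    rw [Module.End.mul_apply, Module.End.mul_apply, LinearEquiv.apply_symm_apply,
      refl_symm_apply D, map_add, map_smul, LinearMap.add_apply, LinearMap.smul_apply, map_add,
      map_smul] at h
    exact h.symm
  have key : ∀ (u v : V) a m, T u (dunklComm D c ρ v a m) = dunklComm D c ρ v a (T u m) -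
      ∑ s : G.Refl, (c s * a (D.αv s) * ((D.lam s - 1) / 2) * (D.α s u * D.α s v)) •
        tensorW ρ s.1 (T (D.αv s) m) := by
    intro u v a m
    simp only [dunklComm_apply_apply, map_sub, map_smul, map_sum, hTs, smul_add, Finset.sum_add_distrib,
        smul_smul]
    rw [sub_sub]
    congr 2
    refine Finset.sum_congr rfl fun s _ => ?_
    congr 1; ring
  refine tensor_op_eq (fun e => ?_) (fun a m hm => ?_)
  · rw [Module.End.mul_apply, Module.End.mul_apply, hT1, hT1, hT1, hT1, hYc]
  · rw [Module.End.mul_apply, Module.End.mul_apply] at hm ⊢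
    rw [hT, hT, map_add, map_add, hT, hT, hm, key, key]
    simp only [mul_comm (D.α _ u)]
    abel

end Operators

end Cherednik

namespace Cherednik

open TensorProduct

section Scalars

variable (R : RCA G D c) {M : Type} [AddCommGroup M] [Module R.H M] [Module ℂ M]
  [IsScalarTower ℂ R.H M]

theorem alg_smul (r : ℂ) (m : M) : algebraMap ℂ R.H r • m = r • m := algebraMap_smul _ _ _

theorem smul_smul_comm' (h : R.H) (r : ℂ) (m : M) : h • r • m = r • h • m := by
  rw [← alg_smul R, ← alg_smul R, smul_smul, smul_smul, Algebra.commutes]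

end Scalars

section Framework

/-- The subalgebra of coordinate functions. -/
def xAlg (R : RCA G D c) : Pol (Dual ℂ V) →ₐ[ℂ] R.H := polLift R.x R.comm_x

@[simp] theorem xAlg_ι (R : RCA G D c) (a : Dual ℂ V) : xAlg R (polι a) = R.x a :=
  polLift_ι _ _ _

instance (R : RCA G D c) : Module (Pol (Dual ℂ V)) R.H :=
  Module.compHom R.H (xAlg R).toRingHom

theorem pol_smul_def (R : RCA G D c) (f : Pol (Dual ℂ V)) (h : R.H) : f • h = xAlg R f * h := rfl

variable (R : RCA G D c)
  {M N : Type} [AddCommGroup M] [Module R.H M] [Module ℂ M] [Module (Pol (Dual ℂ V)) M]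
  [IsScalarTower ℂ R.H M] [IsScalarTower (Pol (Dual ℂ V)) R.H M]
  [IsScalarTower ℂ (Pol (Dual ℂ V)) M]
  [AddCommGroup N] [Module R.H N] [Module ℂ N] [Module (Pol (Dual ℂ V)) N]
  [IsScalarTower ℂ R.H N] [IsScalarTower (Pol (Dual ℂ V)) R.H N]
  [IsScalarTower ℂ (Pol (Dual ℂ V)) N]

theorem x_smul (a : Dual ℂ V) (m : M) : R.x a • m = polι a • m := by
  have h := smul_assoc (polι a : Pol (Dual ℂ V)) (1 : R.H) m
  rwa [pol_smul_def, xAlg_ι, mul_one, one_smul] at h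

theorem y_x_smul (v : V) (a : Dual ℂ V) (m : M) :
    R.y v • polι a • m = polι a • R.y v • m + a v • m -
      ∑ s : G.Refl, (c s * D.α s v * a (D.αv s)) • R.w s.1 • m := by
  rw [← x_smul R, ← x_smul R, smul_smul, R.rel', sub_smul, add_smul, mul_smul, Finset.sum_smul,
    alg_smul]
  simp only [smul_assoc]

theorem w_x_smul (g : G.W) (a : Dual ℂ V) (m : M) :
    R.w g • polι a • m = polι (contra g a) • R.w g • m := by
  rw [← x_smul R, ← x_smul R, smul_smul, R.w_x, mul_smul]; rfl

theorem w_y_smul (g : G.W) (v : V) (m : M) :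
    R.w g • R.y v • m = R.y ((g : V ≃ₗ[ℂ] V) v) • R.w g • m := by
  rw [smul_smul, R.w_y, mul_smul]

/-- A linear map commuting with the generators is linear over the Cherednik algebra. -/
def hLinear (φ : M →ₗ[ℂ] N) (hx : ∀ a m, φ (R.x a • m) = R.x a • φ m)
    (hy : ∀ v m, φ (R.y v • m) = R.y v • φ m) (hw : ∀ g m, φ (R.w g • m) = R.w g • φ m) :
    M →ₗ[R.H] N where
  toFun := φ
  map_add' := φ.map_add
  map_smul' h := by
    refine R.induction (p := fun h => ∀ m, φ (h • m) = h • φ m) hx hy hw ?_ ?_ ?_ h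
    · intro r m
      rw [alg_smul, alg_smul, map_smul]
    · intro a b ha hb m
      rw [add_smul, map_add, ha, hb, add_smul]
    · intro a b ha hb m
      rw [mul_smul, ha, hb, mul_smul]

variable {R} in
theorem map_pol_smul (φ : M →ₗ[R.H] N) (f : Pol (Dual ℂ V)) (m : M) : φ (f • m) = f • φ m :=
  (φ.restrictScalars (Pol (Dual ℂ V))).map_smul f m

variable {E : Type} [AddCommGroup E] [Module ℂ E]

variable {R} in
theorem xgen_induction {k : E →ₗ[ℂ] M}
    (hk : Submodule.span (Pol (Dual ℂ V)) (Set.range k) = ⊤)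
    (U : Submodule ℂ M) (h1 : ∀ e, k e ∈ U)
    (h : ∀ (a : Dual ℂ V), ∀ m ∈ U, polι a • m ∈ U) (m : M) : m ∈ U := by
  have : Submodule.span (Pol (Dual ℂ V)) (Set.range k) ≤ polSubmodule U h := by
    rw [Submodule.span_le]
    rintro _ ⟨e, rfl⟩
    exact h1 e
  rw [hk] at this
  exact this trivial

/-- An `S`-linear map from an `S`-generated module compatible with the lowering and group operators
on generators is linear over the Cherednik algebra. -/
theorem hLinear_of_xgen {k : E →ₗ[ℂ] M}
    (hk : Submodule.span (Pol (Dual ℂ V)) (Set.range k) = ⊤)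
    (φ : M →ₗ[Pol (Dual ℂ V)] N)
    (hy : ∀ v e, φ (R.y v • k e) = R.y v • φ (k e))
    (hw : ∀ g e, φ (R.w g • k e) = R.w g • φ (k e)) :
    ∃ ψ : M →ₗ[R.H] N, ∀ m, ψ m = φ m := by
  have hw' : ∀ g m, φ (R.w g • m) = R.w g • φ m := by
    intro g m
    let U : Submodule ℂ M :=
      { carrier := {m | ∀ g, φ (R.w g • m) = R.w g • φ m}
        add_mem' := fun {a b} ha hb g => by rw [smul_add, map_add, ha, hb, map_add, smul_add]
        zero_mem' := fun g => by simp
        smul_mem' := fun r m hm g => by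
          rw [smul_smul_comm', φ.map_smul_of_tower, hm, φ.map_smul_of_tower, smul_smul_comm'] }
    refine xgen_induction hk U (fun e g => hw g e) (fun a m hm g => ?_) m g
    rw [w_x_smul, φ.map_smul, hm g, φ.map_smul, w_x_smul]
  have hy' : ∀ v m, φ (R.y v • m) = R.y v • φ m := by
    intro v m
    let U : Submodule ℂ M :=
      { carrier := {m | ∀ v, φ (R.y v • m) = R.y v • φ m}
        add_mem' := fun {a b} ha hb g => by rw [smul_add, map_add, ha, hb, map_add, smul_add]
        zero_mem' := fun g => by simp
        smul_mem' := fun r m hm g => by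
          rw [smul_smul_comm', φ.map_smul_of_tower, hm, φ.map_smul_of_tower, smul_smul_comm'] }
    refine xgen_induction hk U (fun e g => hy g e) (fun a m hm v => ?_) m v
    rw [y_x_smul, map_sub, map_add, φ.map_smul (polι a) (R.y v • m), hm v,
      φ.map_smul (polι a) m, map_sum, φ.map_smul_of_tower, y_x_smul]
    congr 1
    refine Finset.sum_congr rfl fun s _ => ?_
    rw [φ.map_smul_of_tower, hw']
  refine ⟨hLinear R (φ.restrictScalars ℂ) (fun a m => ?_) hy' hw', fun m => rfl⟩
  change φ (R.x a • m) = R.x a • φ m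
  rw [x_smul, x_smul, map_smul]

end Framework

section Induction

variable (R : RCA G D c) {E : Type} [AddCommGroup E] [Module ℂ E]

/-- The module induced from a representation of `S(V) # W`. -/
structure IndData (ρ : G.W →* (E ≃ₗ[ℂ] E)) (Y : V →ₗ[ℂ] Module.End ℂ E) where
  Q : Type
  [ab : AddCommGroup Q]
  [modH : Module R.H Q]
  [modC : Module ℂ Q]
  [modS : Module (Pol (Dual ℂ V)) Q]
  [towerCH : IsScalarTower ℂ R.H Q]
  [towerSH : IsScalarTower (Pol (Dual ℂ V)) R.H Q]
  [towerCS : IsScalarTower ℂ (Pol (Dual ℂ V)) Q]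
  κ : E →ₗ[ℂ] Q
  κ_inj : Function.Injective κ
  projective : Module.Projective (Pol (Dual ℂ V)) Q
  finite : FiniteDimensional ℂ E → Module.Finite (Pol (Dual ℂ V)) Q
  span_eq : Submodule.span (Pol (Dual ℂ V)) (Set.range κ) = ⊤
  κ_y : ∀ v e, R.y v • κ e = κ (Y v e)
  κ_w : ∀ g e, R.w g • κ e = κ (ρ g e)
  lift : ∀ (N : Type) [AddCommGroup N] [Module R.H N] [Module ℂ N] [Module (Pol (Dual ℂ V)) N]
    [IsScalarTower ℂ R.H N] [IsScalarTower (Pol (Dual ℂ V)) R.H N]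
    [IsScalarTower ℂ (Pol (Dual ℂ V)) N] (k : E →ₗ[ℂ] N), (∀ v e, R.y v • k e = k (Y v e)) →
    (∀ g e, R.w g • k e = k (ρ g e)) → ∃ φ : Q →ₗ[R.H] N, ∀ e, φ (κ e) = k e

attribute [instance] IndData.ab IndData.modH IndData.modC IndData.modS IndData.towerCH
  IndData.towerSH IndData.towerCS

theorem exists_indData (hc : IsConjInvariant c) (ρ : G.W →* (E ≃ₗ[ℂ] E))
    (Y : V →ₗ[ℂ] Module.End ℂ E) (hY : ∀ g v e, ρ g (Y v e) = Y ((g : V ≃ₗ[ℂ] V) v) (ρ g e))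
    (hYc : ∀ u v e, Y u (Y v e) = Y v (Y u e)) : Nonempty (IndData R ρ Y) := by
  obtain ⟨T, hT, hT1⟩ := exists_dunkl D c ρ Y
  let X : Dual ℂ V →ₗ[ℂ] Module.End ℂ (Pol (Dual ℂ V) ⊗[ℂ] E) :=
    (Algebra.lsmul ℂ ℂ (Pol (Dual ℂ V) ⊗[ℂ] E)).toLinearMap ∘ₗ polι
  have hX : ∀ a m, X a m = polι a • m := fun _ _ => rfl
  obtain ⟨Φ, ⟨hΦx, hΦy, hΦw⟩, -⟩ := R.universal (Module.End ℂ (Pol (Dual ℂ V) ⊗[ℂ] E)) X T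
    (tensorW ρ)
    (fun a b => LinearMap.ext fun m => by
      rw [Module.End.mul_apply, Module.End.mul_apply, hX, hX, hX, hX, smul_comm])
    (dunkl_comm D ρ hc hY hYc hT hT1)
    (fun g a => LinearMap.ext fun m => tensorW_x ρ g a m)
    (dunkl_w D ρ hc hY hT hT1)
    (fun v a => LinearMap.ext fun m => by
      rw [finsum_eq_sum_of_fintype]
      refine Eq.trans ?_ (dunklComm_apply_apply D c ρ v a m) |>.trans ?_
      · change T v (X a m) - X a (T v m) = _
        rw [hX, hX, hT, add_sub_cancel_left]
      · rw [← dunklComm_apply_apply, dunklComm_apply]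
        congr 2)
  let modH : Module R.H (Pol (Dual ℂ V) ⊗[ℂ] E) := Module.compHom _ Φ.toRingHom
  have hdef : ∀ (h : R.H) (m : Pol (Dual ℂ V) ⊗[ℂ] E), h • m = Φ h m := fun _ _ => rfl
  have t1 : IsScalarTower ℂ R.H (Pol (Dual ℂ V) ⊗[ℂ] E) :=
    ⟨fun r h m => by rw [hdef, hdef, map_smul]; rfl⟩
  have hxAlg : ∀ (f : Pol (Dual ℂ V)) (m : Pol (Dual ℂ V) ⊗[ℂ] E), Φ (xAlg R f) m = f • m := by
    intro f
    induction f using pol_induction with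
    | algebraMap r => intro m; simp
    | ι a => intro m; rw [xAlg_ι, hΦx]; rfl
    | mul f g hf hg => intro m; rw [map_mul, map_mul, Module.End.mul_apply, hg, hf, mul_smul]
    | add f g hf hg => intro m; rw [map_add, map_add, LinearMap.add_apply, hf, hg, add_smul]
  have t2 : IsScalarTower (Pol (Dual ℂ V)) R.H (Pol (Dual ℂ V) ⊗[ℂ] E) :=
    ⟨fun f h m => by
      rw [hdef, hdef, pol_smul_def, map_mul, Module.End.mul_apply, hxAlg]⟩
  have hspan : Submodule.span (Pol (Dual ℂ V))
      (Set.range (TensorProduct.mk ℂ (Pol (Dual ℂ V)) E 1)) = ⊤ := by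
    rw [eq_top_iff]
    rintro m -
    induction m using TensorProduct.induction_on with
    | zero => exact Submodule.zero_mem _
    | tmul f e =>
      have h : f ⊗ₜ[ℂ] e = f • TensorProduct.mk ℂ (Pol (Dual ℂ V)) E 1 e := by
        rw [TensorProduct.mk_apply, smul_tmul', smul_eq_mul, mul_one]
      rw [h]
      exact Submodule.smul_mem _ _ (Submodule.subset_span ⟨e, rfl⟩)
    | add u v hu hv => exact Submodule.add_mem _ hu hv
  have hy1 : ∀ v e, R.y v • (TensorProduct.mk ℂ (Pol (Dual ℂ V)) E 1 e) =
      TensorProduct.mk ℂ (Pol (Dual ℂ V)) E 1 (Y v e) := fun v e => by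
    rw [hdef, hΦy]; exact hT1 v e
  have hw1 : ∀ g e, R.w g • (TensorProduct.mk ℂ (Pol (Dual ℂ V)) E 1 e) =
      TensorProduct.mk ℂ (Pol (Dual ℂ V)) E 1 (ρ g e) := fun g e => by
    rw [hdef, hΦw]
    refine (tensorW_tmul ρ g 1 e).trans ?_
    rw [map_one]; rfl
  refine ⟨{ Q := Pol (Dual ℂ V) ⊗[ℂ] E
            κ := TensorProduct.mk ℂ (Pol (Dual ℂ V)) E 1
            κ_inj := ?_
            projective := inferInstance
            finite := fun _ => inferInstance
            span_eq := hspan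
            κ_y := hy1
            κ_w := hw1
            lift := ?_ }⟩
  · let b := Module.finBasis ℂ V
    obtain ⟨F, hF⟩ := exists_polLift (0 : Dual ℂ V →ₗ[ℂ] ℂ) (fun _ _ => rfl)
    let ev : Pol (Dual ℂ V) ⊗[ℂ] E →ₗ[ℂ] E :=
      (TensorProduct.lid ℂ E).toLinearMap ∘ₗ TensorProduct.map F.toLinearMap LinearMap.id
    refine Function.LeftInverse.injective (g := ev) fun e => ?_
    change TensorProduct.lid ℂ E (F 1 ⊗ₜ e) = e
    simp
  · intro N _ _ _ _ _ _ _ k hky hkw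
    let φ : Pol (Dual ℂ V) ⊗[ℂ] E →ₗ[Pol (Dual ℂ V)] N := LinearMap.liftBaseChange _ k
    have hφ : ∀ e, φ (TensorProduct.mk ℂ (Pol (Dual ℂ V)) E 1 e) = k e := fun e => by
      simp [φ, LinearMap.liftBaseChange_tmul]
    obtain ⟨ψ, hψ⟩ := hLinear_of_xgen R hspan φ
      (fun v e => by rw [hy1, hφ, hφ, hky]) (fun g e => by rw [hw1, hφ, hφ, hkw])
    exact ⟨ψ, fun e => by rw [hψ, hφ]⟩

end Induction

end Cherednik

namespace Cherednik

section GenEigen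

variable {M N : Type} [AddCommGroup M] [Module ℂ M] [AddCommGroup N] [Module ℂ N]

theorem mem_genEig {f : Module.End ℂ M} {μ : ℂ} {m : M} :
    m ∈ f.maxGenEigenspace μ ↔ ∃ k : ℕ, ((f - algebraMap ℂ _ μ) ^ k) m = 0 := by
  rw [Module.End.mem_maxGenEigenspace]; rfl

theorem sub_algebraMap_apply (f : Module.End ℂ M) (μ : ℂ) (m : M) :
    (f - algebraMap ℂ _ μ) m = f m - μ • m := rfl

theorem map_genEig {f : Module.End ℂ M} {g : Module.End ℂ N} {μ ν : ℂ} (T : M →ₗ[ℂ] N)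
    (hT : ∀ m, g (T m) - ν • T m = T (f m - μ • m)) {m : M} (hm : m ∈ f.maxGenEigenspace μ) :
    T m ∈ g.maxGenEigenspace ν := by
  obtain ⟨k, hk⟩ := mem_genEig.1 hm
  refine mem_genEig.2 ⟨k, ?_⟩
  have h : ∀ (k : ℕ) m, ((g - algebraMap ℂ _ ν) ^ k) (T m) =
      T (((f - algebraMap ℂ _ μ) ^ k) m) := by
    intro k
    induction k with
    | zero => intro m; rfl
    | succ k ih =>
      intro m
      rw [pow_succ, pow_succ, Module.End.mul_apply, Module.End.mul_apply, sub_algebraMap_apply,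
        sub_algebraMap_apply, hT, ih]
  rw [h, hk, map_zero]

theorem sub_mem_genEig {f : Module.End ℂ M} {μ : ℂ} {m : M}
    (hm : f m - μ • m ∈ f.maxGenEigenspace μ) : m ∈ f.maxGenEigenspace μ := by
  obtain ⟨k, hk⟩ := mem_genEig.1 hm
  refine mem_genEig.2 ⟨k + 1, ?_⟩
  rw [pow_succ, Module.End.mul_apply, sub_algebraMap_apply, hk]

theorem apply_mem_genEig {f : Module.End ℂ M} {μ : ℂ} {m : M}
    (hm : m ∈ f.maxGenEigenspace μ) : f m ∈ f.maxGenEigenspace μ :=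
  map_genEig f (fun m => by rw [map_sub, map_smul]) hm

theorem exists_preimage_genEig {f : Module.End ℂ M} {μ l : ℂ} (h : μ ≠ l) {u : M}
    (hu : u ∈ f.maxGenEigenspace μ) : ∃ u' ∈ f.maxGenEigenspace μ, f u' - l • u' = u := by
  obtain ⟨k, hk⟩ := mem_genEig.1 hu
  clear hu
  have h0 : μ - l ≠ 0 := sub_ne_zero.2 h
  induction k generalizing u with
  | zero => exact ⟨0, Submodule.zero_mem _, by simpa using hk.symm⟩
  | succ k ih =>
    have hk' := hk
    rw [pow_succ, Module.End.mul_apply] at hk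
    obtain ⟨u', hu', h1⟩ := ih hk
    refine ⟨(μ - l)⁻¹ • (u - u'), Submodule.smul_mem _ _ (Submodule.sub_mem _
      (mem_genEig.2 ⟨_, hk'⟩) hu'), ?_⟩
    rw [sub_algebraMap_apply] at h1
    have h2 : f (u - u') - l • (u - u') = (μ - l) • u := by
      rw [map_sub, smul_sub, sub_sub_sub_comm, h1]
      module
    rw [map_smul, smul_comm l, ← smul_sub, h2, smul_smul, inv_mul_cancel₀ h0, one_smul]

theorem mem_iSup_genEig_of_sub {f : Module.End ℂ M} {A : Set ℂ} {l : ℂ} (hl : l ∈ A) {m : M}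
    (hm : f m - l • m ∈ ⨆ μ : A, f.maxGenEigenspace μ) :
    m ∈ ⨆ μ : A, f.maxGenEigenspace μ := by
  have key : ∀ u ∈ ⨆ μ : A, f.maxGenEigenspace μ, ∃ u' ∈ ⨆ μ : A, f.maxGenEigenspace μ,
      u - (f u' - l • u') ∈ f.maxGenEigenspace l := by
    intro u hu
    induction hu using Submodule.iSup_induction' with
    | mem μ u hu =>
      by_cases h : (μ : ℂ) = l
      · exact ⟨0, Submodule.zero_mem _, by simpa [h] using hu⟩
      · obtain ⟨u', hu', h'⟩ := exists_preimage_genEig h hu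
        exact ⟨u', Submodule.mem_iSup_of_mem μ hu', by rw [h', sub_self]; exact zero_mem _⟩
    | zero => exact ⟨0, Submodule.zero_mem _, by simp⟩
    | add u v _ _ hu hv =>
      obtain ⟨u', hu', h1⟩ := hu
      obtain ⟨v', hv', h2⟩ := hv
      refine ⟨u' + v', Submodule.add_mem _ hu' hv', ?_⟩
      convert Submodule.add_mem _ h1 h2 using 1
      rw [map_add, smul_add]; abel
  obtain ⟨u', hu', h⟩ := key _ hm
  have : m - u' ∈ f.maxGenEigenspace l := by
    refine sub_mem_genEig ?_
    convert h using 1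
    rw [map_sub, smul_sub]; abel
  rw [← sub_add_cancel m u']
  exact Submodule.add_mem _ (Submodule.mem_iSup_of_mem ⟨l, hl⟩ this) hu'

theorem mem_iSup_genEig_of_aeval {f : Module.End ℂ M} {A : Set ℂ} {p : Polynomial ℂ}
    (hp : p.Monic) (hA : ∀ l ∈ p.roots, l ∈ A) {m : M}
    (hm : Polynomial.aeval f p m ∈ ⨆ μ : A, f.maxGenEigenspace μ) :
    m ∈ ⨆ μ : A, f.maxGenEigenspace μ := by
  have hprod := (IsAlgClosed.splits p).eq_prod_roots_of_monic hp
  rw [hprod] at hm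
  clear hprod hp
  generalize p.roots = s at hm hA
  induction s using Multiset.induction generalizing m with
  | empty => simpa using hm
  | cons l s ih =>
    have h1 := ih (m := f m - l • m) (by
      rw [Multiset.map_cons, Multiset.prod_cons, mul_comm, map_mul, Module.End.mul_apply] at hm
      simpa using hm) (fun l' hl' => hA l' (Multiset.mem_cons_of_mem hl'))
    exact mem_iSup_genEig_of_sub (hA l (Multiset.mem_cons_self _ _)) h1

theorem genEig_isInternal {f : Module.End ℂ M} (h : ⨆ μ, f.maxGenEigenspace μ = ⊤) :
    DirectSum.IsInternal f.maxGenEigenspace :=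
  (DirectSum.isInternal_submodule_iff_iSupIndep_and_iSup_eq_top _).2
    ⟨f.independent_maxGenEigenspace, h⟩

theorem exists_glue {f : Module.End ℂ M} (h : ⨆ μ, f.maxGenEigenspace μ = ⊤)
    (F : ℂ → M →ₗ[ℂ] N) :
    ∃ T : M →ₗ[ℂ] N, ∀ μ, ∀ m ∈ f.maxGenEigenspace μ, T m = F μ m := by
  let e := LinearEquiv.ofBijective (DirectSum.coeLinearMap f.maxGenEigenspace) (genEig_isInternal h)
  refine ⟨DirectSum.toModule ℂ ℂ N (fun μ => F μ ∘ₗ (f.maxGenEigenspace μ).subtype) ∘ₗ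
    e.symm.toLinearMap, fun μ m hm => ?_⟩
  have : e.symm m = DirectSum.lof ℂ ℂ (fun μ => f.maxGenEigenspace μ) μ ⟨m, hm⟩ := by
    rw [LinearEquiv.symm_apply_eq]
    exact (DirectSum.coeLinearMap_lof (A := f.maxGenEigenspace) μ ⟨m, hm⟩).symm
  rw [LinearMap.comp_apply, LinearEquiv.coe_coe, this, DirectSum.toModule_lof]
  rfl

theorem genEig_ext {f : Module.End ℂ M} (h : ⨆ μ, f.maxGenEigenspace μ = ⊤)
    {T T' : M →ₗ[ℂ] N} (hT : ∀ μ, ∀ m ∈ f.maxGenEigenspace μ, T m = T' m) : T = T' := by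
  have : (⊤ : Submodule ℂ M) ≤ LinearMap.eqLocus T T' := by
    rw [← h]
    exact iSup_le fun μ m hm => hT μ m hm
  exact LinearMap.ext fun m => this trivial

/-- The projection onto a generalized eigenspace. -/
def eigProj (f : Module.End ℂ M) (h : ⨆ μ, f.maxGenEigenspace μ = ⊤) (μ : ℂ) :
    Module.End ℂ M :=
  (exists_glue h (fun ν => if ν = μ then LinearMap.id else 0)).choose

theorem eigProj_self {f : Module.End ℂ M} (h : ⨆ μ, f.maxGenEigenspace μ = ⊤) {μ : ℂ} {m : M}
    (hm : m ∈ f.maxGenEigenspace μ) : eigProj f h μ m = m := by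
  have := (exists_glue h (fun ν => if ν = μ then LinearMap.id else 0)).choose_spec μ m hm
  rwa [if_pos rfl] at this

theorem eigProj_ne {f : Module.End ℂ M} (h : ⨆ μ, f.maxGenEigenspace μ = ⊤) {μ ν : ℂ} {m : M}
    (hne : ν ≠ μ) (hm : m ∈ f.maxGenEigenspace ν) : eigProj f h μ m = 0 := by
  have := (exists_glue h (fun ν => if ν = μ then LinearMap.id else 0)).choose_spec ν m hm
  rwa [if_neg hne] at this

theorem eigProj_mem {f : Module.End ℂ M} (h : ⨆ μ, f.maxGenEigenspace μ = ⊤) (μ : ℂ) (m : M) :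
    eigProj f h μ m ∈ f.maxGenEigenspace μ := by
  have : (⊤ : Submodule ℂ M) ≤ (f.maxGenEigenspace μ).comap (eigProj f h μ) := by
    rw [← h]
    refine iSup_le fun ν m hm => ?_
    rw [Submodule.mem_comap]
    by_cases hν : ν = μ
    · subst hν; rwa [eigProj_self h hm]
    · rw [eigProj_ne h hν hm]; exact zero_mem _
  exact this trivial

theorem map_eigProj {f : Module.End ℂ M} (h : ⨆ μ, f.maxGenEigenspace μ = ⊤)
    {g : Module.End ℂ N} (h' : ⨆ μ, g.maxGenEigenspace μ = ⊤) (T : M →ₗ[ℂ] N)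
    (hT : ∀ μ, ∀ m ∈ f.maxGenEigenspace μ, T m ∈ g.maxGenEigenspace μ) (μ : ℂ) (m : M) :
    T (eigProj f h μ m) = eigProj g h' μ (T m) := by
  have : T ∘ₗ eigProj f h μ = eigProj g h' μ ∘ₗ T := by
    refine genEig_ext h fun ν m hm => ?_
    rw [LinearMap.comp_apply, LinearMap.comp_apply]
    by_cases hν : ν = μ
    · subst hν; rw [eigProj_self h hm, eigProj_self h' (hT _ m hm)]
    · rw [eigProj_ne h hν hm, eigProj_ne h' hν (hT _ m hm), map_zero]
  exact LinearMap.congr_fun this m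

theorem genEig_eq_bot {f : Module.End ℂ M} {A : Set ℂ}
    (h : ⨆ μ : A, f.maxGenEigenspace μ = ⊤) {μ : ℂ} (hμ : μ ∉ A) :
    f.maxGenEigenspace μ = ⊥ := by
  have h1 := f.independent_maxGenEigenspace μ
  have h2 : (⨆ j, ⨆ (_ : j ≠ μ), f.maxGenEigenspace j) = ⊤ := by
    rw [eq_top_iff, ← h]
    refine iSup_le fun ν => ?_
    have hν : (ν : ℂ) ≠ μ := by rintro rfl; exact hμ ν.2
    exact le_iSup₂_of_le (ν : ℂ) hν le_rfl
  rw [h2] at h1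
  exact disjoint_top.1 h1

end GenEigen

section Weights

variable (R : RCA G D c) {n : ℕ} (b : Basis (Fin n) ℂ V)
  {M N : Type} [AddCommGroup M] [Module R.H M] [Module ℂ M] [IsScalarTower ℂ R.H M]
  [AddCommGroup N] [Module R.H N] [Module ℂ N] [IsScalarTower ℂ R.H N]

/-- The Euler operator. -/
def euler (M : Type) [AddCommGroup M] [Module R.H M] [Module ℂ M] [IsScalarTower ℂ R.H M] :
    Module.End ℂ M := Algebra.lsmul ℂ ℂ M (eulerElt R b)

theorem euler_apply (m : M) : euler R b M m = eulerElt R b • m := rfl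

/-- The generalized weight spaces of the Euler operator. -/
def wt (M : Type) [AddCommGroup M] [Module R.H M] [Module ℂ M] [IsScalarTower ℂ R.H M] (μ : ℂ) :
    Submodule ℂ M := (euler R b M).maxGenEigenspace μ

/-- The action of an element, as a linear operator. -/
def act (h : R.H) : Module.End ℂ M := Algebra.lsmul ℂ ℂ M h

variable {R b}

theorem wt_x (a : Dual ℂ V) {μ : ℂ} {m : M} (hm : m ∈ wt R b M μ) :
    R.x a • m ∈ wt R b M (μ + 1) := by
  refine map_genEig (act R (R.x a)) (fun m => ?_) hm
  change eulerElt R b • R.x a • m - (μ + 1) • R.x a • m = R.x a • (eulerElt R b • m - μ • m)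
  rw [smul_smul, euler_x, add_smul, smul_sub, mul_smul, smul_smul_comm', add_smul, one_smul]
  abel

theorem wt_y (v : V) {μ : ℂ} {m : M} (hm : m ∈ wt R b M μ) :
    R.y v • m ∈ wt R b M (μ - 1) := by
  refine map_genEig (act R (R.y v)) (fun m => ?_) hm
  change eulerElt R b • R.y v • m - (μ - 1) • R.y v • m = R.y v • (eulerElt R b • m - μ • m)
  rw [smul_sub, smul_smul _ _ m, smul_smul (R.y v), euler_y, add_smul, smul_smul_comm', sub_smul,
    one_smul]
  abel

theorem wt_w (hc : IsConjInvariant c) (g : G.W) {μ : ℂ} {m : M} (hm : m ∈ wt R b M μ) :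
    R.w g • m ∈ wt R b M μ := by
  refine map_genEig (act R (R.w g)) (fun m => ?_) hm
  change eulerElt R b • R.w g • m - μ • R.w g • m = R.w g • (eulerElt R b • m - μ • m)
  rw [smul_sub, smul_smul _ _ m, smul_smul (R.w g), euler_w R b hc, smul_smul_comm']

theorem wt_map (φ : M →ₗ[R.H] N) {μ : ℂ} {m : M} (hm : m ∈ wt R b M μ) :
    φ m ∈ wt R b N μ := by
  refine map_genEig (φ.restrictScalars ℂ) (fun m => ?_) hm
  change eulerElt R b • φ m - μ • φ m = φ (eulerElt R b • m - μ • m)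
  rw [map_sub, map_smul]
  congr 1
  exact ((φ.restrictScalars ℂ).map_smul μ m).symm

theorem wt_of_eigen {μ : ℂ} {m : M} (hm : eulerElt R b • m = μ • m) : m ∈ wt R b M μ :=
  mem_genEig.2 ⟨1, by rw [pow_one, sub_algebraMap_apply, euler_apply, hm, sub_self]⟩

variable (R M) in
/-- Vectors killed by all products of `k` lowering operators. -/
def nilp : ℕ → Submodule ℂ M
  | 0 => ⊥
  | k + 1 =>
    { carrier := {m | ∀ v, R.y v • m ∈ nilp k}
      add_mem' := fun {a b} ha hb v => by rw [smul_add]; exact (nilp k).add_mem (ha v) (hb v)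
      zero_mem' := fun v => by rw [smul_zero]; exact (nilp k).zero_mem
      smul_mem' := fun r m hm v => by
        rw [smul_smul_comm']; exact (nilp k).smul_mem r (hm v) }

theorem mem_nilp_succ {k : ℕ} {m : M} : m ∈ nilp R M (k + 1) ↔ ∀ v, R.y v • m ∈ nilp R M k :=
  Iff.rfl

theorem mem_nilp_iff {k : ℕ} {m : M} : m ∈ nilp R M k ↔
    ∀ L : List V, L.length = k → (L.map fun v => R.y v).prod • m = 0 := by
  induction k generalizing m with
  | zero =>
    refine ⟨fun h L hL => ?_, fun h => ?_⟩
    · rw [List.length_eq_zero_iff.1 hL]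
      simpa using (Submodule.mem_bot ℂ).1 h
    · exact (Submodule.mem_bot ℂ).2 (by simpa using h [] rfl)
  | succ k ih =>
    rw [mem_nilp_succ]
    refine ⟨fun h L hL => ?_, fun h v => ?_⟩
    · obtain rfl | ⟨L', v, rfl⟩ := L.eq_nil_or_concat
      · simp at hL
      · have := (ih.1 (h v)) L' (by simpa using hL)
        simpa [mul_smul] using this
    · refine ih.2 fun L hL => ?_
      have := h (L ++ [v]) (by simp [hL])
      simpa [mul_smul] using this

theorem nilp_mono {k : ℕ} : nilp R M k ≤ nilp R M (k + 1) := by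
  induction k with
  | zero => exact bot_le
  | succ k ih => exact fun m hm v => ih (hm v)

theorem nilp_w (g : G.W) {k : ℕ} {m : M} (hm : m ∈ nilp R M k) : R.w g • m ∈ nilp R M k := by
  induction k generalizing m with
  | zero => rw [(Submodule.mem_bot ℂ).1 hm, smul_zero]; exact zero_mem _
  | succ k ih =>
    intro v
    have h := ih (hm ((g : V ≃ₗ[ℂ] V).symm v))
    rw [smul_smul, R.w_y, LinearEquiv.apply_symm_apply, mul_smul] at h
    exact h

theorem nilp_x (a : Dual ℂ V) {k : ℕ} {m : M} (hm : m ∈ nilp R M k) :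
    R.x a • m ∈ nilp R M (k + 1) := by
  induction k generalizing m with
  | zero => rw [(Submodule.mem_bot ℂ).1 hm, smul_zero]; exact zero_mem _
  | succ k ih =>
    intro v
    rw [smul_smul, R.rel', sub_smul, add_smul, mul_smul, Finset.sum_smul, alg_smul]
    refine Submodule.sub_mem _ (Submodule.add_mem _ (ih (hm v)) (Submodule.smul_mem _ _ hm))
      (Submodule.sum_mem _ fun s _ => ?_)
    rw [smul_assoc]
    exact Submodule.smul_mem _ _ (nilp_w _ hm)

theorem nilp_map (φ : M →ₗ[R.H] N) {k : ℕ} {m : M} (hm : m ∈ nilp R M k) :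
    φ m ∈ nilp R N k := by
  rw [mem_nilp_iff] at hm ⊢
  intro L hL
  rw [← map_smul, hm L hL, map_zero]

variable (R M) in
/-- Local nilpotency of the lowering operators. -/
def LocNilp : Prop := ∀ m : M, ∃ k, m ∈ nilp R M k

theorem LocNilp.of_surjective (h : LocNilp R M) (φ : M →ₗ[R.H] N) (hφ : Function.Surjective φ) :
    LocNilp R N := fun m => by
  obtain ⟨m, rfl⟩ := hφ m
  obtain ⟨k, hk⟩ := h m
  exact ⟨k, nilp_map φ hk⟩

theorem LocNilp.of_injective (h : LocNilp R N) (φ : M →ₗ[R.H] N) (hφ : Function.Injective φ) :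
    LocNilp R M := fun m => by
  obtain ⟨k, hk⟩ := h (φ m)
  refine ⟨k, mem_nilp_iff.2 fun L hL => hφ ?_⟩
  rw [map_smul, map_zero]
  exact mem_nilp_iff.1 hk L hL

variable (R) in
/-- The part of the Euler element in the group algebra. -/
def eulerZ (n : ℕ) : R.H :=
  ((n : ℂ) / 2) • (1 : R.H) - ∑ s : G.Refl, (2 * c s / (1 - D.lam s)) • R.w s.1

theorem eulerElt_eq_add : eulerElt R b = (∑ i, R.x (b.coord i) * R.y (b i)) + eulerZ R n := by
  rw [eulerElt_eq, eulerZ, add_sub_assoc]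

theorem isIntegral_eulerZ : IsIntegral ℂ (eulerZ R n) := by
  let F : MonoidAlgebra ℂ G.W →ₐ[ℂ] R.H := MonoidAlgebra.lift ℂ R.H G.W R.w
  have h : eulerZ R n = F (((n : ℂ) / 2) • 1 -
      ∑ s : G.Refl, (2 * c s / (1 - D.lam s)) • MonoidAlgebra.of ℂ G.W s.1) := by
    simp [F, eulerZ]
  rw [h]
  exact (IsIntegral.of_finite ℂ _).map F

variable (R n) in
/-- The set of possible weights of modules in category `O`. -/
def wtSet : Set ℂ := {μ | ∃ l ∈ (minpoly ℂ (eulerZ R n)).roots, ∃ k : ℕ, μ = l + k}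

theorem exists_not_mem_wtSet (a : ℂ) : ∃ N : ℕ, ∀ N' : ℕ, N ≤ N' → a - N' ∉ wtSet R n := by
  obtain ⟨B, hB⟩ := ((minpoly ℂ (eulerZ R n)).roots.toFinset.image (fun l => ‖a - l‖)).exists_le
  obtain ⟨N, hN⟩ := exists_nat_gt B
  refine ⟨N, fun N' hN' => ?_⟩
  rintro ⟨l, hl, k, h⟩
  have h1 : a - l = ((N' + k : ℕ) : ℂ) := by push_cast; linear_combination h
  have h2 : ‖a - l‖ ≤ B := hB _ (Finset.mem_image_of_mem _ (Multiset.mem_toFinset.2 hl))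
  rw [h1, Complex.norm_natCast] at h2
  have h3 : (N : ℝ) ≤ N' := by exact_mod_cast hN'
  push_cast at h2
  have : (0 : ℝ) ≤ k := Nat.cast_nonneg k
  linarith

theorem euler_comm_eulerZ (hc : IsConjInvariant c) :
    eulerElt R b * eulerZ R n = eulerZ R n * eulerElt R b := by
  rw [eulerZ, mul_sub, sub_mul, mul_smul_comm, smul_mul_assoc, one_mul, mul_one, Finset.mul_sum,
    Finset.sum_mul]
  congr 1
  refine Finset.sum_congr rfl fun s _ => ?_
  rw [mul_smul_comm, smul_mul_assoc, euler_w R b hc]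

theorem iSup_wt_nilp (hc : IsConjInvariant c) (k : ℕ) :
    nilp R M k ≤ ⨆ μ : wtSet R n, wt R b M μ := by
  set U := ⨆ μ : wtSet R n, wt R b M μ with hU
  have hUx : ∀ a, ∀ m ∈ U, R.x a • m ∈ U := by
    intro a
    change U ≤ U.comap (act R (R.x a))
    refine iSup_le fun μ m hm => ?_
    obtain ⟨l, hl, k, h⟩ := μ.2
    exact Submodule.mem_iSup_of_mem (⟨μ + 1, l, hl, k + 1, by rw [h]; push_cast; ring⟩ : wtSet R n)
      (wt_x a hm)
  have hUw : ∀ g, ∀ m ∈ U, R.w g • m ∈ U := by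
    intro g
    change U ≤ U.comap (act R (R.w g))
    exact iSup_le fun μ m hm => Submodule.mem_iSup_of_mem μ (wt_w hc g hm)
  have hUe : ∀ m ∈ U, eulerElt R b • m ∈ U := by
    change U ≤ U.comap (act R (eulerElt R b))
    exact iSup_le fun μ m hm => Submodule.mem_iSup_of_mem μ (apply_mem_genEig hm)
  have hUz : ∀ m ∈ U, eulerZ R n • m ∈ U := by
    intro m hm
    rw [eulerZ, sub_smul, Finset.sum_smul, smul_assoc, one_smul]
    refine Submodule.sub_mem _ (Submodule.smul_mem _ _ hm) (Submodule.sum_mem _ fun s _ => ?_)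
    rw [smul_assoc]
    exact Submodule.smul_mem _ _ (hUw _ m hm)
  induction k with
  | zero => exact bot_le
  | succ k ih =>
    intro m hm
    have h1 : (eulerElt R b - eulerZ R n) • m ∈ U := by
      rw [eulerElt_eq_add, add_sub_cancel_right, Finset.sum_smul]
      refine Submodule.sum_mem _ fun i _ => ?_
      rw [mul_smul]
      exact hUx _ _ (ih (hm _))
    have hzpow : ∀ j : ℕ, (eulerElt R b - eulerZ R n) • eulerZ R n ^ j • m ∈ U := by
      intro j
      have hcomm : Commute (eulerElt R b - eulerZ R n) (eulerZ R n ^ j) :=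
        (Commute.sub_left (euler_comm_eulerZ hc) (Commute.refl _)).pow_right j
      rw [smul_smul, hcomm.eq, mul_smul]
      have : ∀ u ∈ U, eulerZ R n ^ j • u ∈ U := by
        induction j with
        | zero => intro u hu; rwa [pow_zero, one_smul]
        | succ j ihj => 
          intro u hu
          rw [pow_succ, mul_smul]
          exact ihj ((Commute.sub_left (euler_comm_eulerZ hc) (Commute.refl _)).pow_right j) _
            (hUz _ hu)
      exact this _ h1
    have hpow : ∀ j : ℕ, (eulerElt R b ^ j - eulerZ R n ^ j) • m ∈ U := by
      intro j
      induction j with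
      | zero => simp
      | succ j ihj =>
        have : eulerElt R b ^ (j + 1) - eulerZ R n ^ (j + 1) =
            eulerElt R b * (eulerElt R b ^ j - eulerZ R n ^ j) +
              (eulerElt R b - eulerZ R n) * eulerZ R n ^ j := by
          rw [pow_succ', pow_succ']; noncomm_ring
        rw [this, add_smul, mul_smul, mul_smul]
        exact Submodule.add_mem _ (hUe _ ihj) (hzpow j)
    have hpoly : ∀ p : Polynomial ℂ,
        (Polynomial.aeval (eulerElt R b) p - Polynomial.aeval (eulerZ R n) p) • m ∈ U := by
      intro p
      induction p using Polynomial.induction_on' with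
      | add p q hp hq =>
        rw [map_add, map_add, add_sub_add_comm, add_smul]
        exact Submodule.add_mem _ hp hq
      | monomial j r =>
        rw [Polynomial.aeval_monomial, Polynomial.aeval_monomial, ← mul_sub, mul_smul, alg_smul]
        exact Submodule.smul_mem _ _ (hpow j)
    have h2 := hpoly (minpoly ℂ (eulerZ R n))
    rw [minpoly.aeval, sub_zero] at h2
    refine mem_iSup_genEig_of_aeval (A := wtSet R n) (p := minpoly ℂ (eulerZ R n))
      (minpoly.monic isIntegral_eulerZ) (fun l hl => ⟨l, hl, 0, by simp⟩) ?_
    have h3 : Polynomial.aeval (euler R b M) (minpoly ℂ (eulerZ R n)) m =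
        Polynomial.aeval (eulerElt R b) (minpoly ℂ (eulerZ R n)) • m := by
      rw [euler, Polynomial.aeval_algHom_apply]; rfl
    rw [h3]
    exact h2

theorem LocNilp.iSup_wtSet (h : LocNilp R M) (hc : IsConjInvariant c) :
    ⨆ μ : wtSet R n, wt R b M μ = ⊤ := by
  rw [eq_top_iff]
  intro m _
  obtain ⟨k, hk⟩ := h m
  exact iSup_wt_nilp hc k hk

theorem LocNilp.iSup_wt (h : LocNilp R M) (hc : IsConjInvariant c) :
    ⨆ μ, wt R b M μ = ⊤ := by
  rw [eq_top_iff, ← h.iSup_wtSet (b := b) hc]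
  exact iSup_le fun μ => le_iSup _ (μ : ℂ)

theorem LocNilp.wt_eq_bot (h : LocNilp R M) (hc : IsConjInvariant c) {μ : ℂ}
    (hμ : μ ∉ wtSet R n) : wt R b M μ = ⊥ :=
  genEig_eq_bot (h.iSup_wtSet hc) hμ

theorem wt_le_nilp {a : ℂ} (hbot : wt R b M a = ⊥) (k : ℕ) :
    wt R b M (a + k) ≤ nilp R M k := by
  induction k with
  | zero => rw [Nat.cast_zero, add_zero, hbot]; exact bot_le
  | succ k ih =>
    intro m hm v
    refine ih ?_
    have := wt_y v hm
    rwa [Nat.cast_succ, ← add_assoc, add_sub_cancel_right] at this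

/-- The projection onto a weight space. -/
def pr (hc : IsConjInvariant c) (h : LocNilp R M) (μ : ℂ) : Module.End ℂ M :=
  eigProj (euler R b M) (h.iSup_wt hc) μ

end Weights

end Cherednik

namespace Cherednik

open TensorProduct

section WeightLemmas

variable {R : RCA G D c} {n : ℕ} {b : Basis (Fin n) ℂ V}
  {M N : Type} [AddCommGroup M] [Module R.H M] [Module ℂ M] [IsScalarTower ℂ R.H M]
  [AddCommGroup N] [Module R.H N] [Module ℂ N] [IsScalarTower ℂ R.H N]

theorem map_c_smul (φ : M →ₗ[R.H] N) (r : ℂ) (m : M) : φ (r • m) = r • φ m :=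
  (φ.restrictScalars ℂ).map_smul r m

theorem wt_of_injective (φ : M →ₗ[R.H] N) (hφ : Function.Injective φ) {μ : ℂ} {m : M}
    (h : φ m ∈ wt R b N μ) : m ∈ wt R b M μ := by
  obtain ⟨k, hk⟩ := mem_genEig.1 h
  refine mem_genEig.2 ⟨k, hφ ?_⟩
  rw [map_zero, ← hk]
  clear h hk
  induction k generalizing m with
  | zero => rfl
  | succ k ih =>
    rw [pow_succ, pow_succ, Module.End.mul_apply, Module.End.mul_apply, ih]
    congr 1
    rw [sub_algebraMap_apply, sub_algebraMap_apply, map_sub, map_c_smul, euler_apply,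
      euler_apply, map_smul]

theorem pr_self (hc : IsConjInvariant c) (h : LocNilp R M) {μ : ℂ} {m : M}
    (hm : m ∈ wt R b M μ) : pr (b := b) hc h μ m = m := eigProj_self _ hm

theorem pr_ne (hc : IsConjInvariant c) (h : LocNilp R M) {μ ν : ℂ} (hne : ν ≠ μ) {m : M}
    (hm : m ∈ wt R b M ν) : pr (b := b) hc h μ m = 0 := eigProj_ne _ hne hm

theorem pr_mem (hc : IsConjInvariant c) (h : LocNilp R M) (μ : ℂ) (m : M) :
    pr (b := b) hc h μ m ∈ wt R b M μ := eigProj_mem _ μ m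

theorem map_pr (hc : IsConjInvariant c) (h : LocNilp R M) (h' : LocNilp R N) (φ : M →ₗ[R.H] N)
    (μ : ℂ) (m : M) : φ (pr (b := b) hc h μ m) = pr (b := b) hc h' μ (φ m) :=
  map_eigProj _ _ (φ.restrictScalars ℂ) (fun _ _ hm => wt_map φ hm) μ m

theorem wt_ext (hc : IsConjInvariant c) (h : LocNilp R M) {F : Type} [AddCommGroup F] [Module ℂ F]
    {T T' : M →ₗ[ℂ] F} (hT : ∀ μ, ∀ m ∈ wt R b M μ, T m = T' m) : T = T' :=
  genEig_ext (h.iSup_wt hc) hT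

theorem exists_wt_preimage (hc : IsConjInvariant c) (h : LocNilp R M) (φ : M →ₗ[R.H] N)
    (hφ : Function.Surjective φ) {μ : ℂ} {x : N} (hx : x ∈ wt R b N μ) :
    ∃ m ∈ wt R b M μ, φ m = x := by
  obtain ⟨m, rfl⟩ := hφ x
  refine ⟨pr hc h μ m, pr_mem hc h μ m, ?_⟩
  rw [map_pr hc h (h.of_surjective φ hφ), pr_self hc _ hx]

theorem exists_wt_le_nilp (R : RCA G D c) (b : Basis (Fin n) ℂ V) (hc : IsConjInvariant c)
    (a : ℂ) : ∃ k : ℕ, ∀ (M : Type) [AddCommGroup M] [Module R.H M] [Module ℂ M]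
      [IsScalarTower ℂ R.H M], LocNilp R M → wt R b M a ≤ nilp R M k := by
  obtain ⟨k, hk⟩ := exists_not_mem_wtSet (R := R) (n := n) a
  refine ⟨k, fun M _ _ _ _ h => ?_⟩
  have := wt_le_nilp (h.wt_eq_bot (b := b) hc (hk k le_rfl)) k
  rwa [sub_add_cancel] at this

theorem nilp_y (v : V) {k : ℕ} {m : M} (hm : m ∈ nilp R M k) : R.y v • m ∈ nilp R M k := by
  cases k with
  | zero => rw [(Submodule.mem_bot ℂ).1 hm, smul_zero]; exact zero_mem _
  | succ k => exact nilp_mono (hm v)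

theorem exists_equivariant_lift (hc : IsConjInvariant c) (h : LocNilp R M) (φ : M →ₗ[R.H] N)
    (hφ : Function.Surjective φ) {T : Type} [AddCommGroup T] [Module ℂ T]
    (ρ : G.W →* (T ≃ₗ[ℂ] T)) (κ : T →ₗ[ℂ] N) (hκw : ∀ g t, R.w g • κ t = κ (ρ g t)) {μ : ℂ}
    (hκ : ∀ t, κ t ∈ wt R b N μ) :
    ∃ κ' : T →ₗ[ℂ] M, (∀ t, φ (κ' t) = κ t) ∧ (∀ g t, R.w g • κ' t = κ' (ρ g t)) ∧
      ∀ t, κ' t ∈ wt R b M μ := by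
  let _ : Fintype G.W := Fintype.ofFinite _
  let φ' : wt R b M μ →ₗ[ℂ] wt R b N μ :=
    (φ.restrictScalars ℂ).restrict fun m hm => wt_map φ hm
  have hφ' : Function.Surjective φ' := by
    rintro ⟨x, hx⟩
    obtain ⟨m, hm, h1⟩ := exists_wt_preimage hc h φ hφ hx
    exact ⟨⟨m, hm⟩, Subtype.ext h1⟩
  obtain ⟨k, hk⟩ := Module.projective_lifting_property φ' (κ.codRestrict _ hκ) hφ'
  have hk1 : ∀ t, φ (k t : M) = κ t := fun t =>
    congrArg Subtype.val (LinearMap.congr_fun hk t)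
  let k' : T →ₗ[ℂ] M := (wt R b M μ).subtype ∘ₗ k
  have hk1 : ∀ t, φ (k' t) = κ t := fun t =>
    congrArg Subtype.val (LinearMap.congr_fun hk t)
  have hk2 : ∀ t, k' t ∈ wt R b M μ := fun t => (k t).2
  have hW : (Fintype.card G.W : ℂ) ≠ 0 := Nat.cast_ne_zero.2 Fintype.card_ne_zero
  refine ⟨(Fintype.card G.W : ℂ)⁻¹ • ∑ g : G.W, act R (R.w g) ∘ₗ k' ∘ₗ (ρ g⁻¹ : T →ₗ[ℂ] T),
    fun t => ?_, fun g t => ?_, fun t => ?_⟩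
  · rw [LinearMap.smul_apply, map_c_smul, LinearMap.sum_apply, map_sum]
    have : ∀ g : G.W, φ ((act R (R.w g) ∘ₗ k' ∘ₗ (ρ g⁻¹ : T →ₗ[ℂ] T)) t) = κ t := by
      intro g
      change φ (R.w g • k' (ρ g⁻¹ t)) = _
      rw [map_smul, hk1, hκw, ← LinearEquiv.mul_apply, ← map_mul, mul_inv_cancel, map_one]
      rfl
    rw [Finset.sum_congr rfl fun g _ => this g, Finset.sum_const, Finset.card_univ,
      ← Nat.cast_smul_eq_nsmul ℂ, smul_smul, inv_mul_cancel₀ hW, one_smul]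
  · rw [LinearMap.smul_apply, LinearMap.smul_apply, smul_smul_comm', LinearMap.sum_apply,
      LinearMap.sum_apply, Finset.smul_sum]
    congr 1
    refine Fintype.sum_equiv (Equiv.mulLeft g) _ _ fun g' => ?_
    change R.w g • R.w g' • k' (ρ g'⁻¹ t) = R.w (g * g') • k' (ρ (g * g')⁻¹ (ρ g t))
    rw [map_mul, mul_smul, ← LinearEquiv.mul_apply, ← map_mul, mul_inv_rev, mul_assoc,
      inv_mul_cancel, mul_one]
  · rw [LinearMap.smul_apply, LinearMap.sum_apply]
    exact Submodule.smul_mem _ _ (Submodule.sum_mem _ fun g _ => wt_w hc g (hk2 _))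

end WeightLemmas

section Finiteness

variable {R : RCA G D c} {n : ℕ} {b : Basis (Fin n) ℂ V}
  {M : Type} [AddCommGroup M] [Module R.H M] [Module ℂ M] [Module (Pol (Dual ℂ V)) M]
  [IsScalarTower ℂ R.H M] [IsScalarTower (Pol (Dual ℂ V)) R.H M]
  [IsScalarTower ℂ (Pol (Dual ℂ V)) M]

theorem finiteDimensional_wt (hc : IsConjInvariant c) (h : LocNilp R M)
    [Module.Finite (Pol (Dual ℂ V)) M] (μ : ℂ) : FiniteDimensional ℂ (wt R b M μ) := by
  have hspan : Submodule.span (Pol (Dual ℂ V)) {m : M | ∃ ν, m ∈ wt R b M ν} = ⊤ := by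
    have h1 : (⊤ : Submodule ℂ M) ≤
        (Submodule.span (Pol (Dual ℂ V)) {m : M | ∃ ν, m ∈ wt R b M ν}).restrictScalars ℂ := by
      rw [← h.iSup_wt (b := b) hc]
      exact iSup_le fun ν m hm => Submodule.subset_span ⟨ν, hm⟩
    exact eq_top_iff.2 fun m _ => h1 (x := m) trivial
  have hfg : (Submodule.span (Pol (Dual ℂ V)) {m : M | ∃ ν, m ∈ wt R b M ν}).FG :=
    hspan ▸ Module.Finite.fg_top
  obtain ⟨s, hs, hs'⟩ := (Submodule.fg_span_iff_fg_span_finset_subset _).1 hfg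
  rw [hspan] at hs'
  choose! ν hν using fun m (hm : m ∈ (s : Set M)) => hs hm
  let X : Dual ℂ V →ₗ[ℂ] M →ₗ[ℂ] M :=
    (Algebra.lsmul ℂ ℂ M : R.H →ₐ[ℂ] _).toLinearMap ∘ₗ R.x
  let Z : ℕ → Submodule ℂ M := fun d =>
    Nat.rec (motive := fun _ => Submodule ℂ M) (Submodule.span ℂ (s : Set M)) (fun _ U => Submodule.map₂ X ⊤ U) d
  have hZ0 : Z 0 = Submodule.span ℂ (s : Set M) := rfl
  have hZs : ∀ d, Z (d + 1) = Submodule.map₂ X ⊤ (Z d) := fun _ => rfl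
  have hZfd : ∀ d, FiniteDimensional ℂ ↥(Z d) := by
    intro d
    refine Module.Finite.iff_fg.2 ?_
    induction d with
    | zero => exact ⟨s, rfl⟩
    | succ d ih => rw [hZs]; exact Submodule.FG.map₂ _ Module.Finite.fg_top ih
  have htop : ∀ m, m ∈ ⨆ d, Z d := by
    have hX : ∀ (a : Dual ℂ V), ∀ m ∈ ⨆ d, Z d, polι a • m ∈ ⨆ d, Z d := by
      intro a m hm
      rw [← x_smul R]
      have : ⨆ d, Z d ≤ (⨆ d, Z d).comap (X a) := iSup_le fun d m hm =>
        Submodule.mem_iSup_of_mem (d + 1) (Submodule.apply_mem_map₂ X trivial hm)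
      exact this hm
    have h1 : Submodule.span (Pol (Dual ℂ V)) (s : Set M) ≤ polSubmodule (⨆ d, Z d) hX :=
      Submodule.span_le.2 fun m hm =>
        Submodule.mem_iSup_of_mem 0 (hZ0 ▸ Submodule.subset_span hm : m ∈ Z 0)
    rw [← hs'] at h1
    exact fun m => h1 (x := m) trivial
  have hZw : ∀ d, Z d ≤ ⨆ m : s, wt R b M (ν m + d) := by
    intro d
    induction d with
    | zero =>
      rw [hZ0, Submodule.span_le]
      intro m hm
      refine Submodule.mem_iSup_of_mem ⟨m, hm⟩ ?_
      rw [Nat.cast_zero, add_zero]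
      exact hν m hm
    | succ d ih =>
      rw [hZs, Submodule.map₂_le]
      intro a _ m hm
      have : ⨆ m : s, wt R b M (ν m + d) ≤
          (⨆ m : s, wt R b M (ν m + (d + 1 : ℕ))).comap (X a) := by
        refine iSup_le fun m u hu => Submodule.mem_iSup_of_mem m ?_
        rw [Nat.cast_succ, ← add_assoc]
        exact wt_x a hu
      exact this (ih hm)
  obtain ⟨N, hN⟩ : ∃ N : ℕ, ∀ d : ℕ, N ≤ d → ∀ m : s, ν m + d ≠ μ := by
    obtain ⟨B, hB⟩ := (s.image (fun m => ‖μ - ν m‖)).exists_le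
    obtain ⟨N, hN⟩ := exists_nat_gt B
    refine ⟨N, fun d hd m h => ?_⟩
    have h2 : ‖μ - ν m‖ ≤ B := hB _ (Finset.mem_image_of_mem _ m.2)
    rw [← h, add_sub_cancel_left, Complex.norm_natCast] at h2
    have h3 : (N : ℝ) ≤ d := by exact_mod_cast hd
    linarith
  have hle : wt R b M μ ≤ (⨆ d : Fin N, Z d).map (pr (b := b) hc h μ) := by
    intro m hm
    have h1 : ∀ u ∈ ⨆ d, Z d, pr (b := b) hc h μ u ∈
        (⨆ d : Fin N, Z d).map (pr (b := b) hc h μ) := by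
      change ⨆ d, Z d ≤ ((⨆ d : Fin N, Z d).map (pr (b := b) hc h μ)).comap (pr (b := b) hc h μ)
      refine iSup_le fun d u hu => ?_
      by_cases hd : d < N
      · exact Submodule.mem_map_of_mem (Submodule.mem_iSup_of_mem (⟨d, hd⟩ : Fin N) hu)
      · have h2 : (⨆ m : s, wt R b M (ν m + d)) ≤ LinearMap.ker (pr (b := b) hc h μ) :=
          iSup_le fun m u hu => pr_ne hc h (hN d (not_lt.1 hd) m) hu
        rw [Submodule.mem_comap, h2 (hZw d hu)]
        exact zero_mem _
    have := h1 m (htop m)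
    rwa [pr_self hc h hm] at this
  exact Submodule.finiteDimensional_of_le hle

end Finiteness

end Cherednik

namespace Cherednik

open TensorProduct

section Jet

variable (R : RCA G D c) {T : Type} [AddCommGroup T] [Module ℂ T]

/-- The subalgebra of lowering operators. -/
def yAlg : Pol V →ₐ[ℂ] R.H := polLift R.y R.comm_y

@[simp] theorem yAlg_ι (v : V) : yAlg R (polι v) = R.y v := polLift_ι _ _ _

/-- The diagonal action of `W` on `ℂ[V*] ⊗ T`. -/
def jetW (ρ : G.W →* (T ≃ₗ[ℂ] T)) : G.W →* Module.End ℂ (Pol V ⊗[ℂ] T) where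
  toFun g := TensorProduct.map (polMap (g : V ≃ₗ[ℂ] V).toLinearMap).toLinearMap (ρ g : T →ₗ[ℂ] T)
  map_one' := by
    have h : ((1 : G.W) : V ≃ₗ[ℂ] V).toLinearMap = LinearMap.id := rfl
    refine TensorProduct.ext' fun f e => ?_
    rw [TensorProduct.map_tmul, h, polMap_id, map_one]
    rfl
  map_mul' g g' := by
    have h : ((g * g' : G.W) : V ≃ₗ[ℂ] V).toLinearMap =
      (g : V ≃ₗ[ℂ] V).toLinearMap ∘ₗ (g' : V ≃ₗ[ℂ] V).toLinearMap := rfl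
    refine TensorProduct.ext' fun f e => ?_
    rw [Module.End.mul_apply, TensorProduct.map_tmul, TensorProduct.map_tmul,
      TensorProduct.map_tmul, h, polMap_comp, map_mul]
    rfl

theorem jetW_y (ρ : G.W →* (T ≃ₗ[ℂ] T)) (g : G.W) (v : V) (m : Pol V ⊗[ℂ] T) :
    jetW ρ g (polι v • m) = polι ((g : V ≃ₗ[ℂ] V) v) • jetW ρ g m := by
  induction m using TensorProduct.induction_on with
  | zero => simp
  | tmul f e =>
    change jetW ρ g ((polι v * f) ⊗ₜ e) = _ • (polMap _ f ⊗ₜ ρ g e)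
    rw [smul_tmul', smul_eq_mul]
    change polMap _ (polι v * f) ⊗ₜ ρ g e = _
    rw [map_mul, polMap_ι]
    rfl
  | add u v hu hv => rw [smul_add, map_add, hu, hv, map_add, smul_add]

/-- The multiplication of `ℂ[V*] ⊗ T` by linear functions. -/
def jetY (T : Type) [AddCommGroup T] [Module ℂ T] : V →ₗ[ℂ] Module.End ℂ (Pol V ⊗[ℂ] T) :=
  (Algebra.lsmul ℂ ℂ (Pol V ⊗[ℂ] T)).toLinearMap ∘ₗ polι

theorem jetY_apply (v : V) (m : Pol V ⊗[ℂ] T) : jetY T v m = polι v • m := rfl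

/-- The filtration of `ℂ[V*] ⊗ T` by degree. -/
def jetFil (V T : Type) [AddCommGroup V] [Module ℂ V] [AddCommGroup T] [Module ℂ T] :
    ℕ → Submodule ℂ (Pol V ⊗[ℂ] T)
  | 0 => ⊤
  | k + 1 => Submodule.map₂ (jetY T) ⊤ (jetFil V T k)

theorem jetFil_y (k : ℕ) (v : V) {m : Pol V ⊗[ℂ] T} (hm : m ∈ jetFil V T k) :
    jetY T v m ∈ jetFil V T (k + 1) := Submodule.apply_mem_map₂ _ trivial hm

theorem jetFil_y' (k : ℕ) (v : V) {m : Pol V ⊗[ℂ] T} (hm : m ∈ jetFil V T k) :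
    jetY T v m ∈ jetFil V T k := by
  induction k generalizing m v with
  | zero => trivial
  | succ k ih =>
    have : jetFil V T (k + 1) ≤ (jetFil V T (k + 1)).comap (jetY T v) := by
      rw [jetFil, Submodule.map₂_le]
      intro u _ m hm
      rw [Submodule.mem_comap]
      exact jetFil_y k v (ih u hm)
    exact this hm

theorem jetFil_w (ρ : G.W →* (T ≃ₗ[ℂ] T)) (k : ℕ) (g : G.W) {m : Pol V ⊗[ℂ] T}
    (hm : m ∈ jetFil V T k) : jetW ρ g m ∈ jetFil V T k := by
  induction k generalizing m with
  | zero => trivial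
  | succ k ih =>
    have : jetFil V T (k + 1) ≤ (jetFil V T (k + 1)).comap (jetW ρ g) := by
      rw [jetFil, Submodule.map₂_le]
      intro u _ m hm
      rw [Submodule.mem_comap, jetY_apply, jetW_y]
      exact jetFil_y k _ (ih hm)
    exact this hm

theorem jetFil_cofinite [FiniteDimensional ℂ T] (k : ℕ) :
    ∃ U : Submodule ℂ (Pol V ⊗[ℂ] T), U.FG ∧ U ⊔ jetFil V T k = ⊤ := by
  induction k with
  | zero => exact ⟨⊥, Submodule.fg_bot, by simp [jetFil]⟩
  | succ k ih =>
    obtain ⟨U, hU, hUk⟩ := ih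
    refine ⟨LinearMap.range (TensorProduct.mk ℂ (Pol V) T 1) ⊔ Submodule.map₂ (jetY T) ⊤ U,
      Submodule.FG.sup (by rw [LinearMap.range_eq_map]; exact Module.Finite.fg_top.map _)
        (Submodule.FG.map₂ _ Module.Finite.fg_top hU), ?_⟩
    rw [sup_assoc, jetFil, ← Submodule.map₂_sup_right, hUk]
    refine pol_tensor_top _ (fun e => Submodule.mem_sup_left ⟨e, rfl⟩) fun v m _ =>
      Submodule.mem_sup_right (Submodule.apply_mem_map₂ (jetY T) trivial trivial)

/-- A nilpotent finite dimensional representation of `S(V) # W` induced from a representation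
of `W`. -/
structure JetData (ρ : G.W →* (T ≃ₗ[ℂ] T)) (N : ℕ) where
  E : Type
  [ab : AddCommGroup E]
  [mod : Module ℂ E]
  [fd : FiniteDimensional ℂ E]
  σ : G.W →* (E ≃ₗ[ℂ] E)
  Y : V →ₗ[ℂ] Module.End ℂ E
  k : T →ₗ[ℂ] E
  σ_Y : ∀ g v e, σ g (Y v e) = Y ((g : V ≃ₗ[ℂ] V) v) (σ g e)
  Y_comm : ∀ u v e, Y u (Y v e) = Y v (Y u e)
  σ_k : ∀ g t, σ g (k t) = k (ρ g t)
  gen : ∀ U : Submodule ℂ E, (∀ t, k t ∈ U) → (∀ v, ∀ e ∈ U, Y v e ∈ U) → U = ⊤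
  fil : ℕ → Submodule ℂ E
  fil_zero : fil 0 = ⊤
  fil_N : fil N = ⊥
  fil_Y : ∀ j v e, e ∈ fil j → Y v e ∈ fil (j + 1)
  lift : ∀ (M : Type) [AddCommGroup M] [Module R.H M] [Module ℂ M] [IsScalarTower ℂ R.H M]
    (κ : T →ₗ[ℂ] M), (∀ t, κ t ∈ nilp R M N) →
    ∃ F : E →ₗ[ℂ] M, (∀ t, F (k t) = κ t) ∧ ∀ v e, F (Y v e) = R.y v • F e

attribute [instance] JetData.ab JetData.mod JetData.fd

theorem exists_jetData [FiniteDimensional ℂ T] (ρ : G.W →* (T ≃ₗ[ℂ] T)) (N : ℕ) :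
    Nonempty (JetData R ρ N) := by
  let J := jetFil V T N
  let Wq : G.W →* Module.End ℂ ((Pol V ⊗[ℂ] T) ⧸ J) :=
    { toFun := fun g => J.mapQ J (jetW ρ g) fun m hm => jetFil_w ρ N g hm
      map_one' := by
        refine Submodule.linearMap_qext _ (LinearMap.ext fun m => ?_)
        change J.mkQ (jetW ρ 1 m) = J.mkQ m
        rw [map_one]; rfl
      map_mul' := fun g g' => by
        refine Submodule.linearMap_qext _ (LinearMap.ext fun m => ?_)
        change J.mkQ (jetW ρ (g * g') m) = J.mkQ (jetW ρ g (jetW ρ g' m))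
        rw [map_mul]; rfl }
  let Yq : V →ₗ[ℂ] Module.End ℂ ((Pol V ⊗[ℂ] T) ⧸ J) :=
    { toFun := fun v => J.mapQ J (jetY T v) fun m hm => jetFil_y' N v hm
      map_add' := fun u v => by
        refine Submodule.linearMap_qext _ (LinearMap.ext fun m => ?_)
        change J.mkQ (jetY T (u + v) m) = J.mkQ (jetY T u m) + J.mkQ (jetY T v m)
        rw [map_add]; rfl
      map_smul' := fun r v => by
        refine Submodule.linearMap_qext _ (LinearMap.ext fun m => ?_)
        change J.mkQ (jetY T (r • v) m) = r • J.mkQ (jetY T v m)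
        rw [map_smul]; rfl }
  have hfd : FiniteDimensional ℂ ((Pol V ⊗[ℂ] T) ⧸ J) := by
    obtain ⟨U, hU, hUJ⟩ := jetFil_cofinite (V := V) (T := T) N
    refine Module.finite_def.2 ?_
    have h1 : (⊤ : Submodule ℂ ((Pol V ⊗[ℂ] T) ⧸ J)) = U.map J.mkQ := by
      have h2 : (U ⊔ J).map J.mkQ = ⊤ := by
        rw [hUJ, Submodule.map_top, Submodule.range_mkQ]
      rw [← h2, Submodule.map_sup, Submodule.mkQ_map_self, sup_bot_eq]
    rw [h1]
    exact hU.map _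
  refine ⟨{ E := (Pol V ⊗[ℂ] T) ⧸ J
            σ := (LinearMap.GeneralLinearGroup.generalLinearEquiv ℂ _).toMonoidHom.comp
              Wq.toHomUnits
            Y := Yq
            k := J.mkQ ∘ₗ TensorProduct.mk ℂ (Pol V) T 1
            σ_Y := ?_
            Y_comm := ?_
            σ_k := ?_
            gen := ?_
            fil := fun j => (jetFil V T j).map J.mkQ
            fil_zero := by
              change (⊤ : Submodule ℂ _).map J.mkQ = ⊤
              rw [Submodule.map_top, Submodule.range_mkQ]
            fil_N := Submodule.mkQ_map_self J
            fil_Y := ?_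
            lift := ?_ }⟩
  · intro g v e
    obtain ⟨m, rfl⟩ := J.mkQ_surjective e
    change J.mkQ (jetW ρ g (jetY T v m)) = J.mkQ (jetY T _ (jetW ρ g m))
    rw [jetY_apply, jetW_y, jetY_apply]
  · intro u v e
    obtain ⟨m, rfl⟩ := J.mkQ_surjective e
    change J.mkQ (jetY T u (jetY T v m)) = J.mkQ (jetY T v (jetY T u m))
    rw [jetY_apply, jetY_apply, smul_comm, jetY_apply, jetY_apply]
  · intro g t
    change J.mkQ (polMap _ 1 ⊗ₜ ρ g t) = J.mkQ (1 ⊗ₜ ρ g t)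
    rw [map_one]
  · intro U hk hY
    have h := pol_tensor_top (U.comap J.mkQ) hk fun v m hm => hY v _ hm
    rw [eq_top_iff]
    intro e _
    obtain ⟨m, rfl⟩ := J.mkQ_surjective e
    exact (h ▸ Submodule.mem_top : m ∈ U.comap J.mkQ)
  · rintro j v _ ⟨m, hm, rfl⟩
    exact ⟨_, jetFil_y j v hm, rfl⟩
  · intro M _ _ _ _ κ hκ
    let F : Pol V ⊗[ℂ] T →ₗ[ℂ] M := TensorProduct.lift
      (((Algebra.lsmul ℂ ℂ M : R.H →ₐ[ℂ] _).toLinearMap ∘ₗ (yAlg R).toLinearMap).compl₂ κ)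
    have hF : ∀ f t, F (f ⊗ₜ t) = yAlg R f • κ t := fun f t => rfl
    have hFY : ∀ v m, F (jetY T v m) = R.y v • F m := by
      intro v m
      rw [jetY_apply]
      induction m using TensorProduct.induction_on with
      | zero => simp
      | tmul f e => rw [smul_tmul', smul_eq_mul, hF, hF, map_mul, yAlg_ι, mul_smul]
      | add u v hu hv => rw [smul_add, map_add, hu, hv, map_add, smul_add]
    have hFt : ∀ t, F (1 ⊗ₜ t) = κ t := fun t => by rw [hF, map_one, one_smul]
    have hFN : ∀ m, F m ∈ nilp R M N := by
      have h := pol_tensor_top ((nilp R M N).comap F)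
        (fun t => by rw [Submodule.mem_comap, hFt]; exact hκ t) (fun v m hm => by
          rw [Submodule.mem_comap, ← jetY_apply, hFY]; exact nilp_y v hm)
      exact fun m => (h ▸ Submodule.mem_top : m ∈ (nilp R M N).comap F)
    have hFJ : ∀ j i : ℕ, i + j = N → ∀ m ∈ jetFil V T j, F m ∈ nilp R M i := by
      intro j
      induction j with
      | zero => rintro i rfl m _; exact hFN m
      | succ j ih =>
        intro i hij
        change jetFil V T (j + 1) ≤ (nilp R M i).comap F
        rw [jetFil, Submodule.map₂_le]
        intro v _ m hm
        rw [Submodule.mem_comap, hFY]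
        exact ih (i + 1) (by omega) m hm v
    refine ⟨J.liftQ F fun m hm => ?_, hFt, fun v e => ?_⟩
    · exact hFJ N 0 (zero_add _) m hm
    · obtain ⟨m, rfl⟩ := J.mkQ_surjective e
      exact hFY v m

/-- A module representing vectors of a given type killed by products of `N` lowering operators. -/
structure ProjGen (ρ : G.W →* (T ≃ₗ[ℂ] T)) (N : ℕ) where
  Q : Type
  [ab : AddCommGroup Q]
  [modH : Module R.H Q]
  [modC : Module ℂ Q]
  [modS : Module (Pol (Dual ℂ V)) Q]
  [towerCH : IsScalarTower ℂ R.H Q]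
  [towerSH : IsScalarTower (Pol (Dual ℂ V)) R.H Q]
  [towerCS : IsScalarTower ℂ (Pol (Dual ℂ V)) Q]
  projective : Module.Projective (Pol (Dual ℂ V)) Q
  finite : Module.Finite (Pol (Dual ℂ V)) Q
  locNilp : LocNilp R Q
  k : T →ₗ[ℂ] Q
  k_w : ∀ g t, R.w g • k t = k (ρ g t)
  gen : Submodule.span R.H (Set.range k) = ⊤
  lift : ∀ (M : Type) [AddCommGroup M] [Module R.H M] [Module ℂ M] [Module (Pol (Dual ℂ V)) M]
    [IsScalarTower ℂ R.H M] [IsScalarTower (Pol (Dual ℂ V)) R.H M]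
    [IsScalarTower ℂ (Pol (Dual ℂ V)) M] (κ : T →ₗ[ℂ] M),
    (∀ g t, R.w g • κ t = κ (ρ g t)) → (∀ t, κ t ∈ nilp R M N) →
    ∃ φ : Q →ₗ[R.H] M, ∀ t, φ (k t) = κ t

attribute [instance] ProjGen.ab ProjGen.modH ProjGen.modC ProjGen.modS ProjGen.towerCH
  ProjGen.towerSH ProjGen.towerCS ProjGen.projective ProjGen.finite

variable {R} in
theorem locNilp_of_xgen {M E : Type} [AddCommGroup M] [Module R.H M] [Module ℂ M]
    [Module (Pol (Dual ℂ V)) M] [IsScalarTower ℂ R.H M] [IsScalarTower (Pol (Dual ℂ V)) R.H M]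
    [IsScalarTower ℂ (Pol (Dual ℂ V)) M] [AddCommGroup E] [Module ℂ E] {k : E →ₗ[ℂ] M}
    (hk : Submodule.span (Pol (Dual ℂ V)) (Set.range k) = ⊤) {N : ℕ}
    (h : ∀ e, k e ∈ nilp R M N) : LocNilp R M := by
  have hdir : Monotone (nilp R M) := monotone_nat_of_le_succ fun _ => nilp_mono
  have : ∀ m, m ∈ ⨆ j, nilp R M j := fun m =>
    xgen_induction hk _ (fun e => Submodule.mem_iSup_of_mem N (h e)) (fun a m hm => by
      obtain ⟨j, hj⟩ := (Submodule.mem_iSup_of_directed _ hdir.directed_le).1 hm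
      rw [← x_smul R]
      exact Submodule.mem_iSup_of_mem (j + 1) (nilp_x a hj)) m
  exact fun m => (Submodule.mem_iSup_of_directed _ hdir.directed_le).1 (this m)

theorem exists_projGen [FiniteDimensional ℂ T] (hc : IsConjInvariant c)
    (ρ : G.W →* (T ≃ₗ[ℂ] T)) (N : ℕ) : Nonempty (ProjGen R ρ N) := by
  obtain ⟨J⟩ := exists_jetData R ρ N
  obtain ⟨I⟩ := exists_indData R hc J.σ J.Y J.σ_Y J.Y_comm
  have hnil : ∀ i j : ℕ, i + j = N → ∀ e ∈ J.fil j, I.κ e ∈ nilp R I.Q i := by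
    intro i
    induction i with
    | zero =>
      intro j hj e he
      rw [zero_add] at hj
      subst hj
      rw [J.fil_N, Submodule.mem_bot] at he
      rw [he, map_zero]
      exact zero_mem _
    | succ i ih =>
      intro j hj e he v
      rw [I.κ_y]
      exact ih (j + 1) (by omega) _ (J.fil_Y j v e he)
  refine ⟨{ Q := I.Q
            projective := I.projective
            finite := I.finite inferInstance
            locNilp := locNilp_of_xgen I.span_eq (N := N) fun e =>
              hnil N 0 rfl e (J.fil_zero ▸ Submodule.mem_top)
            k := I.κ ∘ₗ J.k
            k_w := fun g t => by
              rw [LinearMap.comp_apply, I.κ_w, J.σ_k]; rfl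
            gen := ?_
            lift := ?_ }⟩
  · have h := J.gen (((Submodule.span R.H (Set.range (I.κ ∘ₗ J.k))).restrictScalars ℂ).comap I.κ)
      (fun t => Submodule.subset_span ⟨t, rfl⟩) fun v e he => by
        rw [Submodule.mem_comap, ← I.κ_y]
        exact Submodule.smul_mem (Submodule.span R.H (Set.range (I.κ ∘ₗ J.k))) _ he
    have h' : Submodule.span (Pol (Dual ℂ V)) (Set.range I.κ) ≤
        (Submodule.span R.H (Set.range (I.κ ∘ₗ J.k))).restrictScalars _ := by
      rw [Submodule.span_le]
      rintro _ ⟨e, rfl⟩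
      exact (h ▸ Submodule.mem_top : e ∈ _)
    rw [I.span_eq] at h'
    exact eq_top_iff.2 fun q _ => h' (x := q) trivial
  · intro M _ _ _ _ _ _ _ κ hκw hκ
    obtain ⟨F, hFk, hFY⟩ := J.lift M κ hκ
    have hw : ∀ e g, R.w g • F e = F (J.σ g e) := by
      have h := J.gen
        { carrier := {e | ∀ g, R.w g • F e = F (J.σ g e)}
          add_mem' := fun {a b} ha hb g => by rw [map_add, smul_add, ha, hb, map_add, map_add]
          zero_mem' := fun g => by simp
          smul_mem' := fun r e he g => by
            rw [map_smul, smul_smul_comm', he, map_smul, map_smul] }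
        (fun t g => by rw [hFk, hκw, J.σ_k, hFk])
        (fun v e he g => by rw [hFY, w_y_smul, he, J.σ_Y, hFY])
      intro e
      exact (h ▸ Submodule.mem_top : e ∈ _)
    obtain ⟨φ, hφ⟩ := I.lift M F (fun v e => (hFY v e).symm) (fun g e => hw e g)
    exact ⟨φ, fun t => by rw [LinearMap.comp_apply, hφ, hFk]⟩

end Jet

end Cherednik

namespace Cherednik

section CatOInstances

variable {R : RCA G D c}

/-- The underlying vector space of an object of category `O`. -/
@[reducible] def catOModC (X : CatO R) : Module ℂ X.M := Module.compHom X.M (algebraMap ℂ R.H)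

/-- The underlying module over coordinate functions of an object of category `O`. -/
@[reducible] def catOModS (X : CatO R) : Module (Pol (Dual ℂ V)) X.M :=
  Module.compHom X.M (xAlg R).toRingHom

attribute [local instance] catOModC catOModS

theorem catO_towerCH (X : CatO R) : IsScalarTower ℂ R.H X.M :=
  ⟨fun r h m => by
    change _ = algebraMap ℂ R.H r • h • m
    rw [Algebra.smul_def, mul_smul]⟩

theorem catO_towerSH (X : CatO R) : IsScalarTower (Pol (Dual ℂ V)) R.H X.M :=
  ⟨fun f h m => by
    change _ = xAlg R f • h • m
    rw [pol_smul_def, mul_smul]⟩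

theorem catO_towerCS (X : CatO R) : IsScalarTower ℂ (Pol (Dual ℂ V)) X.M :=
  ⟨fun r f m => by
    change xAlg R (r • f) • m = algebraMap ℂ R.H r • xAlg R f • m
    rw [map_smul, Algebra.smul_def, mul_smul]⟩

attribute [local instance] catO_towerCH catO_towerSH catO_towerCS

theorem catO_locNilp (X : CatO R) : LocNilp R X.M := fun m => by
  obtain ⟨k, hk⟩ := X.locNilp m
  exact ⟨k, mem_nilp_iff.2 hk⟩

end CatOInstances

section Representations

/-- The representation on a stable subspace. -/
def subRep {M : Type} [AddCommGroup M] [Module ℂ M] (σ : G.W →* Module.End ℂ M)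
    (U : Submodule ℂ M) (hU : ∀ g, ∀ u ∈ U, σ g u ∈ U) : G.W →* (U ≃ₗ[ℂ] U) :=
  (LinearMap.GeneralLinearGroup.generalLinearEquiv ℂ U).toMonoidHom.comp
    (MonoidHom.toHomUnits
      { toFun := fun g => (σ g).restrict (hU g)
        map_one' := LinearMap.ext fun u => Subtype.ext (by
          change σ 1 u = u
          rw [map_one]; rfl)
        map_mul' := fun g g' => LinearMap.ext fun u => Subtype.ext (by
          change σ (g * g') u = σ g (σ g' u)
          rw [map_mul]; rfl) })

theorem exists_irr_sub {M : Type} [AddCommGroup M] [Module ℂ M] (σ : G.W →* Module.End ℂ M)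
    (U₀ : Submodule ℂ M) [FiniteDimensional ℂ U₀] (hU₀ : ∀ g, ∀ u ∈ U₀, σ g u ∈ U₀)
    (h0 : U₀ ≠ ⊥) :
    ∃ (τ : WRep G) (j : τ.T →ₗ[ℂ] M), τ.IsIrr ∧ Function.Injective j ∧ (∀ t, j t ∈ U₀) ∧
      ∀ g t, σ g (j t) = j (τ.ρ g t) := by
  classical
  have hex : ∃ d : ℕ, ∃ U : Submodule ℂ M, U ≠ ⊥ ∧ U ≤ U₀ ∧ (∀ g, ∀ u ∈ U, σ g u ∈ U) ∧
      finrank ℂ U = d := ⟨_, U₀, h0, le_rfl, hU₀, rfl⟩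
  obtain ⟨U, hU, hUU₀, hUσ, hd⟩ := Nat.find_spec hex
  have hfd : FiniteDimensional ℂ U := Submodule.finiteDimensional_of_le hUU₀
  refine ⟨{ T := U, ρ := subRep σ U hUσ }, U.subtype, ⟨?_, fun U' hU' => ?_⟩,
    U.subtype_injective, fun t => hUU₀ t.2, fun g t => rfl⟩
  · exact Submodule.nontrivial_iff_ne_bot.2 hU
  · by_contra hcon
    push Not at hcon
    have h1 : U'.map U.subtype ≠ ⊥ := fun h => hcon.1
      (Submodule.map_injective_of_injective U.subtype_injective (h.trans (Submodule.map_bot _).symm))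
    have h2 : finrank ℂ (U'.map U.subtype) = finrank ℂ U' :=
      (Submodule.equivMapOfInjective _ U.subtype_injective U').finrank_eq.symm
    have h3 : finrank ℂ U' < finrank ℂ U := Submodule.finrank_lt hcon.2
    refine Nat.find_min hex (m := finrank ℂ U') (by rw [← hd]; exact h3)
      ⟨U'.map U.subtype, h1, ?_, ?_, h2⟩
    · rintro _ ⟨u, -, rfl⟩
      exact hUU₀ u.2
    · rintro g _ ⟨u, hu, rfl⟩
      exact ⟨_, hU' g u hu, rfl⟩

/-- The action of the reflection group on a module over the Cherednik algebra. -/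
def actW (R : RCA G D c) (M : Type) [AddCommGroup M] [Module R.H M] [Module ℂ M]
    [IsScalarTower ℂ R.H M] : G.W →* Module.End ℂ M :=
  (Algebra.lsmul ℂ ℂ M : R.H →ₐ[ℂ] Module.End ℂ M).toMonoidHom.comp R.w

theorem irr_iso_of_injective {τ σ : WRep G} (hσ : σ.IsIrr) (hτ : τ.IsIrr) (f : σ.T →ₗ[ℂ] τ.T)
    (hf : Function.Injective f) (hfw : ∀ g t, f (σ.ρ g t) = τ.ρ g (f t)) : σ.Iso τ := by
  have hs : Function.Surjective f := by
    rw [← LinearMap.range_eq_top]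
    refine (hτ.2 (LinearMap.range f) ?_).resolve_left fun h => ?_
    · rintro g _ ⟨t, rfl⟩
      exact ⟨_, hfw g t⟩
    · obtain ⟨t, ht⟩ := @exists_ne _ hσ.1 (0 : σ.T)
      have : f t ∈ LinearMap.range f := ⟨t, rfl⟩
      rw [h, Submodule.mem_bot] at this
      exact ht (hf (this.trans f.map_zero.symm))
  exact ⟨LinearEquiv.ofBijective f ⟨hf, hs⟩, hfw⟩

end Representations

section Verma

variable {R : RCA G D c} {n : ℕ} {b : Basis (Fin n) ℂ V} {τ : WRep G}
  {M N : Type} [AddCommGroup M] [Module R.H M] [Module ℂ M] [Module (Pol (Dual ℂ V)) M]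
  [IsScalarTower ℂ R.H M] [IsScalarTower (Pol (Dual ℂ V)) R.H M]
  [IsScalarTower ℂ (Pol (Dual ℂ V)) M]
  [AddCommGroup N] [Module R.H N] [Module ℂ N] [IsScalarTower ℂ R.H N]

/-- The inclusion of the lowest weight space as a linear map. -/
def vι (hM : VermaStr R τ M) : τ.T →ₗ[ℂ] M where
  toFun := hM.ι
  map_add' := hM.ι.map_add
  map_smul' r t := by rw [hM.ι_smul, alg_smul]; rfl

theorem vι_y (hM : VermaStr R τ M) (v : V) (t : τ.T) : R.y v • vι hM t = 0 := hM.ι_y v t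

theorem vι_w (hM : VermaStr R τ M) (g : G.W) (t : τ.T) : R.w g • vι hM t = vι hM (τ.ρ g t) :=
  hM.ι_w g t

theorem verma_lift (hM : VermaStr R τ M) (κ : τ.T →ₗ[ℂ] N) (hy : ∀ v t, R.y v • κ t = 0)
    (hw : ∀ g t, R.w g • κ t = κ (τ.ρ g t)) : ∃ φ : M →ₗ[R.H] N, ∀ t, φ (vι hM t) = κ t :=
  (hM.universal N κ.toAddMonoidHom
    (fun a t => by rw [alg_smul]; exact κ.map_smul a t) hy hw).exists

theorem verma_ext (hM : VermaStr R τ M) {φ ψ : M →ₗ[R.H] N} (h : ∀ t, φ (vι hM t) = ψ (vι hM t)) :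
    φ = ψ := by
  refine (hM.universal N (ψ.toAddMonoidHom.comp hM.ι)
    (fun a t => ?_) (fun v t => ?_) (fun g t => ?_)).unique h (fun t => rfl)
  · change ψ (hM.ι (a • t)) = _ • ψ (hM.ι t)
    rw [hM.ι_smul, map_smul]
  · change R.y v • ψ (hM.ι t) = 0
    rw [← map_smul, hM.ι_y, map_zero]
  · change R.w g • ψ (hM.ι t) = ψ (hM.ι (τ.ρ g t))
    rw [← map_smul, hM.ι_w]

theorem exists_ind_equiv (hc : IsConjInvariant c) (hM : VermaStr R τ M) :
    ∃ (I : IndData R τ.ρ (0 : V →ₗ[ℂ] Module.End ℂ τ.T)) (e : I.Q ≃ₗ[R.H] M),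
      ∀ t, e (I.κ t) = vι hM t := by
  obtain ⟨I⟩ := exists_indData R hc τ.ρ (0 : V →ₗ[ℂ] Module.End ℂ τ.T)
    (fun g v e => by simp) (fun u v e => by simp)
  obtain ⟨ψ, hψ⟩ := I.lift M (vι hM) (fun v e => by rw [vι_y]; simp) (fun g e => vι_w hM g e)
  obtain ⟨φ, hφ⟩ := verma_lift hM I.κ (fun v t => by rw [I.κ_y]; simp) (fun g t => I.κ_w g t)
  have h1 : ψ ∘ₗ φ = LinearMap.id :=
    verma_ext hM fun t => by rw [LinearMap.comp_apply, hφ, hψ]; rfl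
  have h2 : ∀ q, φ (ψ q) = q := by
    intro q
    let U : Submodule ℂ I.Q := LinearMap.eqLocus ((φ ∘ₗ ψ).restrictScalars ℂ) LinearMap.id
    refine xgen_induction I.span_eq U (fun t => ?_) (fun a m hm => ?_) q
    · change φ (ψ (I.κ t)) = I.κ t
      rw [hψ, hφ]
    · change φ (ψ (polι a • m)) = polι a • m
      rw [map_pol_smul, map_pol_smul]
      congr 1
  exact ⟨I, LinearEquiv.ofLinearMap ψ φ h1 (LinearMap.ext h2), hψ⟩

theorem vι_injective (hc : IsConjInvariant c) (hM : VermaStr R τ M) :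
    Function.Injective (vι hM) := by
  obtain ⟨I, e, he⟩ := exists_ind_equiv hc hM
  intro s t h
  rw [← he, ← he] at h
  exact I.κ_inj (e.injective h)

theorem verma_span (hc : IsConjInvariant c) (hM : VermaStr R τ M) :
    Submodule.span (Pol (Dual ℂ V)) (Set.range (vι hM)) = ⊤ := by
  obtain ⟨I, e, he⟩ := exists_ind_equiv hc hM
  have h : Set.range (vι hM) = (e.restrictScalars (Pol (Dual ℂ V))).toLinearMap '' Set.range I.κ := by
    rw [← Set.range_comp]
    congr 1
    exact funext fun t => (he t).symm
  rw [h, ← Submodule.map_span, I.span_eq, Submodule.map_top, LinearMap.range_eq_top]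
  exact e.surjective

theorem vι_mem_nilp (hM : VermaStr R τ M) (t : τ.T) : vι hM t ∈ nilp R M 1 := fun v => by
  rw [vι_y]; exact zero_mem _

theorem verma_locNilp (hc : IsConjInvariant c) (hM : VermaStr R τ M) : LocNilp R M :=
  locNilp_of_xgen (verma_span hc hM) (vι_mem_nilp hM)

variable {a : ℂ}

theorem verma_wt_decomp (hc : IsConjInvariant c) (hM : VermaStr R τ M)
    (ha : ∀ t, eulerElt R b • vι hM t = a • vι hM t) (m : M) :
    m ∈ LinearMap.range (vι hM) ⊔ ⨆ k : ℕ, wt R b M (a + (k + 1 : ℕ)) := by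
  refine xgen_induction (verma_span hc hM) _ (fun t =>
    Submodule.mem_sup_left (LinearMap.mem_range_self _ t)) ?_ m
  intro x m hm
  rw [← x_smul R]
  have h : LinearMap.range (vι hM) ⊔ ⨆ k : ℕ, wt R b M (a + (k + 1 : ℕ)) ≤
      (LinearMap.range (vι hM) ⊔ ⨆ k : ℕ, wt R b M (a + (k + 1 : ℕ))).comap (act R (R.x x)) := by
    refine sup_le ?_ (iSup_le fun k u hu => ?_)
    · rintro _ ⟨t, rfl⟩
      refine Submodule.mem_sup_right (Submodule.mem_iSup_of_mem 0 ?_)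
      rw [zero_add, Nat.cast_one]
      exact wt_x x (wt_of_eigen (ha t))
    · refine Submodule.mem_sup_right (Submodule.mem_iSup_of_mem (k + 1) ?_)
      rw [Nat.cast_succ (k + 1), ← add_assoc]
      exact wt_x x hu
  exact h hm

theorem verma_wt_eq (hc : IsConjInvariant c) (hM : VermaStr R τ M)
    (ha : ∀ t, eulerElt R b • vι hM t = a • vι hM t) {m : M} (hm : m ∈ wt R b M a) :
    ∃ t, vι hM t = m := by
  have hL := verma_locNilp hc hM
  obtain ⟨_, ⟨t, rfl⟩, u, hu, rfl⟩ := Submodule.mem_sup.1 (verma_wt_decomp hc hM ha m)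
  refine ⟨t, ?_⟩
  have h1 : pr (b := b) hc hL a u = 0 := by
    have : ⨆ k : ℕ, wt R b M (a + (k + 1 : ℕ)) ≤ LinearMap.ker (pr (b := b) hc hL a) :=
      iSup_le fun k u hu => pr_ne hc hL (by
        intro h
        have : ((k + 1 : ℕ) : ℂ) = 0 := by linear_combination h
        exact Nat.succ_ne_zero k (Nat.cast_eq_zero.1 this)) hu
    exact this hu
  have h2 := pr_self hc hL hm
  rw [map_add, h1, add_zero, pr_self hc hL (wt_of_eigen (ha t))] at h2
  exact h2

theorem verma_wt_exists (hc : IsConjInvariant c) (hM : VermaStr R τ M)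
    (ha : ∀ t, eulerElt R b • vι hM t = a • vι hM t) {μ : ℂ} {m : M} (hm : m ∈ wt R b M μ)
    (h0 : m ≠ 0) : ∃ k : ℕ, μ = a + k := by
  by_contra hcon
  push Not at hcon
  have hL := verma_locNilp hc hM
  have h1 : LinearMap.range (vι hM) ⊔ ⨆ k : ℕ, wt R b M (a + (k + 1 : ℕ)) ≤
      LinearMap.ker (pr (b := b) hc hL μ) := by
    refine sup_le ?_ (iSup_le fun k u hu => pr_ne hc hL (hcon _).symm hu)
    rintro _ ⟨t, rfl⟩
    refine pr_ne hc hL (fun h => hcon 0 ?_) (wt_of_eigen (ha t))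
    rw [← h, Nat.cast_zero, add_zero]
  have h2 := h1 (verma_wt_decomp hc hM ha m)
  rw [LinearMap.mem_ker, pr_self hc hL hm] at h2
  exact h0 h2

/-- Projections onto weight spaces preserve submodules. -/
theorem pr_mem_submodule (hc : IsConjInvariant c) (hN : LocNilp R N) (K : Submodule R.H N) (μ : ℂ)
    {m : N} (hm : m ∈ K) : pr (b := b) hc hN μ m ∈ K := by
  have hK : LocNilp R K := hN.of_injective K.subtype K.subtype_injective
  have h : ((pr (b := b) hc hK μ ⟨m, hm⟩ : K) : N) = pr (b := b) hc hN μ m :=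
    map_pr hc hK hN K.subtype μ ⟨m, hm⟩
  rw [← h]
  exact Subtype.prop _

theorem verma_submodule_eq_top (hc : IsConjInvariant c) (hτ : τ.IsIrr) (hM : VermaStr R τ M)
    (K : Submodule R.H M) {t : τ.T} (ht : t ≠ 0) (htK : vι hM t ∈ K) : K = ⊤ := by
  have h1 := (hτ.2 ((K.restrictScalars ℂ).comap (vι hM)) (fun g t ht => by
    rw [Submodule.mem_comap, ← vι_w]
    exact K.smul_mem _ ht)).resolve_left fun h => ht (by
      have : t ∈ (K.restrictScalars ℂ).comap (vι hM) := htK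
      rwa [h] at this)
  have h2 : Submodule.span (Pol (Dual ℂ V)) (Set.range (vι hM)) ≤ K.restrictScalars _ := by
    rw [Submodule.span_le]
    rintro _ ⟨t, rfl⟩
    exact (h1 ▸ Submodule.mem_top : t ∈ _)
  rw [verma_span hc hM] at h2
  exact eq_top_iff.2 fun m _ => h2 (x := m) trivial

theorem verma_pr_eq_zero (hc : IsConjInvariant c) (hτ : τ.IsIrr) (hM : VermaStr R τ M)
    (ha : ∀ t, eulerElt R b • vι hM t = a • vι hM t) {K : Submodule R.H M} (hK : K ≠ ⊤)
    {m : M} (hm : m ∈ K) : pr (b := b) hc (verma_locNilp hc hM) a m = 0 := by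
  by_contra h0
  obtain ⟨t, ht⟩ := verma_wt_eq hc hM ha (pr_mem hc (verma_locNilp hc hM) a m)
  refine hK (verma_submodule_eq_top hc hτ hM K (t := t) ?_ ?_)
  · rintro rfl
    rw [map_zero] at ht
    exact h0 ht.symm
  · rw [ht]
    exact pr_mem_submodule hc _ K a hm

theorem verma_isGreatestProper (hc : IsConjInvariant c) (hτ : τ.IsIrr) (hM : VermaStr R τ M)
    (ha : ∀ t, eulerElt R b • vι hM t = a • vι hM t) {K : Submodule R.H M} (hK : IsCoatom K) :
    IsGreatestProper K := by
  refine ⟨hK.1, fun K' hK' => ?_⟩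
  by_contra hle
  have htop : K ⊔ K' = ⊤ := hK.2 _ (left_lt_sup.2 hle)
  obtain ⟨t, ht⟩ := @exists_ne _ hτ.1 (0 : τ.T)
  obtain ⟨u, hu, v, hv, huv⟩ := Submodule.mem_sup.1 (htop ▸ Submodule.mem_top : vι hM t ∈ K ⊔ K')
  have h1 := pr_self hc (verma_locNilp hc hM) (wt_of_eigen (ha t))
  rw [← huv, map_add, verma_pr_eq_zero hc hτ hM ha hK.1 hu, verma_pr_eq_zero hc hτ hM ha hK' hv,
    add_zero, huv] at h1
  exact ht (vι_injective hc hM (h1.symm.trans (map_zero _).symm))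

end Verma

end Cherednik

namespace Cherednik

attribute [local instance] catOModC catOModS catO_towerCH catO_towerSH catO_towerCS

section Serre

variable {R : RCA G D c} {n : ℕ} {b : Basis (Fin n) ℂ V} {Vobj : WRep G → CatO R}
  {hVobj : ∀ τ, VermaStr R τ (Vobj τ).M} {cF : WRep G → ℂ}

variable (b hVobj cF) in
/-- The Euler element acts on the lowest weight spaces of Verma modules by `cF`. -/
def IsCharge : Prop := ∀ τ : WRep G, τ.IsIrr → ∀ t : τ.T,
  eulerElt R b • (hVobj τ).ι t = algebraMap ℂ R.H (cF τ) • (hVobj τ).ι t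

theorem IsCharge.eigen (hcF : IsCharge b hVobj cF) {τ : WRep G} (hτ : τ.IsIrr) (t : τ.T) :
    eulerElt R b • vι (hVobj τ) t = cF τ • vι (hVobj τ) t := hcF τ hτ t

theorem IsCharge.eq_of_map (hcF : IsCharge b hVobj cF) {τ : WRep G} (hτ : τ.IsIrr)
    {L : Type} [AddCommGroup L] [Module R.H L] [Module ℂ L] [IsScalarTower ℂ R.H L]
    {j : τ.T →ₗ[ℂ] L} (hy : ∀ v t, R.y v • j t = 0)
    (hw : ∀ g t, R.w g • j t = j (τ.ρ g t)) (t : τ.T) : j t ∈ wt R b L (cF τ) := by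
  obtain ⟨φ, hφ⟩ := verma_lift (hVobj τ) j hy hw
  rw [← hφ]
  exact wt_map φ (wt_of_eigen (hcF.eigen hτ t))

theorem wt_unique {L : Type} [AddCommGroup L] [Module R.H L] [Module ℂ L] [IsScalarTower ℂ R.H L]
    {μ ν : ℂ} {l : L} (h0 : l ≠ 0) (hμ : l ∈ wt R b L μ) (hν : l ∈ wt R b L ν) : μ = ν := by
  by_contra h
  exact h0 (Submodule.disjoint_def.1 ((euler R b L).independent_maxGenEigenspace.pairwiseDisjoint h)
    l hμ hν)

theorem IsCharge.iso_eq (hcF : IsCharge b hVobj cF) (hc : IsConjInvariant c) {τ σ : WRep G}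
    (hτ : τ.IsIrr) (hσ : σ.IsIrr) (h : σ.Iso τ) : cF σ = cF τ := by
  obtain ⟨e, he⟩ := h
  obtain ⟨t, ht⟩ := @exists_ne _ hσ.1 (0 : σ.T)
  let j : σ.T →ₗ[ℂ] (Vobj τ).M := vι (hVobj τ) ∘ₗ e.toLinearMap
  have hj : Function.Injective j := (vι_injective hc (hVobj τ)).comp e.injective
  have h1 : j t ∈ wt R b (Vobj τ).M (cF σ) := hcF.eq_of_map hσ
    (fun v t => vι_y (hVobj τ) v _) (fun g t => (vι_w (hVobj τ) g _).trans (by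
      change _ = vι (hVobj τ) (e (σ.ρ g t))
      rw [he]; rfl)) t
  have h2 : j t ∈ wt R b (Vobj τ).M (cF τ) := wt_of_eigen (hcF.eigen hτ _)
  exact wt_unique (fun h => ht (hj (h.trans j.map_zero.symm))) h1 h2

theorem nilp_one_ne_bot {L : Type} [AddCommGroup L] [Module R.H L] [Module ℂ L]
    [IsScalarTower ℂ R.H L] [Nontrivial L] (hL : LocNilp R L) : nilp R L 1 ≠ ⊥ := by
  intro h
  have hk : ∀ k, nilp R L k = ⊥ := by
    intro k
    induction k with
    | zero => rfl
    | succ k ih =>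
      rw [← h]
      ext m
      rw [mem_nilp_succ, mem_nilp_succ, ih]
      rfl
  obtain ⟨l, hl⟩ := exists_ne (0 : L)
  obtain ⟨k, hk'⟩ := hL l
  rw [hk] at hk'
  exact hl ((Submodule.mem_bot ℂ).1 hk')

/-- A simple module contains an irreducible representation killed by lowering operators. -/
theorem exists_lowest {L : Type} [AddCommGroup L] [Module R.H L] [Module ℂ L]
    [IsScalarTower ℂ R.H L] [Nontrivial L] (hL : LocNilp R L) :
    ∃ (σ : WRep G) (j : σ.T →ₗ[ℂ] L), σ.IsIrr ∧ Function.Injective j ∧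
      (∀ v t, R.y v • j t = 0) ∧ ∀ g t, R.w g • j t = j (σ.ρ g t) := by
  obtain ⟨l, hl, hl0⟩ := (Submodule.ne_bot_iff _).1 (nilp_one_ne_bot hL)
  let U : Submodule ℂ L := Submodule.span ℂ (Set.range fun g : G.W => R.w g • l)
  have hfd : FiniteDimensional ℂ U := FiniteDimensional.span_of_finite ℂ (Set.finite_range _)
  have hUw : ∀ g, ∀ u ∈ U, actW R L g u ∈ U := by
    intro g
    change U ≤ U.comap (actW R L g)
    rw [Submodule.span_le]
    rintro _ ⟨g', rfl⟩
    refine Submodule.subset_span ⟨g * g', ?_⟩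
    change R.w (g * g') • l = R.w g • R.w g' • l
    rw [map_mul, mul_smul]
  have hUn : U ≤ nilp R L 1 := by
    rw [Submodule.span_le]
    rintro _ ⟨g, rfl⟩
    exact nilp_w g hl
  have hU0 : U ≠ ⊥ := (Submodule.ne_bot_iff _).2 ⟨l, Submodule.subset_span ⟨1, by simp⟩, hl0⟩
  obtain ⟨σ, j, hσ, hj, hjU, hjw⟩ := exists_irr_sub (actW R L) U hUw hU0
  exact ⟨σ, j, hσ, hj, fun v t => (Submodule.mem_bot ℂ).1 (hUn (hjU t) v), hjw⟩

theorem IsCharge.exists_simple (hcF : IsCharge b hVobj cF) (hc : IsConjInvariant c)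
    {L : Type} [AddCommGroup L] [Module R.H L] [Module ℂ L] [IsScalarTower ℂ R.H L]
    [IsSimpleModule R.H L] (hL : LocNilp R L) :
    ∃ (σ : WRep G) (j : σ.T →ₗ[ℂ] L), σ.IsIrr ∧ Function.Injective j ∧
      (∀ g t, R.w g • j t = j (σ.ρ g t)) ∧ (∀ t, j t ∈ wt R b L (cF σ)) ∧
      ∃ N' : Submodule R.H (Vobj σ).M, IsGreatestProper N' ∧
        Nonempty (L ≃ₗ[R.H] ((Vobj σ).M ⧸ N')) := by
  have := IsSimpleModule.nontrivial R.H L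
  obtain ⟨σ, j, hσ, hj, hjy, hjw⟩ := exists_lowest hL
  obtain ⟨φ, hφ⟩ := verma_lift (hVobj σ) j hjy hjw
  have hsurj : Function.Surjective φ := by
    refine (LinearMap.surjective_or_eq_zero φ).resolve_right fun h => ?_
    obtain ⟨t, ht⟩ := @exists_ne _ hσ.1 (0 : σ.T)
    refine ht (hj ?_)
    rw [← hφ, h, map_zero]; rfl
  let e := LinearMap.quotKerEquivOfSurjective φ hsurj
  have hco : IsCoatom (LinearMap.ker φ) :=
    isSimpleModule_iff_isCoatom.1 (IsSimpleModule.congr e)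
  exact ⟨σ, j, hσ, hj, hjw, fun t => hcF.eq_of_map hσ hjy hjw t, LinearMap.ker φ,
    verma_isGreatestProper hc hσ (hVobj σ) (hcF.eigen hσ) hco, ⟨e.symm⟩⟩

theorem IsCharge.inSerreLE (hcF : IsCharge b hVobj cF) (hc : IsConjInvariant c) {τ : WRep G}
    (hτ : τ.IsIrr) : InSerreLE R cF Vobj τ (Vobj τ).M := by
  intro N K hsimple
  have hV := verma_locNilp hc (hVobj τ)
  have hN : LocNilp R N := hV.of_injective N.subtype N.subtype_injective
  have hL : LocNilp R (↥N ⧸ K) := hN.of_surjective K.mkQ K.mkQ_surjective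
  obtain ⟨σ, j, hσ, hj, hjw, hjwt, hiso⟩ := hcF.exists_simple (L := ↥N ⧸ K) hc hL
  refine ⟨σ, hσ, ?_, hiso⟩
  obtain ⟨κ, hκ1, hκw, hκwt⟩ := exists_equivariant_lift hc hN K.mkQ K.mkQ_surjective σ.ρ j hjw hjwt
  let f : σ.T →ₗ[ℂ] (Vobj τ).M := (N.subtype.restrictScalars ℂ) ∘ₗ κ
  have hfwt : ∀ t, f t ∈ wt R b (Vobj τ).M (cF σ) := fun t => wt_map N.subtype (hκwt t)
  have hfinj : Function.Injective f := by
    refine N.subtype_injective.comp fun s t h => hj ?_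
    rw [← hκ1, ← hκ1, h]
  have hfw : ∀ g t, f (σ.ρ g t) = R.w g • f t := by
    intro g t
    change N.subtype (κ (σ.ρ g t)) = _
    rw [← hκw, map_smul]; rfl
  obtain ⟨t, ht⟩ := @exists_ne _ hσ.1 (0 : σ.T)
  obtain ⟨k, hk⟩ := verma_wt_exists hc (hVobj τ) (hcF.eigen hτ) (hfwt t)
    (fun h => ht (hfinj (h.trans f.map_zero.symm)))
  rcases Nat.eq_zero_or_pos k with rfl | hpos
  · left
    rw [Nat.cast_zero, add_zero] at hk
    have hrange : ∀ s, f s ∈ LinearMap.range (vι (hVobj τ)) := fun s =>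
      verma_wt_eq hc (hVobj τ) (hcF.eigen hτ) (hk ▸ hfwt s)
    let e := LinearEquiv.ofInjective (vι (hVobj τ)) (vι_injective hc (hVobj τ))
    let f' : σ.T →ₗ[ℂ] τ.T := e.symm.toLinearMap ∘ₗ f.codRestrict _ hrange
    have hf' : ∀ s, vι (hVobj τ) (f' s) = f s := fun s => by
      have := congrArg Subtype.val (e.apply_symm_apply (f.codRestrict _ hrange s))
      exact this
    refine irr_iso_of_injective hσ hτ f' (fun s s' h => hfinj ?_) (fun g s => ?_)
    · rw [← hf', ← hf', h]
    · apply vι_injective hc (hVobj τ)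
      rw [hf', hfw, ← vι_w, hf']
  · exact Or.inr ⟨k, hpos, by rw [hk]; ring⟩

theorem IsCharge.wt_eq_bot_of_inSerreLE (hcF : IsCharge b hVobj cF) (hc : IsConjInvariant c)
    {τ : WRep G} (hτ : τ.IsIrr)
    {X : Type} [AddCommGroup X] [Module R.H X] [Module ℂ X] [IsScalarTower ℂ R.H X]
    (h : InSerreLE R cF Vobj τ X) {k : ℕ} (hk : 0 < k) :
    wt R b X (cF τ - k) = ⊥ := by
  by_contra hne
  obtain ⟨v, hv, hv0⟩ := (Submodule.ne_bot_iff _).1 hne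
  let N : Submodule R.H X := Submodule.span R.H {v}
  have hfin : Module.Finite R.H N := Module.Finite.iff_fg.2 ⟨{v}, by simp [N]⟩
  have hvN : v ∈ N := Submodule.mem_span_singleton_self v
  have hbt : (⊥ : Submodule R.H N) ≠ ⊤ := by
    intro h
    have : (⟨v, hvN⟩ : N) ∈ (⊥ : Submodule R.H N) := h ▸ Submodule.mem_top
    exact hv0 (congrArg Subtype.val ((Submodule.mem_bot R.H).1 this))
  obtain ⟨K, hK, -⟩ := (eq_top_or_exists_le_coatom (⊥ : Submodule R.H N)).resolve_left hbt
  obtain ⟨σ, hσ, hle, N', hN', ⟨e⟩⟩ := h N K (isSimpleModule_iff_isCoatom.2 hK)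
  have hvK : K.mkQ ⟨v, hvN⟩ ≠ 0 := by
    intro h0
    rw [Submodule.mkQ_apply, Submodule.Quotient.mk_eq_zero] at h0
    refine hK.1 (eq_top_iff.2 ?_)
    rintro ⟨u, hu⟩ -
    obtain ⟨r, rfl⟩ := Submodule.mem_span_singleton.1 hu
    exact K.smul_mem r h0
  have hvwt : K.mkQ ⟨v, hvN⟩ ∈ wt R b (↥N ⧸ K) (cF τ - k) :=
    wt_map K.mkQ (wt_of_injective N.subtype N.subtype_injective hv)
  have hV := verma_locNilp hc (hVobj σ)
  obtain ⟨u, hu, hu'⟩ := exists_wt_preimage hc hV N'.mkQ N'.mkQ_surjective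
    (wt_map e.toLinearMap hvwt)
  have hu0 : u ≠ 0 := by
    rintro rfl
    rw [map_zero] at hu'
    exact hvK (e.injective (hu'.symm.trans (map_zero e).symm))
  obtain ⟨j, hj⟩ := verma_wt_exists hc (hVobj σ) (hcF.eigen hσ) hu hu0
  have : ∃ m : ℕ, cF σ = cF τ + m := by
    rcases hle with h | ⟨m, -, hm⟩
    · exact ⟨0, by rw [hcF.iso_eq hc hτ hσ h]; simp⟩
    · exact ⟨m, by rw [← hm]; ring⟩
  obtain ⟨m, hm⟩ := this
  have h0 : ((k + j + m : ℕ) : ℂ) = 0 := by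
    push_cast
    rw [hm] at hj
    linear_combination -hj
  have := Nat.cast_eq_zero.1 h0
  omega

end Serre

end Cherednik

namespace Cherednik

section Lifting

variable {R : RCA G D c} {n : ℕ} {b : Basis (Fin n) ℂ V} {T : Type} [AddCommGroup T] [Module ℂ T]
  {ρ : G.W →* (T ≃ₗ[ℂ] T)} {N : ℕ}

theorem ProjGen.ext (Q : ProjGen R ρ N) {M : Type} [AddCommGroup M] [Module R.H M]
    {f g : Q.Q →ₗ[R.H] M} (h : ∀ t, f (Q.k t) = g (Q.k t)) : f = g :=
  LinearMap.ext_on Q.gen (by rintro _ ⟨t, rfl⟩; exact h t)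

/-- Lifting a generalized eigenspace copy of `T` through a surjection. -/
theorem ProjGen.lift_wt (hc : IsConjInvariant c) (Q : ProjGen R ρ N) {a : ℂ}
    (hN : ∀ (M : Type) [AddCommGroup M] [Module R.H M] [Module ℂ M]
      [IsScalarTower ℂ R.H M], LocNilp R M → wt R b M a ≤ nilp R M N)
    {E X : Type} [AddCommGroup E] [Module R.H E] [Module ℂ E] [IsScalarTower ℂ R.H E]
    [AddCommGroup X] [Module R.H X] [Module ℂ X] [IsScalarTower ℂ R.H X]
    (hE : LocNilp R E) (p : E →ₗ[R.H] X) (hp : Function.Surjective p) (κ : T →ₗ[ℂ] X)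
    (hκw : ∀ g t, R.w g • κ t = κ (ρ g t)) (hκ : ∀ t, κ t ∈ wt R b X a) :
    ∃ h : Q.Q →ₗ[R.H] E, (∀ t, p (h (Q.k t)) = κ t) ∧ ∀ t, h (Q.k t) ∈ wt R b E a := by
  obtain ⟨κ', h1, h2, h3⟩ := exists_equivariant_lift hc hE p hp ρ κ hκw hκ
  let _ : Module (Pol (Dual ℂ V)) E := Module.compHom E (xAlg R).toRingHom
  have : IsScalarTower (Pol (Dual ℂ V)) R.H E := ⟨fun f h m => by
    change _ = xAlg R f • h • m
    rw [pol_smul_def, mul_smul]⟩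
  have : IsScalarTower ℂ (Pol (Dual ℂ V)) E := ⟨fun r f m => by
    change xAlg R (r • f) • m = r • xAlg R f • m
    rw [map_smul, smul_assoc]⟩
  obtain ⟨φ, hφ⟩ := Q.lift E κ' h2 fun t => hN E hE (h3 t)
  exact ⟨φ, fun t => by rw [hφ, h1], fun t => by rw [hφ]; exact h3 t⟩

end Lifting

section Cover

variable {R : RCA G D c} {n : ℕ} (b : Basis (Fin n) ℂ V) {τ : WRep G}
  {M : Type} [AddCommGroup M] [Module R.H M]

/-- A projective cover of a Verma module of lowest weight `a`. -/
structure Cover (hM : VermaStr R τ M) (a : ℂ) where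
  P : Type
  [ab : AddCommGroup P]
  [modH : Module R.H P]
  [modC : Module ℂ P]
  [modS : Module (Pol (Dual ℂ V)) P]
  [towerCH : IsScalarTower ℂ R.H P]
  [towerSH : IsScalarTower (Pol (Dual ℂ V)) R.H P]
  [towerCS : IsScalarTower ℂ (Pol (Dual ℂ V)) P]
  projective : Module.Projective (Pol (Dual ℂ V)) P
  finite : Module.Finite (Pol (Dual ℂ V)) P
  locNilp : LocNilp R P
  π : P →ₗ[R.H] M
  k : τ.T →ₗ[ℂ] P
  k_w : ∀ g t, R.w g • k t = k (τ.ρ g t)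
  k_wt : ∀ t, k t ∈ wt R b P a
  gen : Submodule.span R.H (Set.range k) = ⊤
  π_k : ∀ t, π (k t) = hM.ι t
  lift : ∀ (E X : Type) [AddCommGroup E] [Module R.H E] [Module ℂ E] [IsScalarTower ℂ R.H E]
    [AddCommGroup X] [Module R.H X] [Module ℂ X] [IsScalarTower ℂ R.H X],
    LocNilp R E → ∀ (p : E →ₗ[R.H] X), Function.Surjective p → ∀ f : P →ₗ[R.H] X,
    ∃ f' : P →ₗ[R.H] E, p.comp f' = f
  essential : ∀ K : Submodule R.H P, K.map π = ⊤ → K = ⊤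

attribute [instance] Cover.ab Cover.modH Cover.modC Cover.modS Cover.towerCH
  Cover.towerSH Cover.towerCS Cover.projective Cover.finite

variable [Module ℂ M] [Module (Pol (Dual ℂ V)) M] [IsScalarTower ℂ R.H M]
  [IsScalarTower (Pol (Dual ℂ V)) R.H M] [IsScalarTower ℂ (Pol (Dual ℂ V)) M]

theorem span_vι (hM : VermaStr R τ M) : Submodule.span R.H (Set.range (vι hM)) = ⊤ := by
  have h : (Submodule.span R.H (Set.range (vι hM))).mkQ = 0 :=
    verma_ext hM fun t => by
      rw [LinearMap.zero_apply, Submodule.mkQ_apply, Submodule.Quotient.mk_eq_zero]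
      exact Submodule.subset_span ⟨t, rfl⟩
  rw [← Submodule.ker_mkQ (Submodule.span R.H (Set.range (vι hM))), h, LinearMap.ker_zero]

theorem exists_cover (hc : IsConjInvariant c) (hM : VermaStr R τ M) {a : ℂ}
    (hMn : LocNilp R M) (ha : ∀ t, vι hM t ∈ wt R b M a) : Nonempty (Cover b hM a) := by
  obtain ⟨N, hN⟩ := exists_wt_le_nilp R b hc a
  obtain ⟨Q⟩ := exists_projGen R hc τ.ρ N
  have hQ := Q.locNilp
  have := finiteDimensional_wt (b := b) hc hQ a
  obtain ⟨q, hq⟩ : ∃ q : Q.Q →ₗ[R.H] M, ∀ t, q (Q.k t) = vι hM t := by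
    obtain ⟨h, h1, -⟩ := Q.lift_wt hc hN hMn LinearMap.id Function.surjective_id (vι hM)
      (vι_w hM) ha
    exact ⟨h, h1⟩
  have hqs : Function.Surjective q := by
    rw [← LinearMap.range_eq_top, eq_top_iff, ← span_vι hM, Submodule.span_le]
    rintro _ ⟨t, rfl⟩
    exact ⟨_, hq t⟩
  let S : Set (Q.Q →ₗ[R.H] Q.Q) := {g | q.comp g = q ∧ ∀ t, g (Q.k t) ∈ wt R b Q.Q a}
  let im (g : Q.Q →ₗ[R.H] Q.Q) : Submodule ℂ Q.Q := (wt R b Q.Q a).map (g.restrictScalars ℂ)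
  have hS0 : ∃ g, g ∈ S := by
    obtain ⟨h, h1, h2⟩ := Q.lift_wt hc hN hQ q hqs (vι hM) (vι_w hM) ha
    exact ⟨h, Q.ext fun t => by rw [LinearMap.comp_apply, h1, hq], h2⟩
  obtain ⟨g, hg, hmin⟩ := exists_minimalFor_of_wellFoundedLT (· ∈ S) (fun g => finrank ℂ (im g)) hS0
  have hrange : ∀ h ∈ S, LinearMap.range g ≤ LinearMap.range (g.comp h) := by
    intro h hh
    have hle : im (g.comp h) ≤ im g := by
      rintro _ ⟨m, hm, rfl⟩
      exact ⟨h m, wt_map h hm, rfl⟩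
    have hmem : g.comp h ∈ S := ⟨by rw [← LinearMap.comp_assoc, hg.1, hh.1],
      fun t => wt_map g (hh.2 t)⟩
    have heq : im (g.comp h) = im g :=
      Submodule.eq_of_le_of_finrank_le hle (hmin hmem (Submodule.finrank_mono hle))
    rw [LinearMap.range_eq_map, ← Q.gen, Submodule.map_span, Submodule.span_le]
    rintro _ ⟨_, ⟨t, rfl⟩, rfl⟩
    have h1 : g (Q.k t) ∈ im g := by
      refine ⟨pr (b := b) hc hQ a (Q.k t), pr_mem hc hQ a _, ?_⟩
      change g _ = _
      rw [map_pr hc hQ hQ, pr_self hc hQ (hg.2 t)]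
    rw [← heq] at h1
    obtain ⟨m, -, hm⟩ := h1
    exact ⟨m, hm⟩
  let K : Submodule R.H Q.Q := LinearMap.range g
  let gK : K →ₗ[R.H] K := g.restrict fun x _ => ⟨x, rfl⟩
  have hgKs : Function.Surjective gK := by
    rintro ⟨x, hx⟩
    obtain ⟨z, hz⟩ := hrange g hg hx
    exact ⟨⟨g z, z, rfl⟩, Subtype.ext hz⟩
  have hnoeS : IsNoetherian (Pol (Dual ℂ V)) Q.Q := inferInstance
  have hnoe : IsNoetherian R.H Q.Q := isNoetherian_of_tower (Pol (Dual ℂ V)) hnoeS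
  have hgKi : Function.Injective gK := IsNoetherian.injective_of_surjective_endomorphism gK hgKs
  let e : K ≃ₗ[R.H] K := LinearEquiv.ofBijective gK ⟨hgKi, hgKs⟩
  let r : Q.Q →ₗ[R.H] K := e.symm.toLinearMap.comp g.rangeRestrict
  have hr : ∀ x : K, r x = x := fun x => by
    change e.symm _ = x
    rw [LinearEquiv.symm_apply_eq]
    rfl
  have hqr : ∀ m, q (r m) = q m := by
    intro m
    have h1 : q (g (r m)) = q (r m) := LinearMap.congr_fun hg.1 _
    have h2 : g (r m) = g m := congrArg Subtype.val (e.apply_symm_apply (g.rangeRestrict m))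
    rw [← h1, h2]
    exact LinearMap.congr_fun hg.1 _
  have hrwt : ∀ t, r (Q.k t) ∈ wt R b K a := fun t =>
    wt_map e.symm.toLinearMap (wt_of_injective K.subtype K.subtype_injective (hg.2 t))
  have hKn : LocNilp R K := hQ.of_injective K.subtype K.subtype_injective
  have hKfin : Module.Finite (Pol (Dual ℂ V)) K :=
    Module.Finite.of_surjective (r.restrictScalars (Pol (Dual ℂ V))) fun x => ⟨x, hr x⟩
  refine ⟨{
    P := K
    projective := Module.Projective.of_split (K.subtype.restrictScalars (Pol (Dual ℂ V)))
      (r.restrictScalars (Pol (Dual ℂ V))) (LinearMap.ext hr)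
    finite := hKfin
    locNilp := hKn
    π := q.comp K.subtype
    k := (r.restrictScalars ℂ).comp Q.k
    k_w := fun g t => by
      change R.w g • r (Q.k t) = r (Q.k (τ.ρ g t))
      rw [← map_smul, Q.k_w]
    k_wt := hrwt
    gen := ?_
    π_k := fun t => (hqr _).trans (hq t)
    lift := ?_
    essential := ?_ }⟩
  · have : Set.range ((r.restrictScalars ℂ).comp Q.k) = r '' Set.range Q.k := by
      rw [← Set.range_comp]; rfl
    rw [this, ← Submodule.map_span, Q.gen, ← LinearMap.range_eq_map, LinearMap.range_eq_top]
    exact fun x => ⟨x, hr x⟩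
  · intro E X _ _ _ _ _ _ _ _ hE p hp f
    obtain ⟨h, h1, -⟩ := Q.lift_wt hc hN hE p hp
      ((f.restrictScalars ℂ).comp ((r.restrictScalars ℂ).comp Q.k)) (fun g t => by
        change R.w g • f (r (Q.k t)) = f (r (Q.k (τ.ρ g t)))
        rw [← map_smul, ← map_smul, Q.k_w]) fun t => wt_map f (hrwt t)
    have h2 : p.comp h = f.comp r := Q.ext h1
    refine ⟨h.comp K.subtype, LinearMap.ext fun x => ?_⟩
    have := LinearMap.congr_fun h2 (x : Q.Q)
    rw [LinearMap.comp_apply, LinearMap.comp_apply, hr] at this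
    exact this
  · intro K' hK'
    let p : K' →ₗ[R.H] M := (q.comp K.subtype).comp K'.subtype
    have hp : Function.Surjective p := by
      intro m
      obtain ⟨x, hx, rfl⟩ := (hK' ▸ Submodule.mem_top : m ∈ K'.map (q.comp K.subtype))
      exact ⟨⟨x, hx⟩, rfl⟩
    have hK'n : LocNilp R K' := hKn.of_injective K'.subtype K'.subtype_injective
    obtain ⟨h, h1, h2⟩ := Q.lift_wt hc hN hK'n p hp (vι hM) (vι_w hM) ha
    let h' : Q.Q →ₗ[R.H] Q.Q := (K.subtype.comp K'.subtype).comp h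
    have hh' : h' ∈ S := ⟨Q.ext fun t => (h1 t).trans (hq t).symm,
      fun t => wt_map (K.subtype.comp K'.subtype) (h2 t)⟩
    refine eq_top_iff.2 fun x _ => ?_
    obtain ⟨z, hz⟩ := hrange h' hh' (⟨x, rfl⟩ : g x ∈ LinearMap.range g)
    have : ((h z : K') : K) = x := hgKi (Subtype.ext hz)
    rw [← this]
    exact (h z).2

end Cover

end Cherednik

namespace Cherednik

section Splitting

variable {R : RCA G D c} {n : ℕ} {b : Basis (Fin n) ℂ V} {σ : WRep G}
  {M : Type} [AddCommGroup M] [Module R.H M] [Module ℂ M] [Module (Pol (Dual ℂ V)) M]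
  [IsScalarTower ℂ R.H M] [IsScalarTower (Pol (Dual ℂ V)) R.H M]
  [IsScalarTower ℂ (Pol (Dual ℂ V)) M]
  {X : Type} [AddCommGroup X] [Module R.H X] [Module ℂ X] [Module (Pol (Dual ℂ V)) X]
  [IsScalarTower ℂ R.H X] [IsScalarTower (Pol (Dual ℂ V)) R.H X]
  [IsScalarTower ℂ (Pol (Dual ℂ V)) X]

theorem pr_x (hc : IsConjInvariant c) (h : LocNilp R M) (x : Dual ℂ V) (μ : ℂ) (m : M) :
    pr (b := b) hc h (μ + 1) (polι x • m) = polι x • pr (b := b) hc h μ m := by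
  rw [← x_smul R, ← x_smul R]
  refine LinearMap.congr_fun (wt_ext (b := b) (T := pr (b := b) hc h (μ + 1) ∘ₗ act R (R.x x))
    (T' := act R (R.x x) ∘ₗ pr (b := b) hc h μ) hc h fun ν m hm => ?_) m
  change pr (b := b) hc h (μ + 1) (R.x x • m) = R.x x • pr (b := b) hc h μ m
  by_cases hν : ν = μ
  · subst hν
    rw [pr_self hc h hm, pr_self hc h (wt_x x hm)]
  · rw [pr_ne hc h hν hm, pr_ne hc h (fun h => hν (add_right_cancel h)) (wt_x x hm), smul_zero]

/-- Over the coordinate algebra, a Verma module generated in lowest weight splits off any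
projective module. -/
theorem exists_verma_retraction (hc : IsConjInvariant c) (hM : VermaStr R σ M) {a : ℂ}
    (ha : ∀ t, eulerElt R b • vι hM t = a • vι hM t) (hX : LocNilp R X)
    [Module.Projective (Pol (Dual ℂ V)) X] (h0 : wt R b X (a - 1) = ⊥) (φ : M →ₗ[R.H] X)
    (hφ : Function.Injective fun t => φ (vι hM t)) :
    ∃ ψ : X →ₗ[Pol (Dual ℂ V)] M, ∀ m, ψ (φ m) = m := by
  have hMn := verma_locNilp hc hM
  have ha' : ∀ t, vι hM t ∈ wt R b M a := fun t => wt_of_eigen (ha t)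
  have hM0 : wt R b M (a - 1) = ⊥ := by
    refine (Submodule.eq_bot_iff _).2 fun m hm => ?_
    by_contra hne
    obtain ⟨k, hk⟩ := verma_wt_exists hc hM ha hm hne
    have : ((k + 1 : ℕ) : ℂ) = 0 := by push_cast; linear_combination -hk
    exact Nat.succ_ne_zero k (Nat.cast_eq_zero.1 this)
  have hkill : ∀ {Y : Type} [AddCommGroup Y] [Module R.H Y] [Module ℂ Y]
      [Module (Pol (Dual ℂ V)) Y] [IsScalarTower ℂ R.H Y]
      [IsScalarTower (Pol (Dual ℂ V)) R.H Y] [IsScalarTower ℂ (Pol (Dual ℂ V)) Y]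
      (hY : LocNilp R Y), wt R b Y (a - 1) = ⊥ → ∀ (x : Dual ℂ V) (m : Y),
      pr (b := b) hc hY a (polι x • m) = 0 := by
    intro Y _ _ _ _ _ _ _ hY hY0 x m
    have h1 := pr_x (b := b) hc hY x (a - 1) m
    have h2 : pr (b := b) hc hY (a - 1) m ∈ wt R b Y (a - 1) := pr_mem hc hY _ m
    rw [hY0, Submodule.mem_bot] at h2
    rwa [sub_add_cancel, h2, smul_zero] at h1
  let K₀ : Submodule (Pol (Dual ℂ V)) M :=
    polSubmodule (LinearMap.ker (pr (b := b) hc hMn a)) fun x m _ => hkill hMn hM0 x m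
  let j : σ.T →ₗ[ℂ] X := (φ.restrictScalars ℂ) ∘ₗ vι hM
  obtain ⟨r, hr⟩ := LinearMap.exists_leftInverse_of_injective j (LinearMap.ker_eq_bot.2 hφ)
  let θ₀ : X →ₗ[ℂ] M ⧸ K₀ :=
    (K₀.mkQ.restrictScalars ℂ) ∘ₗ vι hM ∘ₗ r ∘ₗ pr (b := b) hc hX a
  have hθ₀ : ∀ (x : Dual ℂ V) (m : X), θ₀ (polι x • m) = polι x • θ₀ m := by
    intro x m
    change K₀.mkQ (vι hM (r (pr (b := b) hc hX a (polι x • m)))) =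
      polι x • K₀.mkQ (vι hM (r (pr (b := b) hc hX a m)))
    rw [hkill hX h0, map_zero, map_zero, map_zero, ← map_smul, eq_comm, Submodule.mkQ_apply,
      Submodule.Quotient.mk_eq_zero]
    exact hkill hMn hM0 x _
  obtain ⟨ψ, hψ⟩ := Module.projective_lifting_property K₀.mkQ (polLinear θ₀ hθ₀)
    K₀.mkQ_surjective
  have hψ' : ∀ m, pr (b := b) hc hMn a (ψ m) = vι hM (r (pr (b := b) hc hX a m)) := by
    intro m
    have h1 : K₀.mkQ (ψ m) = K₀.mkQ (vι hM (r (pr (b := b) hc hX a m))) :=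
      LinearMap.congr_fun hψ m
    rw [Submodule.mkQ_apply, Submodule.mkQ_apply, Submodule.Quotient.eq] at h1
    have h2 : pr (b := b) hc hMn a (ψ m - vι hM (r (pr (b := b) hc hX a m))) = 0 := h1
    rwa [map_sub, pr_self hc hMn (ha' _), sub_eq_zero] at h2
  obtain ⟨ψ₀, hψ₀⟩ := exists_glue (f := euler R b X) (hX.iSup_wt hc)
    fun μ => pr (b := b) hc hMn μ ∘ₗ ψ.restrictScalars ℂ
  have hψ₀x : ∀ (x : Dual ℂ V) (m : X), ψ₀ (polι x • m) = polι x • ψ₀ m := by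
    intro x m
    rw [← x_smul R, ← x_smul R]
    refine LinearMap.congr_fun (wt_ext (b := b) (T := ψ₀ ∘ₗ act R (R.x x))
      (T' := act R (R.x x) ∘ₗ ψ₀) hc hX fun ν m hm => ?_) m
    change ψ₀ (R.x x • m) = R.x x • ψ₀ m
    rw [hψ₀ _ _ (wt_x x hm), hψ₀ _ _ hm]
    change pr (b := b) hc hMn (ν + 1) (ψ (R.x x • m)) = R.x x • pr (b := b) hc hMn ν (ψ m)
    rw [x_smul R, x_smul R, map_smul, pr_x]
  refine ⟨polLinear ψ₀ hψ₀x, fun m => ?_⟩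
  refine xgen_induction (verma_span hc hM)
    (LinearMap.eqLocus (ψ₀ ∘ₗ φ.restrictScalars ℂ) LinearMap.id) (fun t => ?_) ?_ m
  · change ψ₀ (φ (vι hM t)) = vι hM t
    have h1 : φ (vι hM t) ∈ wt R b X a := wt_map φ (ha' t)
    rw [hψ₀ _ _ h1]
    change pr (b := b) hc hMn a (ψ _) = _
    rw [hψ', pr_self hc hX h1]
    exact congrArg _ (LinearMap.congr_fun hr t)
  · intro x m hm
    change ψ₀ (φ (polι x • m)) = polι x • m
    have hm' : ψ₀ (φ m) = m := hm
    rw [map_pol_smul, hψ₀x, hm']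

theorem projective_quotient_range (φ : M →ₗ[R.H] X) (ψ : X →ₗ[Pol (Dual ℂ V)] M)
    (h : ∀ m, ψ (φ m) = m) [Module.Projective (Pol (Dual ℂ V)) X] :
    Module.Projective (Pol (Dual ℂ V)) (X ⧸ LinearMap.range φ) := by
  let φ' := φ.restrictScalars (Pol (Dual ℂ V))
  let i₀ : (X ⧸ (LinearMap.range φ).restrictScalars (Pol (Dual ℂ V))) →ₗ[Pol (Dual ℂ V)] X :=
    Submodule.liftQ _ (LinearMap.id - φ' ∘ₗ ψ) (by
      rintro _ ⟨m, rfl⟩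
      change φ m - φ (ψ (φ m)) = 0
      rw [h, sub_self])
  let i := i₀ ∘ₗ
    (Submodule.Quotient.restrictScalarsEquiv (Pol (Dual ℂ V)) (LinearMap.range φ)).symm.toLinearMap
  refine Module.Projective.of_split i
    ((LinearMap.range φ).mkQ.restrictScalars (Pol (Dual ℂ V))) (LinearMap.ext fun x => ?_)
  obtain ⟨x, rfl⟩ := (LinearMap.range φ).mkQ_surjective x
  change (LinearMap.range φ).mkQ (x - φ (ψ x)) = _
  rw [map_sub, LinearMap.id_apply, sub_eq_self, Submodule.mkQ_apply, Submodule.Quotient.mk_eq_zero]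
  exact ⟨_, rfl⟩

end Splitting

section Filtration

variable {R : RCA G D c} {Vobj : WRep G → CatO R} {cF : WRep G → ℂ} {τ : WRep G}
  {P : Type} [AddCommGroup P] [Module R.H P]

variable (Vobj cF τ) in
/-- The subquotient `B / A` is a Verma module of weight strictly above `τ`. -/
def VermaStep (A B : Submodule R.H P) : Prop :=
  ∃ τ' : WRep G, τ'.IsIrr ∧ cLT cF τ τ' ∧
    Nonempty ((↥B ⧸ Submodule.comap B.subtype A) ≃ₗ[R.H] (Vobj τ').M)

variable (Vobj cF τ) in
/-- `F` has a finite filtration by Verma modules of weights strictly above `τ`. -/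
def VermaFiltered (F : Submodule R.H P) : Prop :=
  ∃ (m : ℕ) (Ch : Fin (m + 1) → Submodule R.H P), Monotone Ch ∧ Ch 0 = ⊥ ∧ Ch (Fin.last m) = F ∧
    ∀ i : Fin m, VermaStep Vobj cF τ (Ch i.castSucc) (Ch i.succ)

theorem VermaFiltered.bot : VermaFiltered Vobj cF τ (⊥ : Submodule R.H P) :=
  ⟨0, fun _ => ⊥, monotone_const, rfl, rfl, fun i => i.elim0⟩

theorem VermaFiltered.extend {F F' : Submodule R.H P} (h : VermaFiltered Vobj cF τ F)
    (hle : F ≤ F') (hs : VermaStep Vobj cF τ F F') : VermaFiltered Vobj cF τ F' := by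
  obtain ⟨m, Ch, hmono, h0, hlast, hstep⟩ := h
  refine ⟨m + 1, Fin.snoc (α := fun _ => Submodule R.H P) Ch F', Fin.monotone_iff_le_succ.2 ?_,
    ?_, Fin.snoc_last _ _, ?_⟩
  · intro i
    induction i using Fin.lastCases with
    | last => rw [Fin.snoc_castSucc, Fin.succ_last, Fin.snoc_last, hlast]; exact hle
    | cast i =>
      rw [Fin.snoc_castSucc, Fin.succ_castSucc, Fin.snoc_castSucc]
      exact hmono (Fin.castSucc_lt_succ).le
  · rw [← Fin.castSucc_zero, Fin.snoc_castSucc, h0]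
  · intro i
    induction i using Fin.lastCases with
    | last => rw [Fin.snoc_castSucc, Fin.succ_last, Fin.snoc_last, hlast]; exact hs
    | cast i =>
      rw [Fin.snoc_castSucc, Fin.succ_castSucc, Fin.snoc_castSucc]
      exact hstep i

end Filtration

end Cherednik

namespace Cherednik

attribute [local instance] catOModC catOModS catO_towerCH catO_towerSH catO_towerCS

section CoverKernel

variable {R : RCA G D c} {n : ℕ} {b : Basis (Fin n) ℂ V} {τ : WRep G}
  {M : Type} [AddCommGroup M] [Module R.H M] [Module ℂ M] [Module (Pol (Dual ℂ V)) M]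
  [IsScalarTower ℂ R.H M] [IsScalarTower (Pol (Dual ℂ V)) R.H M]
  [IsScalarTower ℂ (Pol (Dual ℂ V)) M] {hM : VermaStr R τ M} {a : ℂ}

theorem Cover.π_surjective (C : Cover b hM a) : Function.Surjective C.π := by
  rw [← LinearMap.range_eq_top, eq_top_iff, ← span_vι hM, Submodule.span_le]
  rintro _ ⟨t, rfl⟩
  exact ⟨_, C.π_k t⟩

theorem Cover.ker_le (C : Cover b hM a) (K : Submodule R.H C.P)
    (hK : ∀ m ∈ wt R b C.P (a - 1), m ∈ K) : LinearMap.ker C.π ≤ K := by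
  obtain ⟨φ, hφ⟩ := verma_lift hM ((K.mkQ.restrictScalars ℂ) ∘ₗ C.k)
    (fun v t => by
      change R.y v • K.mkQ (C.k t) = 0
      rw [← map_smul, Submodule.mkQ_apply, Submodule.Quotient.mk_eq_zero]
      exact hK _ (wt_y v (C.k_wt t)))
    (fun g t => by
      change R.w g • K.mkQ (C.k t) = K.mkQ (C.k (τ.ρ g t))
      rw [← map_smul, C.k_w])
  have h : φ.comp C.π = K.mkQ := by
    refine LinearMap.ext_on C.gen ?_
    rintro _ ⟨t, rfl⟩
    rw [LinearMap.comp_apply, C.π_k]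
    exact hφ t
  intro m hm
  rw [← Submodule.ker_mkQ K, ← h, LinearMap.mem_ker, LinearMap.comp_apply, LinearMap.mem_ker.1 hm,
    map_zero]

theorem Cover.eq_top_of_sup (C : Cover b hM a) {N : Submodule R.H M} (hN : IsGreatestProper N)
    (K : Submodule R.H C.P) (hK : K ⊔ N.comap C.π = ⊤) : K = ⊤ := by
  refine C.essential K ?_
  by_contra hne
  refine hN.1 (eq_top_iff.2 fun m _ => ?_)
  obtain ⟨p, rfl⟩ := C.π_surjective m
  have h : K ⊔ N.comap C.π ≤ N.comap C.π :=
    sup_le (Submodule.map_le_iff_le_comap.1 (hN.2 _ hne)) le_rfl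
  exact h (hK ▸ Submodule.mem_top : p ∈ K ⊔ N.comap C.π)

theorem verma_wt_sub_eq_bot (hc : IsConjInvariant c) (hM : VermaStr R τ M)
    (ha : ∀ t, eulerElt R b • vι hM t = a • vι hM t) {j : ℕ} (hj : 0 < j) :
    wt R b M (a - j) = ⊥ := by
  refine (Submodule.eq_bot_iff _).2 fun m hm => ?_
  by_contra hne
  obtain ⟨k, hk⟩ := verma_wt_exists hc hM ha hm hne
  have h : ((k + j : ℕ) : ℂ) = 0 := by push_cast; linear_combination -hk
  have := Nat.cast_eq_zero.1 h
  omega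

end CoverKernel

section HighestWeight

variable {R : RCA G D c} {n : ℕ} {b : Basis (Fin n) ℂ V} {Vobj : WRep G → CatO R}
  {hVobj : ∀ τ, VermaStr R τ (Vobj τ).M} {cF : WRep G → ℂ} {τ : WRep G}

theorem Cover.ker_le_of_inSerreLE (hcF : IsCharge b hVobj cF) (hc : IsConjInvariant c)
    (hτ : τ.IsIrr) (C : Cover b (hVobj τ) (cF τ)) (K : Submodule R.H C.P)
    (h : InSerreLE R cF Vobj τ (C.P ⧸ K)) : LinearMap.ker C.π ≤ K := by
  refine C.ker_le K fun m hm => ?_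
  have h1 := hcF.wt_eq_bot_of_inSerreLE hc hτ h Nat.one_pos
  have h2 : K.mkQ m ∈ wt R b (C.P ⧸ K) (cF τ - (1 : ℕ)) := by
    rw [Nat.cast_one]
    exact wt_map K.mkQ hm
  rwa [h1, Submodule.mem_bot, Submodule.mkQ_apply, Submodule.Quotient.mk_eq_zero] at h2

theorem Cover.exists_step (hcF : IsCharge b hVobj cF) (hc : IsConjInvariant c)
    (hτ : τ.IsIrr) (C : Cover b (hVobj τ) (cF τ)) (F : Submodule R.H C.P)
    (hF : F ≤ LinearMap.ker C.π) (hne : F ≠ LinearMap.ker C.π)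
    [Module.Projective (Pol (Dual ℂ V)) (C.P ⧸ F)] :
    ∃ F' : Submodule R.H C.P, F < F' ∧ F' ≤ LinearMap.ker C.π ∧
      Module.Projective (Pol (Dual ℂ V)) (C.P ⧸ F') ∧ VermaStep Vobj cF τ F F' := by
  have hX : LocNilp R (C.P ⧸ F) := C.locNilp.of_surjective F.mkQ F.mkQ_surjective
  have hfin : Module.Finite (Pol (Dual ℂ V)) (C.P ⧸ F) :=
    Module.Finite.of_surjective (F.mkQ.restrictScalars (Pol (Dual ℂ V))) F.mkQ_surjective
  have h1 : wt R b (C.P ⧸ F) (cF τ - (0 + 1 : ℕ)) ≠ ⊥ := by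
    intro h1
    refine hne (le_antisymm hF (C.ker_le F fun m hm => ?_))
    have h2 : F.mkQ m ∈ wt R b (C.P ⧸ F) (cF τ - (0 + 1 : ℕ)) := by
      rw [zero_add, Nat.cast_one]
      exact wt_map F.mkQ hm
    rwa [h1, Submodule.mem_bot, Submodule.mkQ_apply, Submodule.Quotient.mk_eq_zero] at h2
  obtain ⟨j, hj, hj'⟩ : ∃ j : ℕ, wt R b (C.P ⧸ F) (cF τ - (j + 1 : ℕ)) ≠ ⊥ ∧
      wt R b (C.P ⧸ F) (cF τ - (j + 1 + 1 : ℕ)) = ⊥ := by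
    by_contra! hcon
    have hall : ∀ j : ℕ, wt R b (C.P ⧸ F) (cF τ - (j + 1 : ℕ)) ≠ ⊥ := by
      intro j
      induction j with
      | zero => exact h1
      | succ j ih => exact hcon j ih
    obtain ⟨N, hN⟩ := exists_not_mem_wtSet (R := R) (n := n) (cF τ)
    exact hall N (hX.wt_eq_bot hc (hN (N + 1) N.le_succ))
  have hj'' : wt R b (C.P ⧸ F) (cF τ - (j + 1 : ℕ) - 1) = ⊥ := by
    rw [← hj']
    congr 1
    push_cast
    ring
  have := finiteDimensional_wt (b := b) hc hX (cF τ - (j + 1 : ℕ))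
  obtain ⟨σ, i, hσ, hi, hiU, hiw⟩ := exists_irr_sub (actW R (C.P ⧸ F))
    (wt R b (C.P ⧸ F) (cF τ - (j + 1 : ℕ))) (fun g u hu => wt_w hc g hu) hj
  have hiy : ∀ v t, R.y v • i t = 0 := fun v t => by
    have := wt_y v (hiU t)
    rwa [hj'', Submodule.mem_bot] at this
  obtain ⟨t₀, ht₀⟩ := @exists_ne _ hσ.1 (0 : σ.T)
  have hcσ : cF σ = cF τ - (j + 1 : ℕ) :=
    wt_unique (fun h => ht₀ (hi (h.trans i.map_zero.symm))) (hcF.eq_of_map hσ hiy hiw t₀)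
      (hiU t₀)
  obtain ⟨φ, hφ⟩ := verma_lift (hVobj σ) i hiy hiw
  obtain ⟨ψ, hψ⟩ := exists_verma_retraction hc (hVobj σ) (hcF.eigen hσ) hX
    (by rw [hcσ]; exact hj'') φ (fun s t h => hi (by rw [← hφ, ← hφ]; exact h))
  have hφi : Function.Injective φ := Function.LeftInverse.injective hψ
  have hproj := projective_quotient_range φ ψ hψ
  let q : C.P →ₗ[R.H] (C.P ⧸ F) ⧸ LinearMap.range φ := (LinearMap.range φ).mkQ.comp F.mkQ
  have hqs : Function.Surjective q := (LinearMap.range φ).mkQ_surjective.comp F.mkQ_surjective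
  have hmem : ∀ m, m ∈ LinearMap.ker q ↔ F.mkQ m ∈ LinearMap.range φ := fun m => by
    rw [LinearMap.mem_ker, LinearMap.comp_apply, Submodule.mkQ_apply (LinearMap.range φ),
      Submodule.Quotient.mk_eq_zero]
  have hle : F ≤ LinearMap.ker q := fun m hm => by
    rw [hmem, Submodule.mkQ_apply, (Submodule.Quotient.mk_eq_zero _).2 hm]
    exact zero_mem _
  refine ⟨LinearMap.ker q, lt_of_le_of_ne hle ?_, ?_, ?_, σ, hσ, ⟨j + 1, j.succ_pos, ?_⟩, ?_⟩
  · intro heq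
    obtain ⟨m, hm⟩ := F.mkQ_surjective (i t₀)
    have h2 : m ∈ LinearMap.ker q := (hmem m).2 ⟨vι (hVobj σ) t₀, (hφ t₀).trans hm.symm⟩
    rw [← heq, ← Submodule.Quotient.mk_eq_zero F, ← Submodule.mkQ_apply, hm] at h2
    exact ht₀ (hi (h2.trans i.map_zero.symm))
  · let π' : (C.P ⧸ F) →ₗ[R.H] (Vobj τ).M := F.liftQ C.π hF
    have h2 : π'.comp φ = 0 := verma_ext (hVobj σ) fun t => by
      have h3 : π' (i t) ∈ wt R b (Vobj τ).M (cF τ - (j + 1 : ℕ)) := wt_map π' (hiU t)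
      rw [verma_wt_sub_eq_bot hc (hVobj τ) (hcF.eigen hτ) j.succ_pos, Submodule.mem_bot] at h3
      rw [LinearMap.comp_apply, hφ, h3, LinearMap.zero_apply]
    intro m hm
    obtain ⟨d, hd⟩ := (hmem m).1 hm
    have h3 : π' (φ d) = 0 := LinearMap.congr_fun h2 d
    rw [hd] at h3
    exact h3
  · exact Module.Projective.of_equiv
      ((LinearMap.quotKerEquivOfSurjective q hqs).symm.restrictScalars (Pol (Dual ℂ V)))
  · rw [hcσ]; ring
  · let f : ↥(LinearMap.ker q) →ₗ[R.H] LinearMap.range φ :=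
      (F.mkQ.comp (LinearMap.ker q).subtype).codRestrict _ fun m => (hmem m).1 m.2
    have hfs : Function.Surjective f := by
      rintro ⟨x, hx⟩
      obtain ⟨m, rfl⟩ := F.mkQ_surjective x
      exact ⟨⟨m, (hmem m).2 hx⟩, rfl⟩
    have hfk : LinearMap.ker f = F.comap (LinearMap.ker q).subtype := by
      ext m
      rw [LinearMap.mem_ker, Submodule.mem_comap, ← Submodule.Quotient.mk_eq_zero F]
      exact Subtype.ext_iff
    exact ⟨(Submodule.quotEquivOfEq _ _ hfk.symm).trans
      ((LinearMap.quotKerEquivOfSurjective f hfs).trans (LinearEquiv.ofInjective φ hφi).symm)⟩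

theorem Cover.vermaFiltered (hcF : IsCharge b hVobj cF) (hc : IsConjInvariant c)
    (hτ : τ.IsIrr) (C : Cover b (hVobj τ) (cF τ)) :
    VermaFiltered Vobj cF τ (LinearMap.ker C.π) := by
  have hnoeS : IsNoetherian (Pol (Dual ℂ V)) C.P := inferInstance
  have hnoe : IsNoetherian R.H C.P := isNoetherian_of_tower (Pol (Dual ℂ V)) hnoeS
  obtain ⟨F, ⟨hF, hfil, hproj⟩, hmax⟩ := exists_maximalFor_of_wellFoundedGT
    (fun F : Submodule R.H C.P => F ≤ LinearMap.ker C.π ∧ VermaFiltered Vobj cF τ F ∧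
      Module.Projective (Pol (Dual ℂ V)) (C.P ⧸ F)) id
    ⟨⊥, bot_le, .bot, Module.Projective.of_equiv
      ((Submodule.quotEquivOfEqBot (⊥ : Submodule R.H C.P) rfl).symm.restrictScalars
        (Pol (Dual ℂ V)))⟩
  by_cases hne : F = LinearMap.ker C.π
  · exact hne ▸ hfil
  · obtain ⟨F', hlt, hle, hproj', hstep⟩ := C.exists_step hcF hc hτ F hF hne
    exact absurd (hmax ⟨hle, hfil.extend hlt.le hstep, hproj'⟩ hlt.le) hlt.not_ge

/-- The cover as an object of category `O`. -/
def Cover.toCatO (C : Cover b (hVobj τ) (cF τ)) : CatO R where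
  M := C.P
  locNilp m := by
    obtain ⟨k, hk⟩ := C.locNilp m
    exact ⟨k, mem_nilp_iff.1 hk⟩
  fg := Module.Finite.of_restrictScalars_finite (Pol (Dual ℂ V)) R.H C.P

theorem surjective_of_epi {X Y : CatO R} (f : X ⟶ Y) [CategoryTheory.Epi f] :
    Function.Surjective (show X.M →ₗ[R.H] Y.M from f) := by
  let f' : X.M →ₗ[R.H] Y.M := f
  have hY := Y.fg
  let Z : CatO R :=
    { M := Y.M ⧸ LinearMap.range f'
      locNilp := fun z => by
        obtain ⟨y, rfl⟩ := (LinearMap.range f').mkQ_surjective z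
        obtain ⟨N, hN⟩ := Y.locNilp y
        exact ⟨N, fun L hL => by rw [← map_smul, hN L hL, map_zero]⟩
      fg := inferInstance }
  let g : Y ⟶ Z := (LinearMap.range f').mkQ
  let g₀ : Y ⟶ Z := (0 : Y.M →ₗ[R.H] Z.M)
  have h : g = g₀ := (CategoryTheory.cancel_epi f).1 (by
    change (LinearMap.range f').mkQ.comp f' = LinearMap.comp 0 f'
    rw [LinearMap.range_mkQ_comp, LinearMap.zero_comp])
  rw [← LinearMap.range_eq_top, ← Submodule.ker_mkQ (LinearMap.range f')]
  exact (congrArg LinearMap.ker h).trans LinearMap.ker_zero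

theorem Cover.toCatO_projective (C : Cover b (hVobj τ) (cF τ)) :
    CategoryTheory.Projective C.toCatO where
  factors {E X} f e _ := by
    obtain ⟨f', hf'⟩ := C.lift E.M X.M (catO_locNilp E) (show E.M →ₗ[R.H] X.M from e)
      (surjective_of_epi e) f
    exact ⟨f', hf'⟩

end HighestWeight

end Cherednik

/-- **`𝒪_c(W)` is a highest weight category** (GGOR), with respect to the order
`≤_c`, with standard objects the Verma modules: for each irreducible `τ` there
is a projective cover `P_c(τ)` of `L_c(τ)` surjecting onto `Δ_c(τ)`, the Verma
module `Δ_c(τ)` is the maximal quotient of `P_c(τ)` lying in the Serre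
subcategory generated by the simples `L_c(τ')` with `τ' ≤_c τ` (so the standard
object corresponding to `L_c(τ)` is `Δ_c(τ)`), and the kernel of
`P_c(τ) ↠ Δ_c(τ)` is filtered with successive quotients `Δ_c(τ')`, `τ' >_c τ`. -/
theorem catO_highest_weight
    (hc : IsConjInvariant c) (R : RCA G D c)
    {n : ℕ} (b : Basis (Fin n) ℂ V)
    -- a choice of Verma module `Δ_c(τ)` in `𝒪_c(W)` for each `τ`
    (Vobj : WRep G → CatO R) (hVobj : ∀ τ, VermaStr R τ (Vobj τ).M)
    -- `cF τ` is the scalar by which the Euler element acts on `τ ⊂ Δ_c(τ)`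
    (cF : WRep G → ℂ)
    (hcF : ∀ τ : WRep G, τ.IsIrr → ∀ t : τ.T,
      eulerElt R b • (hVobj τ).ι t = algebraMap ℂ R.H (cF τ) • (hVobj τ).ι t) :
    ∀ τ : WRep G, τ.IsIrr →
      ∃ (P : CatO R) (π : P.M →ₗ[R.H] (Vobj τ).M),
        CategoryTheory.Projective P ∧ Function.Surjective π ∧
        -- `P` is a projective cover of `L_c(τ)`: the composition
        -- `P ↠ Δ_c(τ) ↠ L_c(τ)` is an essential epimorphism
        (∀ N : Submodule R.H (Vobj τ).M, IsGreatestProper N →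
          ∀ K : Submodule R.H P.M, K ⊔ Submodule.comap π N = ⊤ → K = ⊤) ∧
        -- `Δ_c(τ)` lies in `𝒪_{≤ τ}` …
        InSerreLE R cF Vobj τ (Vobj τ).M ∧
        -- … and is the *maximal* quotient of `P` lying in `𝒪_{≤ τ}`
        (∀ K : Submodule R.H P.M, InSerreLE R cF Vobj τ (P.M ⧸ K) →
          LinearMap.ker π ≤ K) ∧
        -- the kernel of `P ↠ Δ_c(τ)` is filtered by `Δ_c(τ')` with `τ' >_c τ`
        (∃ (m : ℕ) (Ch : Fin (m + 1) → Submodule R.H P.M),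
          Monotone Ch ∧ Ch 0 = ⊥ ∧ Ch (Fin.last m) = LinearMap.ker π ∧
          ∀ i : Fin m, ∃ τ' : WRep G, τ'.IsIrr ∧ cLT cF τ τ' ∧
            Nonempty
              ((↥(Ch i.succ) ⧸
                  Submodule.comap (Ch i.succ).subtype (Ch i.castSucc))
                ≃ₗ[R.H] (Vobj τ').M)) := by
  intro τ hτ
  have hcF' : Cherednik.IsCharge b hVobj cF := hcF
  let _ := Cherednik.catOModC (Vobj τ)
  let _ := Cherednik.catOModS (Vobj τ)
  have := Cherednik.catO_towerCH (Vobj τ)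
  have := Cherednik.catO_towerSH (Vobj τ)
  have := Cherednik.catO_towerCS (Vobj τ)
  obtain ⟨C⟩ := Cherednik.exists_cover b hc (hVobj τ) (Cherednik.catO_locNilp (Vobj τ))
    fun t => Cherednik.wt_of_eigen (hcF'.eigen hτ t)
  exact ⟨C.toCatO, C.π, C.toCatO_projective, C.π_surjective, fun N hN => C.eq_top_of_sup hN,
    hcF'.inSerreLE hc hτ, C.ker_le_of_inSerreLE hcF' hc hτ, C.vermaFiltered hcF' hc hτ⟩

end
end Stmt5
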